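/- arXiv:1211.2576 — 3 statements merged into one kernel-verified Lean document; each statement's English description precedes it below -/
import Mathlib

section
/- Let (M₁,φ₁) and (M₂,φ₂) be von Neumann probability spaces with central supports z₁ = z_{φ₁} and z₂ = z_{φ₂}. Suppose for j = 1,2 that S⁽ʲ⁾ = {x⁽ʲ⁾_i : i ∈ I} is a set of self-adjoint elements of M_j, indexed by the same set I, which generates M_j as a von Neumann algebra, and suppose φ₁(x⁽¹⁾_𝐢) = φ₂(x⁽²⁾_𝐢) for every finite multi-index 𝐢 ∈ I*. Then there exists a unique *-isomorphism θ : M₁z₁ → M₂z₂ such that φ₂ ∘ θ agrees with φ₁ on M₁z₁ and θ(x⁽¹⁾_i z₁) = x⁽²⁾_i z₂ for all i ∈ I. -/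
set_option synthInstance.maxHeartbeats 400000
set_option maxHeartbeats 1000000

open scoped InnerProductSpace ComplexConjugate

noncomputable section

namespace Paper

variable {H : Type} [NormedAddCommGroup H] [InnerProductSpace ℂ H] [CompleteSpace H]
variable {H' : Type} [NormedAddCommGroup H'] [InnerProductSpace ℂ H'] [CompleteSpace H']

/-- An operator is a (self-adjoint, idempotent) orthogonal projection. -/
def IsProjection (p : H →L[ℂ] H) : Prop := IsSelfAdjoint p ∧ p * p = p

/-- The vector state determined by a vector `Ω`. -/
def vecState (Ω : H) (x : H →L[ℂ] H) : ℂ := ⟪x Ω, Ω⟫_ℂ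

/-- A normal state on a von Neumann algebra, described via its canonical form as a
countable convex combination of vector states. -/
def IsNormalState (M : Set (H →L[ℂ] H)) (φ : (H →L[ℂ] H) → ℂ) : Prop :=
  ∃ ξ : ℕ → H, (Summable fun n => ‖ξ n‖ ^ 2) ∧ (∑' n, ‖ξ n‖ ^ 2) = 1 ∧
    ∀ x ∈ M, φ x = ∑' n, ⟪x (ξ n), ξ n⟫_ℂ

/-- Normality (complete additivity) of a map between operator algebras: it is `σ`-weakly
continuous, equivalently it preserves sums of orthogonal families of projections lying in the
given domain `S`. -/
def IsNormalMapOn (S : Set (H →L[ℂ] H)) (Θ : (H →L[ℂ] H) → (H' →L[ℂ] H')) : Prop :=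
  ∀ {ι : Type} (p : ι → (H →L[ℂ] H)) (q : H →L[ℂ] H),
    (∀ i, p i ∈ S) → q ∈ S →
    (∀ i, IsProjection (p i)) → (∀ i k, i ≠ k → p i * p k = 0) →
    (∀ ξ : H, HasSum (fun i => p i ξ) (q ξ)) →
    ∀ ξ : H', HasSum (fun i => Θ (p i) ξ) (Θ q ξ)

/-- `Θ` is a `*`-homomorphism on the subset `S` (typically a von Neumann algebra). -/
structure IsStarHomOn (S : Set (H →L[ℂ] H)) (Θ : (H →L[ℂ] H) → (H' →L[ℂ] H')) : Prop where
  map_add : ∀ x ∈ S, ∀ y ∈ S, Θ (x + y) = Θ x + Θ y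
  map_smul : ∀ (c : ℂ), ∀ x ∈ S, Θ (c • x) = c • Θ x
  map_mul : ∀ x ∈ S, ∀ y ∈ S, Θ (x * y) = Θ x * Θ y
  map_star : ∀ x ∈ S, Θ (star x) = star (Θ x)

/-- The (self-adjoint part of the) center of `S` is trivial. -/
def IsFactorSet (S : Set (H →L[ℂ] H)) : Prop :=
  ∀ x ∈ S, (∀ y ∈ S, x * y = y * x) → ∃ c : ℂ, x = c • (1 : H →L[ℂ] H)

/-- A type `I` factor: a factor possessing a minimal projection. -/
def IsTypeIFactorSet (S : Set (H →L[ℂ] H)) : Prop :=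
  IsFactorSet S ∧ ∃ p ∈ S, p ≠ 0 ∧ IsProjection p ∧
    ∀ q ∈ S, IsProjection q → q * p = q → q = 0 ∨ q = p

/-- `z` is the central support of the normal state `φ` of the von Neumann algebra `S`, i.e. the
smallest central projection of full measure. -/
structure IsCentralSupport (S : Set (H →L[ℂ] H)) (φ : (H →L[ℂ] H) → ℂ) (z : H →L[ℂ] H) :
    Prop where
  mem : z ∈ S
  proj : IsProjection z
  central : ∀ y ∈ S, z * y = y * z
  full : φ z = 1
  min : ∀ w ∈ S, IsProjection w → (∀ y ∈ S, w * y = y * w) → φ w = 1 → z * w = z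

/-- The von Neumann algebra generated by a (self-adjoint) set of operators. -/
def vN (S : Set (H →L[ℂ] H)) : Set (H →L[ℂ] H) := Set.centralizer (Set.centralizer S)

variable {I : Type}

/-- The properties required of the isomorphism `θ : M₁z₁ → M₂z₂` in Proposition 2.1:
it is a normal `*`-isomorphism of `M₁z₁` onto `M₂z₂`, it intertwines the states, and it sends
`x₁ i · z₁` to `x₂ i · z₂`. -/
structure Stmt0Iso (M₁ : Set (H →L[ℂ] H)) (M₂ : Set (H' →L[ℂ] H'))
    (φ₁ : (H →L[ℂ] H) → ℂ) (φ₂ : (H' →L[ℂ] H') → ℂ)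
    (x₁ : I → (H →L[ℂ] H)) (x₂ : I → (H' →L[ℂ] H'))
    (z₁ : H →L[ℂ] H) (z₂ : H' →L[ℂ] H')
    (θ : (H →L[ℂ] H) → (H' →L[ℂ] H')) : Prop where
  mapsTo : Set.MapsTo θ ((· * z₁) '' M₁) ((· * z₂) '' M₂)
  surjOn : Set.SurjOn θ ((· * z₁) '' M₁) ((· * z₂) '' M₂)
  injOn : Set.InjOn θ ((· * z₁) '' M₁)
  hom : IsStarHomOn ((· * z₁) '' M₁) θ
  normal : IsNormalMapOn ((· * z₁) '' M₁) θ
  state : ∀ a ∈ (· * z₁) '' M₁, φ₂ (θ a) = φ₁ a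
  gen : ∀ i : I, θ (x₁ i * z₁) = x₂ i * z₂

section Generic

variable {E K₁ K₂ : Type*} [AddCommGroup E] [Module ℂ E]
  [NormedAddCommGroup K₁] [InnerProductSpace ℂ K₁] [CompleteSpace K₁]
  [NormedAddCommGroup K₂] [InnerProductSpace ℂ K₂] [CompleteSpace K₂]

lemma isoExt (Φ₁ : E →ₗ[ℂ] K₁) (Φ₂ : E →ₗ[ℂ] K₂)
    (h : ∀ f g, ⟪Φ₁ f, Φ₁ g⟫_ℂ = ⟪Φ₂ f, Φ₂ g⟫_ℂ) :
    ∃ V : K₁ →L[ℂ] K₂, (∀ f, V (Φ₁ f) = Φ₂ f) ∧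
      ∀ η, (∀ f, ⟪Φ₁ f, η⟫_ℂ = 0) → V η = 0 := by
  set L := (LinearMap.range Φ₁).topologicalClosure with hL
  have hmem : ∀ f, Φ₁ f ∈ L := fun f =>
    Submodule.le_topologicalClosure _ (LinearMap.mem_range_self _ f)
  have : CompleteSpace L := (Submodule.isClosed_topologicalClosure _).completeSpace_coe
  let e : E →ₗ[ℂ] L := Φ₁.codRestrict L hmem
  have hd : DenseRange e := by
    intro y
    rw [Metric.mem_closure_iff]
    intro ε hε
    have hy : (y : K₁) ∈ closure (LinearMap.range Φ₁ : Set K₁) := y.2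
    obtain ⟨_, ⟨f, rfl⟩, hf⟩ := Metric.mem_closure_iff.1 hy ε hε
    exact ⟨e f, ⟨f, rfl⟩, hf⟩
  have hn : ∀ f, ‖Φ₂ f‖ ≤ 1 * ‖e f‖ := by
    intro f
    have h1 : ‖e f‖ = ‖Φ₁ f‖ := rfl
    have h2 := h f f
    rw [inner_self_eq_norm_sq_to_K, inner_self_eq_norm_sq_to_K] at h2
    have h3 : ‖Φ₁ f‖ ^ 2 = ‖Φ₂ f‖ ^ 2 := by exact_mod_cast h2
    rw [h1, one_mul]
    exact (pow_le_pow_iff_left₀ (norm_nonneg _) (norm_nonneg _) two_ne_zero).1 h3.ge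
  refine ⟨(Φ₂.extendOfNorm e) ∘L L.orthogonalProjectionOnto, ?_, ?_⟩
  · intro f
    have : L.orthogonalProjectionOnto (Φ₁ f) = e f :=
      Submodule.orthogonalProjectionOnto_mem_subspace_eq_self (e f)
    rw [ContinuousLinearMap.comp_apply, this]
    exact LinearMap.extendOfNorm_eq hd ⟨1, hn⟩ f
  · intro η hη
    have hm : η ∈ Lᗮ := by
      rw [hL, Submodule.orthogonal_closure]
      rintro _ ⟨f, rfl⟩
      exact hη f
    rw [ContinuousLinearMap.comp_apply,
      Submodule.orthogonalProjectionOnto_apply_of_mem_orthogonal hm, map_zero]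

/-- Operators agreeing on the range of `Φ` and on its complement are equal. -/
lemma ext_range {F : Type*} [NormedAddCommGroup F] [NormedSpace ℂ F]
    (Φ : E →ₗ[ℂ] K₁) (S T : K₁ →L[ℂ] F)
    (h1 : ∀ f, S (Φ f) = T (Φ f)) (h2 : ∀ η, (∀ f, ⟪Φ f, η⟫_ℂ = 0) → S η = T η) : S = T := by
  set L := (LinearMap.range Φ).topologicalClosure with hL
  have : CompleteSpace L := (Submodule.isClosed_topologicalClosure _).completeSpace_coe
  have hLle : ∀ y ∈ L, S y = T y := by
    have : L ≤ LinearMap.ker (S - T).toLinearMap := by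
      refine Submodule.topologicalClosure_minimal _ ?_ (S - T).isClosed_ker
      rintro _ ⟨f, rfl⟩
      simp [h1]
    intro y hy
    simpa [sub_eq_zero] using this hy
  ext y
  obtain ⟨u, hu, v, hv, rfl⟩ := L.exists_add_mem_mem_orthogonal y
  rw [map_add, map_add, hLle u hu, h2 v]
  intro f
  exact hv _ (Submodule.le_topologicalClosure _ (LinearMap.mem_range_self _ f))

end Generic

section Words

variable {K₁ K₂ : Type*}
  [NormedAddCommGroup K₁] [InnerProductSpace ℂ K₁] [CompleteSpace K₁]
  [NormedAddCommGroup K₂] [InnerProductSpace ℂ K₂] [CompleteSpace K₂]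

lemma sa_inner {x : K₁ →L[ℂ] K₁} (hx : IsSelfAdjoint x) (a b : K₁) :
    ⟪x a, b⟫_ℂ = ⟪a, x b⟫_ℂ := by
  conv_rhs => rw [← hx.star_eq, ContinuousLinearMap.star_eq_adjoint]
  rw [ContinuousLinearMap.adjoint_inner_right]

lemma inner_word (x : I → (K₁ →L[ℂ] K₁)) (hx : ∀ i, IsSelfAdjoint (x i)) (l : List I) (a b : K₁) :
    ⟪a, (l.map x).prod b⟫_ℂ = ⟪(l.reverse.map x).prod a, b⟫_ℂ := by
  induction l generalizing a b with
  | nil => simp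
  | cons i l ih =>
    simp only [List.map_cons, List.prod_cons, List.reverse_cons, List.map_append, List.prod_append,
      List.map_nil, List.prod_nil, mul_one, mul_apply_eq_comp]
    rw [← sa_inner (hx i), ih]

/-- Uniqueness of the GNS construction. -/
lemma gns (x₁ : I → (K₁ →L[ℂ] K₁)) (x₂ : I → (K₂ →L[ℂ] K₂))
    (hx₁ : ∀ i, IsSelfAdjoint (x₁ i)) (hx₂ : ∀ i, IsSelfAdjoint (x₂ i)) (Ω₁ : K₁) (Ω₂ : K₂)
    (hm : ∀ l : List I, ⟪(l.map x₁).prod Ω₁, Ω₁⟫_ℂ = ⟪(l.map x₂).prod Ω₂, Ω₂⟫_ℂ) :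
    ∃ V : K₁ →L[ℂ] K₂, (∀ l : List I, V ((l.map x₁).prod Ω₁) = (l.map x₂).prod Ω₂) ∧
      (∀ η, (∀ l : List I, ⟪(l.map x₁).prod Ω₁, η⟫_ℂ = 0) → V η = 0) ∧
      (∀ i η, V (x₁ i η) = x₂ i (V η)) ∧ (∀ η, ⟪Ω₂, V η⟫_ℂ = ⟪Ω₁, η⟫_ℂ) ∧
      (∀ P : K₁ →L[ℂ] K₁, IsSelfAdjoint P → (∀ i, P * x₁ i = x₁ i * P) → P Ω₁ = Ω₁ →
        ∀ η, V (P η) = V η) ∧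
      (∀ Q : K₂ →L[ℂ] K₂, (∀ i, Q * x₂ i = x₂ i * Q) → Q Ω₂ = Ω₂ →
        ∀ η, Q (V η) = V η) ∧
      (∀ S : K₂ →L[ℂ] ℂ, (∀ l : List I, S ((l.map x₂).prod Ω₂) = 0) → ∀ η, S (V η) = 0) := by
  let Φ₁ : (List I →₀ ℂ) →ₗ[ℂ] K₁ := Finsupp.linearCombination ℂ (fun l => (l.map x₁).prod Ω₁)
  let Φ₂ : (List I →₀ ℂ) →ₗ[ℂ] K₂ := Finsupp.linearCombination ℂ (fun l => (l.map x₂).prod Ω₂)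
  have e₁ : ∀ l c, Φ₁ (Finsupp.single l c) = c • (l.map x₁).prod Ω₁ := fun l c => by simp [Φ₁]
  have e₂ : ∀ l c, Φ₂ (Finsupp.single l c) = c • (l.map x₂).prod Ω₂ := fun l c => by simp [Φ₂]
  have hin : ∀ f g, ⟪Φ₁ f, Φ₁ g⟫_ℂ = ⟪Φ₂ f, Φ₂ g⟫_ℂ := by
    intro f g
    induction f using Finsupp.induction_linear with
    | zero => simp
    | add f f' h h' => simp only [map_add, inner_add_left, h, h']
    | single l c =>
      induction g using Finsupp.induction_linear with
      | zero => simp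
      | add f f' h h' => simp only [map_add, inner_add_right, h, h']
      | single l' c' =>
        rw [e₁, e₁, e₂, e₂]
        simp only [inner_smul_left, inner_smul_right]
        have := hm (l'.reverse ++ l)
        simp only [List.map_append, List.prod_append, mul_apply_eq_comp] at this
        rw [inner_word x₁ hx₁, inner_word x₂ hx₂, this]
  obtain ⟨V, hV1, hV2⟩ := isoExt Φ₁ Φ₂ hin
  have hVw : ∀ l : List I, V ((l.map x₁).prod Ω₁) = (l.map x₂).prod Ω₂ := by
    intro l
    have := hV1 (Finsupp.single l 1)
    simpa [e₁, e₂] using this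
  have hperp : ∀ η, (∀ l : List I, ⟪(l.map x₁).prod Ω₁, η⟫_ℂ = 0) → ∀ f, ⟪Φ₁ f, η⟫_ℂ = 0 := by
    intro η h f
    induction f using Finsupp.induction_linear with
    | zero => simp
    | add f f' h h' => simp only [map_add, inner_add_left, h, h', add_zero]
    | single l c => rw [e₁, inner_smul_left, h, mul_zero]
  have hperp' : ∀ η, (∀ f, ⟪Φ₁ f, η⟫_ℂ = 0) → (∀ l : List I, ⟪(l.map x₁).prod Ω₁, η⟫_ℂ = 0) := by
    intro η h l
    have := h (Finsupp.single l 1)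
    simpa [e₁] using this
  have hV3 : ∀ η, (∀ l : List I, ⟪(l.map x₁).prod Ω₁, η⟫_ℂ = 0) → V η = 0 :=
    fun η h => hV2 η (hperp η h)
  have key : ∀ {F : Type _} [NormedAddCommGroup F] [NormedSpace ℂ F] (S T : K₁ →L[ℂ] F),
      (∀ l : List I, S ((l.map x₁).prod Ω₁) = T ((l.map x₁).prod Ω₁)) →
      (∀ η, (∀ l : List I, ⟪(l.map x₁).prod Ω₁, η⟫_ℂ = 0) → S η = T η) → S = T := by
    intro F _ _ S T h1 h2
    refine ext_range Φ₁ S T ?_ (fun η h => h2 η (hperp' η h))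
    intro f
    induction f using Finsupp.induction_linear with
    | zero => simp
    | add f f' h h' => simp only [map_add, h, h']
    | single l c => rw [e₁, map_smul, map_smul, h1]
  have key' : ∀ (S T : K₁ →L[ℂ] ℂ),
      (∀ l : List I, S ((l.map x₁).prod Ω₁) = T ((l.map x₁).prod Ω₁)) →
      (∀ η, (∀ l : List I, ⟪(l.map x₁).prod Ω₁, η⟫_ℂ = 0) → S η = T η) → S = T := by
    intro S T h1 h2
    refine ext_range Φ₁ S T ?_ (fun η h => h2 η (hperp' η h))
    intro f
    induction f using Finsupp.induction_linear with
    | zero => simp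
    | add f f' h h' => simp only [map_add, h, h']
    | single l c => rw [e₁, map_smul, map_smul, h1]
  have comm₁ : ∀ P : K₁ →L[ℂ] K₁, (∀ i, P * x₁ i = x₁ i * P) → P Ω₁ = Ω₁ →
      ∀ l : List I, P ((l.map x₁).prod Ω₁) = (l.map x₁).prod Ω₁ := by
    intro P h1 h2 l
    induction l with
    | nil => simpa using h2
    | cons i l ih =>
      have := congrArg (fun A : K₁ →L[ℂ] K₁ => A ((l.map x₁).prod Ω₁)) (h1 i)
      simp only [mul_apply_eq_comp, ih] at this
      simpa using this
  have comm₂ : ∀ P : K₂ →L[ℂ] K₂, (∀ i, P * x₂ i = x₂ i * P) → P Ω₂ = Ω₂ →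
      ∀ l : List I, P ((l.map x₂).prod Ω₂) = (l.map x₂).prod Ω₂ := by
    intro P h1 h2 l
    induction l with
    | nil => simpa using h2
    | cons i l ih =>
      have := congrArg (fun A : K₂ →L[ℂ] K₂ => A ((l.map x₂).prod Ω₂)) (h1 i)
      simp only [mul_apply_eq_comp, ih] at this
      simpa using this
  refine ⟨V, hVw, hV3, ?_, ?_, ?_, ?_, ?_⟩
  · intro i η
    have : V ∘L x₁ i = x₂ i ∘L V := by
      apply key
      · intro l
        have := hVw (i :: l)
        simp only [List.map_cons, List.prod_cons, mul_apply_eq_comp] at this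
        simp [this, hVw]
      · intro η h
        have h0 : V (x₁ i η) = 0 := by
          apply hV3
          intro l
          rw [← sa_inner (hx₁ i)]
          have := h (i :: l)
          simpa using this
        simp [h0, hV3 η h]
    exact congrArg (fun A : K₁ →L[ℂ] K₂ => A η) this
  · intro η
    have : (innerSL ℂ Ω₂) ∘L V = innerSL ℂ Ω₁ := by
      apply key'
      · intro l
        have h1 := inner_word x₁ hx₁ l Ω₁ Ω₁
        have h2 := inner_word x₂ hx₂ l Ω₂ Ω₂
        show ⟪Ω₂, V _⟫_ℂ = ⟪Ω₁, _⟫_ℂ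
        rw [hVw, h1, h2, hm]
      · intro η h
        have := h []
        simp only [List.map_nil, List.prod_nil, one_apply_eq_self] at this
        simp [hV3 η h, this]
    exact congrArg (fun A : K₁ →L[ℂ] ℂ => A η) this
  · intro P hP h1 h2 η
    have : V ∘L P = V := by
      apply key
      · intro l
        simp [comm₁ P h1 h2]
      · intro η h
        have h0 : V (P η) = 0 := by
          apply hV3
          intro l
          rw [← sa_inner hP, comm₁ P h1 h2, h]
        simp [h0, hV3 η h]
    exact congrArg (fun A : K₁ →L[ℂ] K₂ => A η) this
  · intro Q h1 h2 η
    have : Q ∘L V = V := by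
      apply key
      · intro l
        simp [hVw, comm₂ Q h1 h2]
      · intro η h
        simp [hV3 η h]
    exact congrArg (fun A : K₁ →L[ℂ] K₂ => A η) this
  · intro S h η
    have : S ∘L V = 0 := by
      apply key'
      · intro l
        simp [hVw, h]
      · intro η h
        simp [hV3 η h]
    exact congrArg (fun A : K₁ →L[ℂ] ℂ => A η) this

end Words

section Amp

/-- The Hilbert space `ℓ²(ℕ, H)`. -/
abbrev L2 (H : Type) [NormedAddCommGroup H] [InnerProductSpace ℂ H] : Type :=
  lp (fun _ : ℕ => H) 2

lemma amp_memlp (x : H →L[ℂ] H) (f : L2 H) : Memℓp (fun n => x (f n)) 2 := by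
  have hf := lp.memℓp f
  rw [memℓp_gen_iff (by norm_num)] at hf
  apply memℓp_gen
  refine Summable.of_nonneg_of_le (fun n => by positivity) (fun n => ?_)
    (hf.mul_left (‖x‖ ^ (2 : ENNReal).toReal))
  rw [← Real.mul_rpow (norm_nonneg _) (norm_nonneg _)]
  exact Real.rpow_le_rpow (norm_nonneg _) (x.le_opNorm _) (by norm_num)

/-- The ampliation of `x` to `ℓ²(ℕ, H)`. -/
def amp (x : H →L[ℂ] H) : L2 H →L[ℂ] L2 H :=
  LinearMap.mkContinuous
    { toFun := fun f => ⟨fun n => x (f n), amp_memlp x f⟩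
      map_add' := fun f g => by ext n; exact map_add x _ _
      map_smul' := fun c f => by ext n; simp } ‖x‖ (by
    intro f
    have h2 : (0 : ℝ) < (2 : ENNReal).toReal := by norm_num
    refine lp.norm_le_of_forall_sum_le h2 (by positivity) ?_
    intro s
    rw [Real.mul_rpow (norm_nonneg _) (norm_nonneg _)]
    calc _ ≤ ∑ i ∈ s, ‖x‖ ^ (2 : ENNReal).toReal * ‖f i‖ ^ (2 : ENNReal).toReal := by
          refine Finset.sum_le_sum (fun n _ => ?_)
          rw [← Real.mul_rpow (norm_nonneg _) (norm_nonneg _)]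
          exact Real.rpow_le_rpow (norm_nonneg _) (x.le_opNorm _) (by norm_num)
      _ ≤ _ := by
          rw [← Finset.mul_sum]
          gcongr
          exact lp.sum_rpow_le_norm_rpow h2 f s)

@[simp] lemma amp_apply (x : H →L[ℂ] H) (f : L2 H) (n : ℕ) : amp x f n = x (f n) := rfl

lemma amp_sa {x : H →L[ℂ] H} (hx : IsSelfAdjoint x) : IsSelfAdjoint (amp x) := by
  rw [ContinuousLinearMap.isSelfAdjoint_iff_isSymmetric]
  intro f g
  show ⟪amp x f, g⟫_ℂ = ⟪f, amp x g⟫_ℂ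
  rw [lp.inner_eq_tsum, lp.inner_eq_tsum]
  simp only [amp_apply, sa_inner hx]

lemma amp_comm {x y : H →L[ℂ] H} (h : x * y = y * x) : amp x * amp y = amp y * amp x := by
  ext f n
  exact congrArg (fun A : H →L[ℂ] H => A (f n)) h

lemma amp_word (x : I → (H →L[ℂ] H)) (l : List I) (f : L2 H) :
    (l.map (fun i => amp (x i))).prod f = amp ((l.map x).prod) f := by
  induction l with
  | nil => ext n; simp
  | cons i l ih =>
    ext n
    simp [ih]

/-- The vector in `ℓ²` given by a square summable sequence. -/
def vec (ξ : ℕ → H) (h : Summable fun n => ‖ξ n‖ ^ 2) : L2 H :=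
  ⟨ξ, memℓp_gen (by simpa using h)⟩

@[simp] lemma vec_apply (ξ : ℕ → H) (h : Summable fun n => ‖ξ n‖ ^ 2) (n : ℕ) :
    vec ξ h n = ξ n := rfl

lemma state_eq {M : Set (H →L[ℂ] H)} {φ : (H →L[ℂ] H) → ℂ} {ξ : ℕ → H}
    (h : Summable fun n => ‖ξ n‖ ^ 2) (hφ : ∀ x ∈ M, φ x = ∑' n, ⟪x (ξ n), ξ n⟫_ℂ)
    {x : H →L[ℂ] H} (hx : x ∈ M) : φ x = ⟪amp x (vec ξ h), vec ξ h⟫_ℂ := by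
  rw [hφ x hx, lp.inner_eq_tsum]
  simp

lemma tsum_self {ξ : ℕ → H} (h1 : ∑' n, ‖ξ n‖ ^ 2 = 1) : ∑' n, ⟪ξ n, ξ n⟫_ℂ = 1 := by
  have e : ∀ η : H, ⟪η, η⟫_ℂ = ((‖η‖ ^ 2 : ℝ) : ℂ) := fun η => by
    rw [inner_self_eq_norm_sq_to_K]; push_cast; rfl
  simp only [e]
  rw [← Complex.ofReal_tsum, h1, Complex.ofReal_one]

lemma proj_fix {p : H →L[ℂ] H} (hp : IsProjection p) {ξ : ℕ → H}
    (h : Summable fun n => ‖ξ n‖ ^ 2) (h1 : ∑' n, ‖ξ n‖ ^ 2 = 1)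
    (hs : ⟪amp p (vec ξ h), vec ξ h⟫_ℂ = 1) (n : ℕ) : p (ξ n) = ξ n := by
  have hΩ : ⟪vec ξ h, vec ξ h⟫_ℂ = 1 := by
    rw [lp.inner_eq_tsum]
    simp only [vec_apply]
    exact tsum_self h1
  have hpp : amp p (amp p (vec ξ h)) = amp p (vec ξ h) := by
    ext n
    exact congrArg (fun A : H →L[ℂ] H => A (ξ n)) hp.2
  have h0 : ⟪vec ξ h - amp p (vec ξ h), vec ξ h - amp p (vec ξ h)⟫_ℂ = 0 := by
    have e1 : ⟪vec ξ h, amp p (vec ξ h)⟫_ℂ = 1 := by rw [← sa_inner (amp_sa hp.1), hs]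
    have e2 : ⟪amp p (vec ξ h), amp p (vec ξ h)⟫_ℂ = 1 := by
      rw [← sa_inner (amp_sa hp.1), hpp, hs]
    rw [inner_sub_left, inner_sub_right, inner_sub_right, hΩ, e1, e2, hs]
    ring
  have h3 := sub_eq_zero.1 (inner_self_eq_zero.1 h0)
  exact (congrArg (fun f : L2 H => f n) h3).symm

/-- A closed subspace invariant under `M` and `M'` containing the vectors of the state contains
the range of the central support. -/
lemma support_mem {M : Set (H →L[ℂ] H)} {φ : (H →L[ℂ] H) → ℂ} {x : I → (H →L[ℂ] H)}
    (hx : ∀ i, IsSelfAdjoint (x i)) (hgen : M = vN (Set.range x)) {z : H →L[ℂ] H}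
    (hz : IsCentralSupport M φ z) {ξ : ℕ → H}
    (h1 : ∑' n, ‖ξ n‖ ^ 2 = 1)
    (hφ : ∀ x ∈ M, φ x = ∑' n, ⟪x (ξ n), ξ n⟫_ℂ)
    (R : Submodule ℂ H) (hR : IsClosed (R : Set H))
    (hRx : ∀ i, ∀ η ∈ R, x i η ∈ R)
    (hRy : ∀ y ∈ Set.centralizer (Set.range x), ∀ η ∈ R, y η ∈ R)
    (hξ : ∀ n, ξ n ∈ R) (η : H) : z η ∈ R := by
  have : CompleteSpace R := hR.completeSpace_coe
  set p := R.starProjection with hp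
  have hps : IsSelfAdjoint p := (isStarProjection_starProjection).isSelfAdjoint
  have hpi : p * p = p := (isStarProjection_starProjection).isIdempotentElem
  have hpR : ∀ η ∈ R, p η = η := fun η h => Submodule.starProjection_eq_self_iff.2 h
  have hpm : ∀ η, p η ∈ R := fun η => Submodule.starProjection_apply_mem R η
  have comm : ∀ y : H →L[ℂ] H, (∀ η ∈ R, y η ∈ R) → (∀ η ∈ R, star y η ∈ R) → p * y = y * p := by
    intro y h1 h2
    have e1 : p * y * p = y * p := by
      ext η
      exact hpR _ (h1 _ (hpm η))
    have e2 : p * star y * p = star y * p := by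
      ext η
      exact hpR _ (h2 _ (hpm η))
    have e3 := congrArg star e2
    simp only [star_mul, star_star, hps.star_eq] at e3
    rw [← e3, ← mul_assoc, e1]
  have hpc : p ∈ Set.centralizer (Set.range x) := by
    rintro _ ⟨i, rfl⟩
    exact (comm (x i) (hRx i) (by rw [(hx i).star_eq]; exact hRx i)).symm
  have hpM : p ∈ M := by
    rw [hgen]
    intro y hy
    have hy' : star y ∈ Set.centralizer (Set.range x) := by
      rintro _ ⟨i, rfl⟩
      have := congrArg star (hy (x i) ⟨i, rfl⟩)
      simp only [star_mul, (hx i).star_eq] at this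
      exact this.symm
    exact (comm y (hRy y hy) (hRy _ hy')).symm
  have hφp : φ p = 1 := by
    rw [hφ p hpM]
    simp only [hpR _ (hξ _)]
    exact tsum_self h1
  have hzp := hz.min p hpM ⟨hps, hpi⟩ (by
    intro y hy
    rw [hgen] at hy
    exact (hy p hpc)) hφp
  have hzp' := congrArg star hzp
  simp only [star_mul, hps.star_eq, hz.proj.1.star_eq] at hzp'
  rw [← hzp']
  exact hpm _

end Amp

section Intertwiners

/-- Intertwiners between the two families, supported on `z₁` and `z₂`. -/
def J (x₁ : I → (H →L[ℂ] H)) (x₂ : I → (H' →L[ℂ] H')) (z₁ : H →L[ℂ] H) (z₂ : H' →L[ℂ] H') :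
    Set (H →L[ℂ] H') :=
  {T | (∀ i, T ∘L x₁ i = x₂ i ∘L T) ∧ z₂ ∘L T = T ∧ T ∘L z₁ = T}

lemma J_adj {x₁ : I → (H →L[ℂ] H)} {x₂ : I → (H' →L[ℂ] H')} {z₁ : H →L[ℂ] H}
    {z₂ : H' →L[ℂ] H'} (hx₁ : ∀ i, IsSelfAdjoint (x₁ i)) (hx₂ : ∀ i, IsSelfAdjoint (x₂ i))
    (hz₁ : IsSelfAdjoint z₁) (hz₂ : IsSelfAdjoint z₂) {T : H →L[ℂ] H'} (hT : T ∈ J x₁ x₂ z₁ z₂) :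
    ContinuousLinearMap.adjoint T ∈ J x₂ x₁ z₂ z₁ := by
  obtain ⟨h1, h2, h3⟩ := hT
  refine ⟨fun i => ?_, ?_, ?_⟩
  · have := congrArg ContinuousLinearMap.adjoint (h1 i)
    rw [ContinuousLinearMap.adjoint_comp, ContinuousLinearMap.adjoint_comp,
      (hx₁ i).adjoint_eq, (hx₂ i).adjoint_eq] at this
    exact this.symm
  · have := congrArg ContinuousLinearMap.adjoint h3
    rwa [ContinuousLinearMap.adjoint_comp, hz₁.adjoint_eq] at this
  · have := congrArg ContinuousLinearMap.adjoint h2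
    rwa [ContinuousLinearMap.adjoint_comp, hz₂.adjoint_eq] at this

/-- Density of the ranges of a set of operators in the range of `z`. -/
def DenseIn (𝒥 : Set (H →L[ℂ] H')) (z : H' →L[ℂ] H') : Prop :=
  ∀ η, (∀ T ∈ 𝒥, ContinuousLinearMap.adjoint T η = 0) → z η = 0

lemma uniq0 {F : Type} [NormedAddCommGroup F] [InnerProductSpace ℂ F] [CompleteSpace F]
    {𝒥 : Set (H →L[ℂ] H')} {z : H' →L[ℂ] H'} (hz : IsSelfAdjoint z) (hd : DenseIn 𝒥 z)
    {d : H' →L[ℂ] F} (hdz : d ∘L z = d) (h : ∀ T ∈ 𝒥, d ∘L T = 0) : d = 0 := by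
  have h1 : z ∘L ContinuousLinearMap.adjoint d = 0 := by
    ext ζ
    refine hd _ ?_
    intro T hT
    have := congrArg ContinuousLinearMap.adjoint (h T hT)
    rw [ContinuousLinearMap.adjoint_comp, map_zero] at this
    exact congrArg (fun A : F →L[ℂ] H => A ζ) this
  have h2 := congrArg ContinuousLinearMap.adjoint h1
  rw [ContinuousLinearMap.adjoint_comp, map_zero, hz.adjoint_eq,
    ContinuousLinearMap.adjoint_adjoint, hdz] at h2
  exact h2

lemma uniq1 {F : Type} [NormedAddCommGroup F] [InnerProductSpace ℂ F] [CompleteSpace F]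
    {𝒥 : Set (H →L[ℂ] H')} {z : H' →L[ℂ] H'} (hz : IsSelfAdjoint z) (hd : DenseIn 𝒥 z)
    {b c : H' →L[ℂ] F} (hb : b ∘L z = b) (hc : c ∘L z = c)
    (h : ∀ T ∈ 𝒥, b ∘L T = c ∘L T) : b = c := by
  rw [← sub_eq_zero]
  refine uniq0 hz hd ?_ ?_
  · rw [ContinuousLinearMap.sub_comp, hb, hc]
  · intro T hT
    rw [ContinuousLinearMap.sub_comp, h T hT, sub_self]

/-- `b` corresponds to `a`. -/
def Rel (𝒥 : Set (H →L[ℂ] H')) (a : H →L[ℂ] H) (b : H' →L[ℂ] H') : Prop :=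
  ∀ T ∈ 𝒥, b ∘L T = T ∘L a

lemma J_comm {x₁ : I → (H →L[ℂ] H)} {x₂ : I → (H' →L[ℂ] H')} {z₁ : H →L[ℂ] H}
    {z₂ : H' →L[ℂ] H'} (hx₁ : ∀ i, IsSelfAdjoint (x₁ i)) (hx₂ : ∀ i, IsSelfAdjoint (x₂ i))
    (hz₁ : IsSelfAdjoint z₁) (hz₂ : IsSelfAdjoint z₂) {S T : H →L[ℂ] H'}
    (hS : S ∈ J x₁ x₂ z₁ z₂) (hT : T ∈ J x₁ x₂ z₁ z₂) {a : H →L[ℂ] H}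
    (ha : a ∈ vN (Set.range x₁)) (η : H) :
    ContinuousLinearMap.adjoint S (T (a η)) = a (ContinuousLinearMap.adjoint S (T η)) := by
  have hS' := J_adj hx₁ hx₂ hz₁ hz₂ hS
  have h1 : (ContinuousLinearMap.adjoint S ∘L T : H →L[ℂ] H) ∈ Set.centralizer (Set.range x₁) := by
    rintro _ ⟨i, rfl⟩
    ext ζ
    have e1 := congrArg (fun A : H →L[ℂ] H' => A ζ) (hT.1 i)
    have e2 := congrArg (fun A : H' →L[ℂ] H => A (T ζ)) (hS'.1 i)
    simp only [ContinuousLinearMap.comp_apply] at e1 e2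
    simp only [mul_apply_eq_comp, ContinuousLinearMap.comp_apply, e1, e2]
  exact congrArg (fun A : H →L[ℂ] H => A η) (ha _ h1)

lemma rel_star {x₁ : I → (H →L[ℂ] H)} {x₂ : I → (H' →L[ℂ] H')} {z₁ : H →L[ℂ] H}
    {z₂ : H' →L[ℂ] H'} (hx₁ : ∀ i, IsSelfAdjoint (x₁ i)) (hx₂ : ∀ i, IsSelfAdjoint (x₂ i))
    (hz₁ : IsSelfAdjoint z₁) (hz₂ : IsSelfAdjoint z₂) (hd : DenseIn (J x₁ x₂ z₁ z₂) z₂)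
    {a : H →L[ℂ] H} {b : H' →L[ℂ] H'}
    (ha : a ∈ vN (Set.range x₁)) (hb : b ∘L z₂ = b) (h : Rel (J x₁ x₂ z₁ z₂) a b) :
    Rel (J x₁ x₂ z₁ z₂) (star a) (star b) := by
  intro T hT
  have key : ContinuousLinearMap.adjoint T ∘L b = a ∘L ContinuousLinearMap.adjoint T := by
    have hT' := J_adj hx₁ hx₂ hz₁ hz₂ hT
    refine uniq1 hz₂ hd ?_ ?_ ?_
    · rw [ContinuousLinearMap.comp_assoc, hb]
    · rw [ContinuousLinearMap.comp_assoc, hT'.2.2]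
    · intro S hS
      ext ζ
      have e1 := congrArg (fun A : H →L[ℂ] H' => A ζ) (h S hS)
      simp only [ContinuousLinearMap.comp_apply] at e1
      simp only [ContinuousLinearMap.comp_apply, e1]
      exact J_comm hx₁ hx₂ hz₁ hz₂ hT hS ha ζ
  have := congrArg ContinuousLinearMap.adjoint key
  rw [ContinuousLinearMap.adjoint_comp, ContinuousLinearMap.adjoint_comp,
    ContinuousLinearMap.adjoint_adjoint] at this
  exact this

lemma rel_swap {x₁ : I → (H →L[ℂ] H)} {x₂ : I → (H' →L[ℂ] H')} {z₁ : H →L[ℂ] H}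
    {z₂ : H' →L[ℂ] H'} (hx₁ : ∀ i, IsSelfAdjoint (x₁ i)) (hx₂ : ∀ i, IsSelfAdjoint (x₂ i))
    (hz₁ : IsSelfAdjoint z₁) (hz₂ : IsSelfAdjoint z₂) (hd : DenseIn (J x₁ x₂ z₁ z₂) z₂)
    {a : H →L[ℂ] H} {b : H' →L[ℂ] H'}
    (ha : a ∈ vN (Set.range x₁)) (hb : b ∘L z₂ = b) (h : Rel (J x₁ x₂ z₁ z₂) a b) :
    Rel (J x₂ x₁ z₂ z₁) b a := by
  intro T hT
  have h1 := rel_star hx₁ hx₂ hz₁ hz₂ hd ha hb h _ (J_adj hx₂ hx₁ hz₂ hz₁ hT)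
  have h2 := congrArg ContinuousLinearMap.adjoint h1
  rw [ContinuousLinearMap.adjoint_comp, ContinuousLinearMap.adjoint_comp,
    ContinuousLinearMap.adjoint_adjoint, ContinuousLinearMap.star_eq_adjoint,
    ContinuousLinearMap.star_eq_adjoint,
    ContinuousLinearMap.adjoint_adjoint, ContinuousLinearMap.adjoint_adjoint] at h2
  exact h2.symm

lemma exists_unitary {x₁ : I → (H →L[ℂ] H)} {x₂ : I → (H' →L[ℂ] H')} {z₁ : H →L[ℂ] H}
    {z₂ : H' →L[ℂ] H'} (hx₁ : ∀ i, IsSelfAdjoint (x₁ i)) (hx₂ : ∀ i, IsSelfAdjoint (x₂ i))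
    (hz₁ : IsSelfAdjoint z₁) (hz₂ : IsSelfAdjoint z₂) (hd : DenseIn (J x₁ x₂ z₁ z₂) z₂)
    (hzM : z₂ ∈ vN (Set.range x₂))
    {u : H →L[ℂ] H} (hu : u ∈ vN (Set.range x₁)) (huu : star u * u = 1) :
    ∃ b ∈ vN (Set.range x₂), b ∘L z₂ = b ∧ Rel (J x₁ x₂ z₁ z₂) u b := by
  let Φ₁ : (J x₁ x₂ z₁ z₂ →₀ H) →ₗ[ℂ] H' :=
    Finsupp.lsum ℂ (fun T => (T : H →L[ℂ] H').toLinearMap)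
  let Φ₂ : (J x₁ x₂ z₁ z₂ →₀ H) →ₗ[ℂ] H' :=
    Finsupp.lsum ℂ (fun T => ((T : H →L[ℂ] H') ∘L u).toLinearMap)
  have e₁ : ∀ T ζ, Φ₁ (Finsupp.single T ζ) = (T : H →L[ℂ] H') ζ := fun T ζ => by simp [Φ₁]
  have e₂ : ∀ T ζ, Φ₂ (Finsupp.single T ζ) = (T : H →L[ℂ] H') (u ζ) := fun T ζ => by simp [Φ₂]
  have hin : ∀ f g, ⟪Φ₁ f, Φ₁ g⟫_ℂ = ⟪Φ₂ f, Φ₂ g⟫_ℂ := by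
    intro f g
    induction f using Finsupp.induction_linear with
    | zero => simp
    | add f f' h h' => simp only [map_add, inner_add_left, h, h']
    | single T c =>
      induction g using Finsupp.induction_linear with
      | zero => simp
      | add f f' h h' => simp only [map_add, inner_add_right, h, h']
      | single S c' =>
        rw [e₁, e₁, e₂, e₂]
        rw [← ContinuousLinearMap.adjoint_inner_right, ← ContinuousLinearMap.adjoint_inner_right,
          J_comm hx₁ hx₂ hz₁ hz₂ T.2 S.2 hu, ← ContinuousLinearMap.adjoint_inner_right,
          ← ContinuousLinearMap.star_eq_adjoint u]
        have := congrArg (fun A : H →L[ℂ] H =>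
          A (ContinuousLinearMap.adjoint (T : H →L[ℂ] H') ((S : H →L[ℂ] H') c'))) huu
        simp only [mul_apply_eq_comp, one_apply_eq_self] at this
        rw [this]
  obtain ⟨b, hb1, hb2⟩ := isoExt Φ₁ Φ₂ hin
  have hbT : Rel (J x₁ x₂ z₁ z₂) u b := by
    intro T hT
    ext ζ
    have := hb1 (Finsupp.single ⟨T, hT⟩ ζ)
    rwa [e₁, e₂] at this
  have hbz : b ∘L z₂ = b := by
    ext η
    have h0 : b (η - z₂ η) = 0 := by
      apply hb2
      intro f
      induction f using Finsupp.induction_linear with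
      | zero => simp
      | add f f' h h' => simp only [map_add, inner_add_left, h, h', add_zero]
      | single T c =>
        have := congrArg (fun A : H →L[ℂ] H' => A c) T.2.2.1
        simp only [ContinuousLinearMap.comp_apply] at this
        rw [e₁, inner_sub_right, ← sa_inner hz₂, this, sub_self]
    rw [map_sub, sub_eq_zero] at h0
    exact h0.symm
  refine ⟨b, ?_, hbz, hbT⟩
  intro y hy
  have hyz : y ∘L z₂ = z₂ ∘L y := hzM y hy
  refine uniq1 (F := H') (b := y ∘L b) (c := b ∘L y) hz₂ hd ?_ ?_ ?_
  · rw [ContinuousLinearMap.comp_assoc, hbz]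
  · rw [ContinuousLinearMap.comp_assoc, hyz, ← ContinuousLinearMap.comp_assoc, hbz]
  · intro T hT
    have hyT : y ∘L T ∈ J x₁ x₂ z₁ z₂ := by
      refine ⟨fun i => ?_, ?_, ?_⟩
      · have : x₂ i ∘L y = y ∘L x₂ i := hy (x₂ i) ⟨i, rfl⟩
        rw [ContinuousLinearMap.comp_assoc, hT.1 i, ← ContinuousLinearMap.comp_assoc, ← this,
          ContinuousLinearMap.comp_assoc]
      · rw [← ContinuousLinearMap.comp_assoc, ← hyz, ContinuousLinearMap.comp_assoc, hT.2.1]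
      · rw [ContinuousLinearMap.comp_assoc, hT.2.2]
    rw [ContinuousLinearMap.comp_assoc, ContinuousLinearMap.comp_assoc, hbT T hT, hbT _ hyT,
      ContinuousLinearMap.comp_assoc]

lemma exists_rel (M₁ : VonNeumannAlgebra H) (M₂ : VonNeumannAlgebra H')
    {x₁ : I → (H →L[ℂ] H)} {x₂ : I → (H' →L[ℂ] H')} {z₁ : H →L[ℂ] H}
    {z₂ : H' →L[ℂ] H'} (hx₁ : ∀ i, IsSelfAdjoint (x₁ i)) (hx₂ : ∀ i, IsSelfAdjoint (x₂ i))
    (hgen₁ : (M₁ : Set (H →L[ℂ] H)) = vN (Set.range x₁))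
    (hgen₂ : (M₂ : Set (H' →L[ℂ] H')) = vN (Set.range x₂))
    (hz₁ : IsSelfAdjoint z₁) (hz₂ : IsSelfAdjoint z₂) (hd : DenseIn (J x₁ x₂ z₁ z₂) z₂)
    (hzM : z₂ ∈ M₂) {a : H →L[ℂ] H} (ha : a ∈ M₁) :
    ∃ b ∈ M₂, b ∘L z₂ = b ∧ Rel (J x₁ x₂ z₁ z₂) a b := by
  have hcl : IsClosed (M₁.toStarSubalgebra : Set (H →L[ℂ] H)) := by
    show IsClosed (M₁ : Set (H →L[ℂ] H))
    rw [hgen₁]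
    exact Set.isClosed_centralizer _
  let _ : CStarAlgebra M₁.toStarSubalgebra := StarSubalgebra.cstarAlgebra _ (h_closed := hcl)
  have hspan := CStarAlgebra.span_unitary (A := M₁.toStarSubalgebra)
  have hmem : ∀ b, b ∈ M₂ ↔ b ∈ vN (Set.range x₂) := fun b => by
    rw [← hgen₂]; rfl
  have hmem₁ : ∀ b, b ∈ M₁ ↔ b ∈ vN (Set.range x₁) := fun b => by
    rw [← hgen₁]; rfl
  have key : ∀ a : M₁.toStarSubalgebra,
      ∃ b ∈ M₂, b ∘L z₂ = b ∧ Rel (J x₁ x₂ z₁ z₂) (a : H →L[ℂ] H) b := by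
    intro a
    have ha : a ∈ Submodule.span ℂ (unitary M₁.toStarSubalgebra : Set M₁.toStarSubalgebra) := by
      rw [hspan]; trivial
    induction ha using Submodule.span_induction with
    | mem u hu =>
      have h1 := congrArg (fun v : M₁.toStarSubalgebra => (v : H →L[ℂ] H)) hu.1
      obtain ⟨b, hb, h⟩ := exists_unitary hx₁ hx₂ hz₁ hz₂ hd ((hmem _).1 hzM)
        ((hmem₁ (u : H →L[ℂ] H)).1 u.2) h1
      exact ⟨b, (hmem b).2 hb, h⟩
    | zero =>
      refine ⟨0, zero_mem _, by simp, fun T _ => by simp⟩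
    | add a a' _ _ h h' =>
      obtain ⟨b, hb, hbz, hr⟩ := h
      obtain ⟨b', hb', hbz', hr'⟩ := h'
      refine ⟨b + b', add_mem hb hb', by rw [ContinuousLinearMap.add_comp, hbz, hbz'],
        fun T hT => ?_⟩
      rw [ContinuousLinearMap.add_comp, hr T hT, hr' T hT, ← ContinuousLinearMap.comp_add]
      rfl
    | smul c a _ h =>
      obtain ⟨b, hb, hbz, hr⟩ := h
      refine ⟨c • b, M₂.toStarSubalgebra.smul_mem hb c,
        by rw [ContinuousLinearMap.smul_comp, hbz],
        fun T hT => ?_⟩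
      rw [ContinuousLinearMap.smul_comp, hr T hT, ← ContinuousLinearMap.comp_smul]
      rfl
  exact key ⟨a, ha⟩

end Intertwiners

section Main

lemma J_mul {x₁ : I → (H →L[ℂ] H)} {x₂ : I → (H' →L[ℂ] H')} {z₁ : H →L[ℂ] H}
    {z₂ : H' →L[ℂ] H'} (hzM : z₂ ∈ vN (Set.range x₂)) {y : H' →L[ℂ] H'}
    (hy : y ∈ Set.centralizer (Set.range x₂)) {T : H →L[ℂ] H'} (hT : T ∈ J x₁ x₂ z₁ z₂) :
    y ∘L T ∈ J x₁ x₂ z₁ z₂ := by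
  have hyz : y ∘L z₂ = z₂ ∘L y := hzM y hy
  refine ⟨fun i => ?_, ?_, ?_⟩
  · have : x₂ i ∘L y = y ∘L x₂ i := hy (x₂ i) ⟨i, rfl⟩
    rw [ContinuousLinearMap.comp_assoc, hT.1 i, ← ContinuousLinearMap.comp_assoc, ← this,
      ContinuousLinearMap.comp_assoc]
  · rw [← ContinuousLinearMap.comp_assoc, ← hyz, ContinuousLinearMap.comp_assoc, hT.2.1]
  · rw [ContinuousLinearMap.comp_assoc, hT.2.2]

/-- Matrix entry of an operator between `ℓ²` spaces. -/
def entry (V : L2 H →L[ℂ] L2 H') (m n : ℕ) : H →L[ℂ] H' :=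
  (lp.evalCLM ℂ (fun _ : ℕ => H') 2 m) ∘L V ∘L
    (lp.singleContinuousLinearMap ℂ (fun _ : ℕ => H) 2 n)

lemma entry_apply (V : L2 H →L[ℂ] L2 H') (m n : ℕ) (ζ : H) :
    entry V m n ζ = V (lp.single 2 n ζ) m := rfl

lemma amp_single (x : H →L[ℂ] H) (n : ℕ) (ζ : H) :
    amp x (lp.single 2 n ζ : L2 H) = lp.single 2 n (x ζ) := by
  ext k
  rw [amp_apply]
  by_cases h : k = n
  · subst h; rw [lp.single_apply_self, lp.single_apply_self]
  · rw [lp.single_apply_ne _ _ _ h, lp.single_apply_ne _ _ _ h, map_zero]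

lemma word_mem (M : VonNeumannAlgebra H) {x : I → (H →L[ℂ] H)}
    (hgen : (M : Set (H →L[ℂ] H)) = vN (Set.range x)) (l : List I) : (l.map x).prod ∈ M := by
  refine list_prod_mem ?_
  intro y hy
  obtain ⟨i, _, rfl⟩ := List.mem_map.1 hy
  show x i ∈ (M : Set (H →L[ℂ] H))
  rw [hgen]
  exact Set.subset_centralizer_centralizer ⟨i, rfl⟩

lemma main_V (M₁ : VonNeumannAlgebra H) (M₂ : VonNeumannAlgebra H')
    {φ₁ : (H →L[ℂ] H) → ℂ} {φ₂ : (H' →L[ℂ] H') → ℂ}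
    {ξ₁ : ℕ → H} (s₁ : Summable fun n => ‖ξ₁ n‖ ^ 2) (t₁ : (∑' n, ‖ξ₁ n‖ ^ 2) = 1)
    (hφ₁ : ∀ x ∈ (M₁ : Set (H →L[ℂ] H)), φ₁ x = ∑' n, ⟪x (ξ₁ n), ξ₁ n⟫_ℂ)
    {ξ₂ : ℕ → H'} (s₂ : Summable fun n => ‖ξ₂ n‖ ^ 2) (t₂ : (∑' n, ‖ξ₂ n‖ ^ 2) = 1)
    (hφ₂ : ∀ x ∈ (M₂ : Set (H' →L[ℂ] H')), φ₂ x = ∑' n, ⟪x (ξ₂ n), ξ₂ n⟫_ℂ)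
    {x₁ : I → (H →L[ℂ] H)} {x₂ : I → (H' →L[ℂ] H')}
    (hx₁ : ∀ i, IsSelfAdjoint (x₁ i)) (hx₂ : ∀ i, IsSelfAdjoint (x₂ i))
    (hgen₁ : (M₁ : Set (H →L[ℂ] H)) = vN (Set.range x₁))
    (hgen₂ : (M₂ : Set (H' →L[ℂ] H')) = vN (Set.range x₂))
    {z₁ : H →L[ℂ] H} {z₂ : H' →L[ℂ] H'}
    (hz₁ : IsCentralSupport (M₁ : Set (H →L[ℂ] H)) φ₁ z₁)
    (hz₂ : IsCentralSupport (M₂ : Set (H' →L[ℂ] H')) φ₂ z₂)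
    (hmom : ∀ l : List I, φ₁ (l.map x₁).prod = φ₂ (l.map x₂).prod) :
    DenseIn (J x₁ x₂ z₁ z₂) z₂ ∧
    ∃ V : L2 H →L[ℂ] L2 H',
      (∀ l : List I, V (amp (l.map x₁).prod (vec ξ₁ s₁)) = amp (l.map x₂).prod (vec ξ₂ s₂)) ∧
      (∀ η, ⟪vec ξ₂ s₂, V η⟫_ℂ = ⟪vec ξ₁ s₁, η⟫_ℂ) ∧
      (∀ S : L2 H' →L[ℂ] ℂ, (∀ l : List I, S (amp (l.map x₂).prod (vec ξ₂ s₂)) = 0) →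
        ∀ η, S (V η) = 0) ∧
      (∀ a b, Rel (J x₁ x₂ z₁ z₂) a b → ∀ f, amp b (V f) = V (amp a f)) := by
  have hxm₁ : ∀ i, x₁ i ∈ (M₁ : Set (H →L[ℂ] H)) := fun i => by
    simpa using word_mem M₁ hgen₁ [i]
  have hxm₂ : ∀ i, x₂ i ∈ (M₂ : Set (H' →L[ℂ] H')) := fun i => by
    simpa using word_mem M₂ hgen₂ [i]
  obtain ⟨V, v1, -, v3, v4, v5, v6, v7⟩ := gns (fun i => amp (x₁ i)) (fun i => amp (x₂ i))
    (fun i => amp_sa (hx₁ i)) (fun i => amp_sa (hx₂ i)) (vec ξ₁ s₁) (vec ξ₂ s₂) (by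
      intro l
      rw [amp_word, amp_word, ← state_eq s₁ hφ₁ (word_mem M₁ hgen₁ l),
        ← state_eq s₂ hφ₂ (word_mem M₂ hgen₂ l), hmom])
  simp only [amp_word] at v1 v7
  have zf₁ : amp z₁ (vec ξ₁ s₁) = vec ξ₁ s₁ := by
    ext n
    exact proj_fix hz₁.proj s₁ t₁ (by rw [← state_eq s₁ hφ₁ hz₁.mem, hz₁.full]) n
  have zf₂ : amp z₂ (vec ξ₂ s₂) = vec ξ₂ s₂ := by
    ext n
    exact proj_fix hz₂.proj s₂ t₂ (by rw [← state_eq s₂ hφ₂ hz₂.mem, hz₂.full]) n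
  have w5 := v5 (amp z₁) (amp_sa hz₁.proj.1) (fun i => amp_comm (hz₁.central _ (hxm₁ i))) zf₁
  have w6 := v6 (amp z₂) (fun i => amp_comm (hz₂.central _ (hxm₂ i))) zf₂
  have hVJ : ∀ m n, entry V m n ∈ J x₁ x₂ z₁ z₂ := by
    intro m n
    refine ⟨fun i => ?_, ?_, ?_⟩
    · ext ζ
      simp only [ContinuousLinearMap.comp_apply, entry_apply]
      rw [← amp_single, v3, amp_apply]
    · ext ζ
      simp only [ContinuousLinearMap.comp_apply, entry_apply]
      rw [← amp_apply, w6]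
    · ext ζ
      simp only [ContinuousLinearMap.comp_apply, entry_apply]
      rw [← amp_single, w5]
  have hzM : z₂ ∈ vN (Set.range x₂) := by rw [← hgen₂]; exact hz₂.mem
  refine ⟨?_, V, v1, v4, v7, ?_⟩
  · intro η hη
    let W : Submodule ℂ H' := ⨅ T ∈ J x₁ x₂ z₁ z₂,
      LinearMap.ker (ContinuousLinearMap.adjoint T).toLinearMap
    have hW : ∀ ω, ω ∈ W ↔ ∀ T ∈ J x₁ x₂ z₁ z₂, ContinuousLinearMap.adjoint T ω = 0 := by
      intro ω
      simp [W, Submodule.mem_iInf]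
    have hzR : z₂ η ∈ Wᗮ := by
      refine support_mem hx₂ hgen₂ hz₂ t₂ hφ₂ Wᗮ W.isClosed_orthogonal ?_ ?_ ?_ η
      · intro i ζ hζ ω hω
        rw [← sa_inner (hx₂ i)]
        refine hζ _ ((hW _).2 ?_)
        intro T hT
        have := congrArg (fun A : H' →L[ℂ] H => A ω)
          ((J_adj hx₁ hx₂ hz₁.proj.1 hz₂.proj.1 hT).1 i)
        simp only [ContinuousLinearMap.comp_apply] at this
        rw [this, (hW _).1 hω T hT, map_zero]
      · intro y hy ζ hζ ω hω
        rw [← ContinuousLinearMap.adjoint_inner_left]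
        refine hζ _ ((hW _).2 ?_)
        intro T hT
        have := (hW _).1 hω _ (J_mul hzM hy hT)
        rwa [ContinuousLinearMap.adjoint_comp] at this
      · intro n ω hω
        have h0 : (innerSL ℂ ω) ∘L (lp.evalCLM ℂ (fun _ : ℕ => H') 2 n) ∘L V = 0 := by
          refine lp.ext_continuousLinearMap (by norm_num) ?_
          intro m
          ext ζ
          show ⟪ω, entry V n m ζ⟫_ℂ = 0
          rw [← ContinuousLinearMap.adjoint_inner_left, (hW _).1 hω _ (hVJ n m), inner_zero_left]
        have h1 := congrArg (fun A : L2 H →L[ℂ] ℂ => A (vec ξ₁ s₁)) h0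
        have h2 : V (vec ξ₁ s₁) = vec ξ₂ s₂ := by
          have := v1 []
          simpa [show amp (1 : H →L[ℂ] H) = 1 from rfl,
            show amp (1 : H' →L[ℂ] H') = 1 from rfl] using this
        change ⟪ω, V (vec ξ₁ s₁) n⟫_ℂ = 0 at h1
        rwa [h2] at h1
    have hηW : η ∈ W := (hW η).2 hη
    have h1 := hzR η hηW
    have h2 : z₂ (z₂ η) = z₂ η := congrArg (fun A : H' →L[ℂ] H' => A η) hz₂.proj.2
    rw [← inner_self_eq_zero (𝕜 := ℂ), sa_inner hz₂.proj.1, h2, h1]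
  · intro a b hab f
    have : amp b ∘L V = V ∘L amp a := by
      refine lp.ext_continuousLinearMap (by norm_num) ?_
      intro n
      ext ζ m
      show b (entry V m n ζ) = V (amp a (lp.single 2 n ζ)) m
      rw [amp_single]
      exact congrArg (fun A : H →L[ℂ] H' => A ζ) (hab _ (hVJ m n))
    exact congrArg (fun A : L2 H →L[ℂ] L2 H' => A f) this

lemma normal_aux {𝒥 : Set (H →L[ℂ] H')} {z : H' →L[ℂ] H'} (hd : DenseIn 𝒥 z)
    {ι : Type} (p : ι → (H →L[ℂ] H)) (q : H →L[ℂ] H) (P : ι → (H' →L[ℂ] H')) (Q : H' →L[ℂ] H')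
    (hp : ∀ i, Rel 𝒥 (p i) (P i)) (hq : Rel 𝒥 q Q)
    (hPz : ∀ i, P i ∘L z = P i) (hQz : Q ∘L z = Q)
    (hP : ∀ i, IsProjection (P i)) (ho : ∀ i k, i ≠ k → P i * P k = 0)
    (hs : ∀ ξ : H, HasSum (fun i => p i ξ) (q ξ)) (ξ : H') :
    HasSum (fun i => P i ξ) (Q ξ) := by
  classical
  have hproj : ∀ F : Finset ι, IsStarProjection (∑ i ∈ F, P i) := by
    intro F
    constructor
    · show (∑ i ∈ F, P i) * (∑ i ∈ F, P i) = ∑ i ∈ F, P i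
      rw [Finset.sum_mul_sum]
      refine Finset.sum_congr rfl fun i hi => ?_
      rw [Finset.sum_eq_single i (fun k _ hk => ho i k hk.symm) (fun h => absurd hi h), (hP i).2]
    · exact isSelfAdjoint_sum F fun i _ => (hP i).1
  have hlip : ∀ F : Finset ι, LipschitzWith 1 (fun η => ∑ i ∈ F, P i η) := by
    intro F
    have h1 : ‖∑ i ∈ F, P i‖ ≤ 1 := (hproj F).norm_le
    have h2 := (∑ i ∈ F, P i).lipschitz
    have h3 := h2.weaken (show ‖∑ i ∈ F, P i‖₊ ≤ 1 from h1)
    have e : (fun η => ∑ i ∈ F, P i η) = ((∑ i ∈ F, P i : H' →L[ℂ] H') : H' → H') := by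
      ext η
      simp
    rw [e]
    simpa using h3
  have hcl : IsClosed {η | HasSum (fun i => P i η) (Q η)} :=
    (LipschitzWith.uniformEquicontinuous (fun (F : Finset ι) η => ∑ i ∈ F, P i η) 1
      hlip).equicontinuous.isClosed_setOfPred_tendsto Q.continuous
  let C : Submodule ℂ H' :=
    { carrier := {η | HasSum (fun i => P i η) (Q η)}
      add_mem' := by
        intro a b ha hb
        simpa using HasSum.add ha hb
      zero_mem' := by simp [hasSum_zero]
      smul_mem' := by
        intro c a ha
        simpa using HasSum.const_smul c ha }
  have hCcl : IsClosed (C : Set H') := hcl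
  have hCc : CompleteSpace C := hCcl.completeSpace_coe
  have hperp : Cᗮ = ⊥ := by
    rw [Submodule.eq_bot_iff]
    intro η hη
    have h1 : z η = 0 := by
      apply hd
      intro T hT
      rw [← inner_self_eq_zero (𝕜 := ℂ), ContinuousLinearMap.adjoint_inner_right]
      refine hη _ ?_
      show HasSum _ _
      set ζ := ContinuousLinearMap.adjoint T η
      have h2 := (hs ζ).mapL T
      have e : ∀ i, P i (T ζ) = T (p i ζ) := fun i =>
        congrArg (fun A : H →L[ℂ] H' => A ζ) (hp i T hT)
      have e' : Q (T ζ) = T (q ζ) := congrArg (fun A : H →L[ℂ] H' => A ζ) (hq T hT)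
      simpa only [e, e'] using h2
    have h2 : η ∈ C := by
      show HasSum _ _
      have e : ∀ i, P i η = 0 := fun i => by
        rw [← hPz i, ContinuousLinearMap.comp_apply, h1, map_zero]
      have e' : Q η = 0 := by
        rw [← hQz, ContinuousLinearMap.comp_apply, h1, map_zero]
      simp only [e, e']
      exact hasSum_zero
    exact inner_self_eq_zero.1 (hη η h2)
  have htop : C = ⊤ := (Submodule.orthogonal_eq_bot_iff).1 hperp
  have : ξ ∈ C := by rw [htop]; trivial
  exact this

end Main

/-- **Proposition 2.1.**  Given von Neumann probability spaces `(M₁,φ₁)`, `(M₂,φ₂)` with central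
supports `z₁, z₂`, self-adjoint generating families `x₁, x₂` indexed by the same set `I`, and
equality of all mixed moments, there is a unique `*`-isomorphism `θ : M₁z₁ → M₂z₂` with
`φ₂ ∘ θ = φ₁` on `M₁z₁` and `θ (x₁ i * z₁) = x₂ i * z₂` for all `i`. -/
theorem proposition_2_1
    (M₁ : VonNeumannAlgebra H) (M₂ : VonNeumannAlgebra H')
    (φ₁ : (H →L[ℂ] H) → ℂ) (φ₂ : (H' →L[ℂ] H') → ℂ)
    (hφ₁ : IsNormalState (M₁ : Set (H →L[ℂ] H)) φ₁)
    (hφ₂ : IsNormalState (M₂ : Set (H' →L[ℂ] H')) φ₂)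
    (x₁ : I → (H →L[ℂ] H)) (x₂ : I → (H' →L[ℂ] H'))
    (hx₁ : ∀ i, IsSelfAdjoint (x₁ i)) (hx₂ : ∀ i, IsSelfAdjoint (x₂ i))
    (hgen₁ : (M₁ : Set (H →L[ℂ] H)) = vN (Set.range x₁))
    (hgen₂ : (M₂ : Set (H' →L[ℂ] H')) = vN (Set.range x₂))
    (z₁ : H →L[ℂ] H) (z₂ : H' →L[ℂ] H')
    (hz₁ : IsCentralSupport (M₁ : Set (H →L[ℂ] H)) φ₁ z₁)
    (hz₂ : IsCentralSupport (M₂ : Set (H' →L[ℂ] H')) φ₂ z₂)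
    (hmom : ∀ l : List I, φ₁ (l.map x₁).prod = φ₂ (l.map x₂).prod) :
    ∃ θ : (H →L[ℂ] H) → (H' →L[ℂ] H'),
      Stmt0Iso (M₁ : Set (H →L[ℂ] H)) (M₂ : Set (H' →L[ℂ] H')) φ₁ φ₂ x₁ x₂ z₁ z₂ θ ∧
      ∀ θ' : (H →L[ℂ] H) → (H' →L[ℂ] H'),
        Stmt0Iso (M₁ : Set (H →L[ℂ] H)) (M₂ : Set (H' →L[ℂ] H')) φ₁ φ₂ x₁ x₂ z₁ z₂ θ' →
        Set.EqOn θ' θ ((· * z₁) '' (M₁ : Set (H →L[ℂ] H))) := by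
  obtain ⟨ξ₁, s₁, t₁, hs₁⟩ := hφ₁
  obtain ⟨ξ₂, s₂, t₂, hs₂⟩ := hφ₂
  obtain ⟨D₂, V, v1, v2, v3, v4⟩ := main_V M₁ M₂ s₁ t₁ hs₁ s₂ t₂ hs₂ hx₁ hx₂ hgen₁ hgen₂ hz₁ hz₂ hmom
  obtain ⟨D₁, -⟩ := main_V M₂ M₁ s₂ t₂ hs₂ s₁ t₁ hs₁ hx₂ hx₁ hgen₂ hgen₁ hz₂ hz₁
    (fun l => (hmom l).symm)
  have sa₁ := hz₁.proj.1
  have sa₂ := hz₂.proj.1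
  have zz₁ := hz₁.proj.2
  have zz₂ := hz₂.proj.2
  have hzm₁ : z₁ ∈ M₁ := hz₁.mem
  have hzm₂ : z₂ ∈ M₂ := hz₂.mem
  have hgm₁ : ∀ a ∈ M₁, a ∈ vN (Set.range x₁) := fun a ha => by rw [← hgen₁]; exact ha
  have hgm₂ : ∀ a ∈ M₂, a ∈ vN (Set.range x₂) := fun a ha => by rw [← hgen₂]; exact ha
  have hS₁ : ∀ a, a ∈ (· * z₁) '' (M₁ : Set (H →L[ℂ] H)) ↔ a ∈ M₁ ∧ a * z₁ = a := by
    intro a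
    constructor
    · rintro ⟨m, hm, rfl⟩
      refine ⟨mul_mem hm hzm₁, ?_⟩
      simp only [mul_assoc, zz₁]
    · rintro ⟨h1, h2⟩
      exact ⟨a, h1, h2⟩
  have hS₂ : ∀ a, a ∈ (· * z₂) '' (M₂ : Set (H' →L[ℂ] H')) ↔ a ∈ M₂ ∧ a * z₂ = a := by
    intro a
    constructor
    · rintro ⟨m, hm, rfl⟩
      refine ⟨mul_mem hm hzm₂, ?_⟩
      simp only [mul_assoc, zz₂]
    · rintro ⟨h1, h2⟩
      exact ⟨a, h1, h2⟩
  have hex : ∀ a : H →L[ℂ] H, ∃ b : H' →L[ℂ] H', a ∈ M₁ →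
      (b ∈ M₂ ∧ b * z₂ = b ∧ Rel (J x₁ x₂ z₁ z₂) a b) := by
    intro a
    by_cases ha : a ∈ M₁
    · obtain ⟨b, h⟩ := exists_rel M₁ M₂ hx₁ hx₂ hgen₁ hgen₂ sa₁ sa₂ D₂ hzm₂ ha
      exact ⟨b, fun _ => h⟩
    · exact ⟨0, fun h => absurd h ha⟩
  choose θ hθ using hex
  have hu : ∀ {a b}, a ∈ M₁ → b * z₂ = b → Rel (J x₁ x₂ z₁ z₂) a b → θ a = b := by
    intro a b ha hb hr
    refine uniq1 sa₂ D₂ (hθ a ha).2.1 hb ?_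
    intro T hT
    rw [(hθ a ha).2.2 T hT, hr T hT]
  have hback : ∀ b ∈ M₂, b * z₂ = b → ∃ a ∈ M₁, a * z₁ = a ∧ Rel (J x₁ x₂ z₁ z₂) a b := by
    intro b hb hbz
    obtain ⟨a, ha, haz, hr⟩ := exists_rel M₂ M₁ hx₂ hx₁ hgen₂ hgen₁ sa₂ sa₁ D₁ hzm₁ hb
    exact ⟨a, ha, haz, rel_swap hx₂ hx₁ sa₂ sa₁ D₁ (hgm₂ b hb) haz hr⟩
  have hadd : ∀ x ∈ M₁, ∀ y ∈ M₁, θ (x + y) = θ x + θ y := by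
    intro x hx y hy
    refine hu (add_mem hx hy) (by rw [add_mul, (hθ x hx).2.1, (hθ y hy).2.1]) ?_
    intro T hT
    rw [ContinuousLinearMap.add_comp, ContinuousLinearMap.comp_add, (hθ x hx).2.2 T hT,
      (hθ y hy).2.2 T hT]
  have hsmul : ∀ (c : ℂ), ∀ x ∈ M₁, θ (c • x) = c • θ x := by
    intro c x hx
    refine hu (M₁.toStarSubalgebra.smul_mem hx c) (by rw [smul_mul_assoc, (hθ x hx).2.1]) ?_
    intro T hT
    rw [ContinuousLinearMap.smul_comp, ContinuousLinearMap.comp_smul, (hθ x hx).2.2 T hT]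
  have hmul : ∀ x ∈ M₁, ∀ y ∈ M₁, θ (x * y) = θ x * θ y := by
    intro x hx y hy
    refine hu (mul_mem hx hy) (by rw [mul_assoc, (hθ y hy).2.1]) ?_
    intro T hT
    show (θ x ∘L θ y) ∘L T = T ∘L (x ∘L y)
    rw [ContinuousLinearMap.comp_assoc, (hθ y hy).2.2 T hT, ← ContinuousLinearMap.comp_assoc,
      (hθ x hx).2.2 T hT, ContinuousLinearMap.comp_assoc]
  have hstar : ∀ x ∈ M₁, θ (star x) = star (θ x) := by
    intro x hx
    refine hu (star_mem hx) ?_ ?_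
    · have := congrArg star (hθ x hx).2.1
      rw [star_mul, sa₂.star_eq] at this
      rw [← hz₂.central _ (star_mem (hθ x hx).1)]
      exact this
    · exact rel_star hx₁ hx₂ sa₁ sa₂ D₂ (hgm₁ x hx) (hθ x hx).2.1 (hθ x hx).2.2
  have hxm₁ : ∀ i, x₁ i ∈ M₁ := fun i => by
    simpa using word_mem M₁ hgen₁ [i]
  have hxm₂ : ∀ i, x₂ i ∈ M₂ := fun i => by
    simpa using word_mem M₂ hgen₂ [i]
  have hΩ : V (vec ξ₁ s₁) = vec ξ₂ s₂ := by
    have := v1 []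
    simpa [show amp (1 : H →L[ℂ] H) = 1 from rfl,
      show amp (1 : H' →L[ℂ] H') = 1 from rfl] using this
  have hiso : Stmt0Iso (M₁ : Set (H →L[ℂ] H)) (M₂ : Set (H' →L[ℂ] H')) φ₁ φ₂ x₁ x₂ z₁ z₂ θ := by
    refine ⟨?_, ?_, ?_, ⟨?_, ?_, ?_, ?_⟩, ?_, ?_, ?_⟩
    · intro a ha
      have ha' := ((hS₁ a).1 ha).1
      exact (hS₂ _).2 ⟨(hθ a ha').1, (hθ a ha').2.1⟩
    · intro b hb
      obtain ⟨hb1, hb2⟩ := (hS₂ b).1 hb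
      obtain ⟨a, ha, haz, hr⟩ := hback b hb1 hb2
      exact ⟨a, (hS₁ a).2 ⟨ha, haz⟩, hu ha hb2 hr⟩
    · intro a ha a' ha' h
      obtain ⟨h1, h2⟩ := (hS₁ a).1 ha
      obtain ⟨h1', h2'⟩ := (hS₁ a').1 ha'
      have r := rel_swap hx₁ hx₂ sa₁ sa₂ D₂ (hgm₁ a h1) (hθ a h1).2.1 (hθ a h1).2.2
      have r' := rel_swap hx₁ hx₂ sa₁ sa₂ D₂ (hgm₁ a' h1') (hθ a' h1').2.1 (hθ a' h1').2.2
      refine uniq1 sa₁ D₁ h2 h2' ?_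
      intro T hT
      rw [r T hT, r' T hT, h]
    · exact fun x hx y hy => hadd x ((hS₁ x).1 hx).1 y ((hS₁ y).1 hy).1
    · exact fun c x hx => hsmul c x ((hS₁ x).1 hx).1
    · exact fun x hx y hy => hmul x ((hS₁ x).1 hx).1 y ((hS₁ y).1 hy).1
    · exact fun x hx => hstar x ((hS₁ x).1 hx).1
    · intro ι p q hp hq hpr hpo hsum
      have hp' : ∀ i, p i ∈ M₁ := fun i => ((hS₁ _).1 (hp i)).1
      have hq' : q ∈ M₁ := ((hS₁ _).1 hq).1
      refine normal_aux D₂ p q (fun i => θ (p i)) (θ q) (fun i => (hθ _ (hp' i)).2.2)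
        (hθ q hq').2.2 (fun i => (hθ _ (hp' i)).2.1) (hθ q hq').2.1 ?_ ?_ hsum
      · intro i
        refine ⟨?_, ?_⟩
        · show star _ = _
          rw [← hstar _ (hp' i), (hpr i).1.star_eq]
        · rw [← hmul _ (hp' i) _ (hp' i), (hpr i).2]
      · intro i k hik
        rw [← hmul _ (hp' i) _ (hp' k), hpo i k hik]
        exact hu (zero_mem _) (by simp) (fun T _ => by simp)
    · intro a ha
      have ha' := ((hS₁ a).1 ha).1
      rw [state_eq s₁ hs₁ ha', state_eq s₂ hs₂ (hθ a ha').1]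
      rw [← inner_conj_symm, ← inner_conj_symm (amp a (vec ξ₁ s₁)), ← v2,
        ← v4 a (θ a) (hθ a ha').2.2, hΩ]
    · intro i
      refine hu (mul_mem (hxm₁ i) hzm₁) (by rw [mul_assoc, zz₂]) ?_
      intro T hT
      show (x₂ i ∘L z₂) ∘L T = T ∘L (x₁ i * z₁)
      rw [← hz₁.central _ (hxm₁ i)]
      show (x₂ i ∘L z₂) ∘L T = T ∘L (z₁ ∘L x₁ i)
      rw [ContinuousLinearMap.comp_assoc, hT.2.1, ← ContinuousLinearMap.comp_assoc, hT.2.2,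
        hT.1 i]
  refine ⟨θ, hiso, ?_⟩
  intro θ' hθ' a ha
  -- moments with `a` inserted
  have hmoment : ∀ η : (H →L[ℂ] H) → (H' →L[ℂ] H'),
      Stmt0Iso (M₁ : Set (H →L[ℂ] H)) (M₂ : Set (H' →L[ℂ] H')) φ₁ φ₂ x₁ x₂ z₁ z₂ η →
      ∀ l l' : List I, φ₂ ((l.map x₂).prod * η a * (l'.map x₂).prod) =
        φ₁ ((l.map x₁).prod * z₁ * a * ((l'.map x₁).prod * z₁)) := by
    intro η hη l l'
    have hw : ∀ l : List I, (l.map x₁).prod * z₁ ∈ (· * z₁) '' (M₁ : Set (H →L[ℂ] H)) :=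
      fun l => ⟨_, word_mem M₁ hgen₁ l, rfl⟩
    have hz1 : η z₁ = z₂ := by
      have hzS : z₁ ∈ (· * z₁) '' (M₁ : Set (H →L[ℂ] H)) := (hS₁ _).2 ⟨hzm₁, zz₁⟩
      obtain ⟨e, he, hez⟩ := hη.surjOn ((hS₂ _).2 ⟨hzm₂, zz₂⟩)
      have h1 := hη.hom.map_mul z₁ hzS e he
      have h2 : z₁ * e = e := by
        rw [hz₁.central e ((hS₁ e).1 he).1, ((hS₁ e).1 he).2]
      rw [h2, hez, ((hS₂ _).1 (hη.mapsTo hzS)).2] at h1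
      exact h1.symm
    have hηw : ∀ l : List I, η ((l.map x₁).prod * z₁) = (l.map x₂).prod * z₂ := by
      intro l
      induction l with
      | nil => simpa using hz1
      | cons i l ih =>
        have e1 : ((i :: l).map x₁).prod * z₁ = (x₁ i * z₁) * ((l.map x₁).prod * z₁) := by
          have := hz₁.central _ (word_mem M₁ hgen₁ l)
          rw [← this, mul_assoc (x₁ i), ← mul_assoc z₁ z₁, zz₁, this]
          simp [mul_assoc]
        have e2 : ((i :: l).map x₂).prod * z₂ = (x₂ i * z₂) * ((l.map x₂).prod * z₂) := by
          have := hz₂.central _ (word_mem M₂ hgen₂ l)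
          rw [← this, mul_assoc (x₂ i), ← mul_assoc z₂ z₂, zz₂, this]
          simp [mul_assoc]
        rw [e1, e2, hη.hom.map_mul _ ⟨_, hxm₁ i, rfl⟩ _ (hw l), hη.gen, ih]
    have hSm : ∀ u ∈ (· * z₁) '' (M₁ : Set (H →L[ℂ] H)),
        ∀ v ∈ (· * z₁) '' (M₁ : Set (H →L[ℂ] H)), u * v ∈ (· * z₁) '' (M₁ : Set (H →L[ℂ] H)) := by
      intro u hu v hv
      obtain ⟨h1, h2⟩ := (hS₁ u).1 hu
      obtain ⟨h3, h4⟩ := (hS₁ v).1 hv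
      exact (hS₁ _).2 ⟨mul_mem h1 h3, by rw [mul_assoc, h4]⟩
    have h1 := hη.state _ (hSm _ (hSm _ (hw l) _ ha) _ (hw l'))
    rw [hη.hom.map_mul _ (hSm _ (hw l) _ ha) _ (hw l'), hη.hom.map_mul _ (hw l) _ ha, hηw,
      hηw] at h1
    rw [← h1]
    congr 1
    obtain ⟨h3, h4⟩ := (hS₂ _).1 (hη.mapsTo ha)
    have c1 : z₂ * η a = η a := by rw [hz₂.central _ h3, h4]
    rw [← hz₂.central _ (word_mem M₂ hgen₂ l'), mul_assoc _ z₂ (η a), c1,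
      mul_assoc _ (η a) (z₂ * _), ← mul_assoc (η a) z₂, h4, mul_assoc]
  obtain ⟨hb, hbz⟩ := (hS₂ _).1 (hiso.mapsTo ha)
  obtain ⟨hb', hbz'⟩ := (hS₂ _).1 (hθ'.mapsTo ha)
  have hdM : θ' a - θ a ∈ M₂ := sub_mem hb' hb
  have hdz : (θ' a - θ a) * z₂ = θ' a - θ a := by rw [sub_mul, hbz, hbz']
  obtain ⟨c, hc, hcz, hcr⟩ := hback _ hdM hdz
  have hin : ∀ b ∈ M₂, ∀ l l' : List I,
      ⟪amp b (amp (l'.map x₂).prod (vec ξ₂ s₂)), amp (l.map x₂).prod (vec ξ₂ s₂)⟫_ℂ =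
        φ₂ ((l.reverse.map x₂).prod * b * (l'.map x₂).prod) := by
    intro b hb l l'
    rw [state_eq s₂ hs₂ (mul_mem (mul_mem (word_mem M₂ hgen₂ l.reverse) hb)
      (word_mem M₂ hgen₂ l')), ← amp_word x₂ l,
      inner_word (fun i => amp (x₂ i)) (fun i => amp_sa (hx₂ i)), amp_word]
    rfl
  have hvan : ∀ l' : List I, amp (θ' a - θ a) (amp (l'.map x₂).prod (vec ξ₂ s₂)) = 0 := by
    intro l'
    have h1 : ∀ l : List I, ⟪amp (θ' a - θ a) (amp (l'.map x₂).prod (vec ξ₂ s₂)),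
        amp (l.map x₂).prod (vec ξ₂ s₂)⟫_ℂ = 0 := by
      intro l
      have e : amp (θ' a - θ a) (amp (l'.map x₂).prod (vec ξ₂ s₂)) =
          amp (θ' a) (amp (l'.map x₂).prod (vec ξ₂ s₂)) -
          amp (θ a) (amp (l'.map x₂).prod (vec ξ₂ s₂)) := by
        ext n; rfl
      rw [e, inner_sub_left, hin _ hb', hin _ hb, hmoment θ' hθ', hmoment θ hiso, sub_self]
    have h2 := v3 (innerSL ℂ (amp (θ' a - θ a) (amp (l'.map x₂).prod (vec ξ₂ s₂)))) h1
      (amp c (amp (l'.map x₁).prod (vec ξ₁ s₁)))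
    rw [← v4 c _ hcr, v1] at h2
    exact inner_self_eq_zero.1 h2
  rw [← sub_eq_zero]
  set d := θ' a - θ a with hd
  let R : Submodule ℂ H' := ⨅ l : List I, LinearMap.ker (d * (l.map x₂).prod).toLinearMap
  have hR : ∀ ω, ω ∈ R ↔ ∀ l : List I, d ((l.map x₂).prod ω) = 0 := by
    intro ω
    simp [R, Submodule.mem_iInf]
  have hRcl : IsClosed (R : Set H') := by
    have : (R : Set H') = ⋂ l : List I, {ω | (d * (l.map x₂).prod) ω = 0} := by
      ext ω
      rw [SetLike.mem_coe, hR, Set.mem_iInter]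
      rfl
    rw [this]
    exact isClosed_iInter fun l =>
      isClosed_eq (d * (l.map x₂).prod).continuous continuous_const
  have hzR : ∀ η, z₂ η ∈ R := by
    refine support_mem hx₂ hgen₂ hz₂ t₂ hs₂ R hRcl ?_ ?_ ?_
    · intro i ω hω
      rw [hR] at hω ⊢
      intro l
      have := hω (l ++ [i])
      simpa using this
    · intro y hy ω hω
      rw [hR] at hω ⊢
      intro l
      have h1 := hgm₂ _ (mul_mem hdM (word_mem M₂ hgen₂ l)) y hy
      have h2 := congrArg (fun A : H' →L[ℂ] H' => A ω) h1
      simp only [mul_apply_eq_comp] at h2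
      rw [← h2, hω l, map_zero]
    · intro n
      rw [hR]
      intro l
      exact congrArg (fun f : L2 H' => f n) (hvan l)
  rw [← hdz]
  ext η
  have := (hR _).1 (hzR η) []
  simpa using this

end Paper
end
end

section
/- Let (M₁,φ₁) and (M₂,φ₂) be von Neumann probability spaces. Suppose S⁽ʲ⁾ = {x⁽ʲ⁾_i : i ∈ I} ⊂ M_j are sets of self-adjoint elements, indexed by the same set I, such that S⁽¹⁾ generates M₁ as a von Neumann algebra and the von Neumann algebra N generated by S⁽²⁾ inside M₂ is a factor. If φ₁(x⁽¹⁾_𝐢) = φ₂(x⁽²⁾_𝐢) for every finite multi-index 𝐢 ∈ I*, then there exists a unique normal unital *-homomorphism θ : M₁ → N ⊂ M₂ such that θ(x⁽¹⁾_i) = x⁽²⁾_i for all i ∈ I. -/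
set_option synthInstance.maxHeartbeats 400000
set_option maxHeartbeats 1000000

open scoped InnerProductSpace ComplexConjugate

noncomputable section

namespace Paper

variable {H : Type} [NormedAddCommGroup H] [InnerProductSpace ℂ H] [CompleteSpace H]
variable {H' : Type} [NormedAddCommGroup H'] [InnerProductSpace ℂ H'] [CompleteSpace H']

variable {I : Type}

set_option linter.unusedSectionVars false

theorem mulv (a b : H →L[ℂ] H) (v : H) : (a * b) v = a (b v) := rfl

section Aux
variable {E E' F : Type} [NormedAddCommGroup E] [InnerProductSpace ℂ E] [CompleteSpace E]
  [NormedAddCommGroup E'] [InnerProductSpace ℂ E'] [CompleteSpace E'] [AddCommGroup F] [Module ℂ F]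

theorem exists_ext (e : F →ₗ[ℂ] E) (g : F →ₗ[ℂ] E') (C : ℝ) (h : ∀ x, ‖g x‖ ≤ C * ‖e x‖) :
    ∃ V : E →L[ℂ] E', (∀ x, V (e x) = g x) ∧ ∀ k, (∀ x, ⟪e x, k⟫_ℂ = 0) → V k = 0 := by
  let K := (LinearMap.range e).topologicalClosure
  have hK : ∀ x, e x ∈ K := fun x => Submodule.le_topologicalClosure _ ⟨x, rfl⟩
  have : CompleteSpace K := (Submodule.isClosed_topologicalClosure _).completeSpace_coe
  let e' : F →ₗ[ℂ] K := e.codRestrict K hK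
  have hd : DenseRange e' := by
    intro y
    rw [Metric.mem_closure_iff]
    intro ε hε
    have hy : (y : E) ∈ closure (LinearMap.range e : Set E) := y.2
    obtain ⟨b, ⟨x, rfl⟩, hb⟩ := Metric.mem_closure_iff.1 hy ε hε
    exact ⟨e' x, ⟨x, rfl⟩, hb⟩
  refine ⟨(g.extendOfNorm e').comp K.orthogonalProjectionOnto, ?_, ?_⟩
  · intro x
    have h1 : K.orthogonalProjectionOnto (e x) = e' x :=
      Submodule.orthogonalProjectionOnto_mem_subspace_eq_self (e' x)
    have h2 := LinearMap.extendOfNorm_eq (f := g) hd ⟨C, h⟩ x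
    simp only [ContinuousLinearMap.comp_apply]
    rw [h1, h2]
  · intro k hk
    have : k ∈ Kᗮ := by
      rw [Submodule.orthogonal_closure, Submodule.mem_orthogonal]
      rintro _ ⟨x, rfl⟩
      exact hk x
    simp only [ContinuousLinearMap.comp_apply]
    rw [Submodule.orthogonalProjectionOnto_eq_zero_iff.2 this, map_zero]

theorem intertwine (e : F →ₗ[ℂ] E) (g : F →ₗ[ℂ] E') (V : E →L[ℂ] E')
    (h1 : ∀ x, V (e x) = g x) (h2 : ∀ k, (∀ x, ⟪e x, k⟫_ℂ = 0) → V k = 0)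
    (T : E →L[ℂ] E) (S : E' →L[ℂ] E')
    (hT : ∀ x, ∃ x', T (e x) = e x' ∧ S (g x) = g x')
    (hT' : ∀ x, ∃ x', (star T) (e x) = e x') (k : E) : V (T k) = S (V k) := by
  let K := (LinearMap.range e).topologicalClosure
  have : CompleteSpace K := (Submodule.isClosed_topologicalClosure _).completeSpace_coe
  have key1 : ∀ k ∈ K, V (T k) = S (V k) := by
    intro k hk
    have hc : IsClosed {k : E | V (T k) = S (V k)} :=
      isClosed_eq (by fun_prop) (by fun_prop)
    have hs : (LinearMap.range e : Set E) ⊆ {k : E | V (T k) = S (V k)} := by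
      rintro _ ⟨x, rfl⟩
      obtain ⟨x', a, b⟩ := hT x
      simp only [Set.mem_ofPred_eq]
      rw [a, h1, h1, b]
    exact closure_minimal hs hc hk
  have key2 : ∀ k ∈ Kᗮ, V (T k) = S (V k) := by
    intro k hk
    rw [Submodule.orthogonal_closure, Submodule.mem_orthogonal] at hk
    rw [h2 k (fun x => hk _ ⟨x, rfl⟩), map_zero]
    apply h2
    intro x
    obtain ⟨x', hx'⟩ := hT' x
    rw [← ContinuousLinearMap.adjoint_inner_left, ← ContinuousLinearMap.star_eq_adjoint, hx']
    exact hk _ ⟨x', rfl⟩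
  have hk : k ∈ K ⊔ Kᗮ := by rw [Submodule.sup_orthogonal_of_hasOrthogonalProjection]; trivial
  obtain ⟨a, ha, b, hb, rfl⟩ := Submodule.mem_sup.1 hk
  simp only [map_add]
  rw [key1 a ha, key2 b hb]

end Aux

/-! ### Membership in a von Neumann algebra -/

theorem mem_of_comm (M : VonNeumannAlgebra H) (x : H →L[ℂ] H)
    (h : ∀ c ∈ Set.centralizer (M : Set (H →L[ℂ] H)), c * x = x * c) : x ∈ M := by
  have : x ∈ Set.centralizer (Set.centralizer (M : Set (H →L[ℂ] H))) := fun c hc => h c hc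
  rw [VonNeumannAlgebra.centralizer_centralizer] at this
  exact this

theorem smul_mem_M (M : VonNeumannAlgebra H) (c : ℂ) {x : H →L[ℂ] H} (hx : x ∈ M) : c • x ∈ M :=
  M.toStarSubalgebra.smul_mem hx c

theorem comm_of_mem (M : VonNeumannAlgebra H) {x : H →L[ℂ] H} (hx : x ∈ M) {c : H →L[ℂ] H}
    (hc : c ∈ Set.centralizer (M : Set (H →L[ℂ] H))) : x * c = c * x := hc x hx

theorem star_mem_centralizer (M : VonNeumannAlgebra H) {c : H →L[ℂ] H}
    (hc : c ∈ Set.centralizer (M : Set (H →L[ℂ] H))) :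
    star c ∈ Set.centralizer (M : Set (H →L[ℂ] H)) := by
  rw [← VonNeumannAlgebra.coe_commutant] at *
  exact star_mem (S := VonNeumannAlgebra H) hc

theorem exists_sqrt (M : VonNeumannAlgebra H) {y : H →L[ℂ] H} (hy : y ∈ M) (h0 : 0 ≤ y) :
    ∃ s ∈ M, star s = s ∧ s * s = y := by
  refine ⟨CFC.sqrt y, ?_, ?_, CFC.sqrt_mul_sqrt_self y h0⟩
  · apply mem_of_comm
    intro c hc
    have h : Commute y c := comm_of_mem M hy hc
    rw [CFC.sqrt]
    exact (h.cfcₙ_nnreal _).symm.eq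
  · exact (IsSelfAdjoint.of_nonneg (CFC.sqrt_nonneg y)).star_eq

theorem proj_of_submodule_mem (M : VonNeumannAlgebra H) (K : Submodule ℂ H) [CompleteSpace K]
    (h : ∀ c ∈ Set.centralizer (M : Set (H →L[ℂ] H)), ∀ v ∈ K, c v ∈ K) :
    K.starProjection ∈ M := by
  rw [VonNeumannAlgebra.IsStarProjection.mem_iff isStarProjection_starProjection]
  intro y hy
  rw [Module.End.mem_invtSubmodule]
  intro v hv
  have hv' : v ∈ K := by simpa using hv
  have := h y (by rw [← VonNeumannAlgebra.coe_commutant]; exact hy) v hv'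
  simpa using this

theorem isProjection_starProjection (K : Submodule ℂ H) [CompleteSpace K] :
    IsProjection K.starProjection :=
  ⟨isStarProjection_starProjection.isSelfAdjoint, isStarProjection_starProjection.isIdempotentElem⟩

/-! ### Projections -/

theorem IsProjection.inner_eq {p : H →L[ℂ] H} (hp : IsProjection p) (v : H) :
    ⟪p v, v⟫_ℂ = ((‖p v‖ ^ 2 : ℝ) : ℂ) := by
  have h1 : ∀ u w, ⟪p u, w⟫_ℂ = ⟪u, p w⟫_ℂ := hp.1.isSymmetric
  have h2 : p (p v) = p v := by rw [← mulv, hp.2]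
  rw [← h2, h1, h2, inner_self_eq_norm_sq_to_K]
  norm_cast

theorem IsProjection.norm_le {p : H →L[ℂ] H} (hp : IsProjection p) (v : H) : ‖p v‖ ≤ ‖v‖ := by
  have h := hp.inner_eq v
  have h2 : ‖p v‖ ^ 2 ≤ ‖p v‖ * ‖v‖ := by
    have := norm_inner_le_norm (𝕜 := ℂ) (p v) v
    rw [h, Complex.norm_real, Real.norm_of_nonneg (by positivity)] at this
    exact this
  by_contra! hlt
  have : 0 < ‖p v‖ := (norm_nonneg v).trans_lt hlt
  nlinarith

theorem IsProjection.sum {ι : Type} {p : ι → (H →L[ℂ] H)} (hp : ∀ i, IsProjection (p i))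
    (ho : ∀ i k, i ≠ k → p i * p k = 0) (s : Finset ι) : IsProjection (∑ i ∈ s, p i) := by
  classical
  constructor
  · rw [IsSelfAdjoint, star_sum]
    exact Finset.sum_congr rfl fun i _ => (hp i).1
  · rw [Finset.sum_mul_sum]
    refine Finset.sum_congr rfl fun i hi => ?_
    rw [Finset.sum_eq_single_of_mem i hi (fun k _ hk => ho i k hk.symm), (hp i).2]

theorem IsProjection.one_sub {p : H →L[ℂ] H} (hp : IsProjection p) : IsProjection (1 - p) := by
  refine ⟨(IsSelfAdjoint.one _).sub hp.1, ?_⟩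
  simp [sub_mul, mul_sub, hp.2]

theorem IsProjection.mul_comm_of {p e : H →L[ℂ] H} (hp : IsProjection p) (he : IsProjection e)
    (h : p * e = p) : e * p = p := by
  have := congrArg star h
  rwa [star_mul, hp.1.star_eq, he.1.star_eq] at this

theorem IsProjection.sub {p e : H →L[ℂ] H} (hp : IsProjection p) (he : IsProjection e)
    (h : p * e = p) : IsProjection (e - p) := by
  refine ⟨he.1.sub hp.1, ?_⟩
  rw [sub_mul, mul_sub, mul_sub, hp.2, he.2, h, hp.mul_comm_of he h]; simp

theorem IsProjection.map {S : Set (H →L[ℂ] H)} {Θ : (H →L[ℂ] H) → (H' →L[ℂ] H')}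
    (hΘ : IsStarHomOn S Θ) {p : H →L[ℂ] H} (hp : IsProjection p) (hpS : p ∈ S) :
    IsProjection (Θ p) := by
  constructor
  · rw [IsSelfAdjoint, ← hΘ.map_star p hpS, hp.1.star_eq]
  · rw [← hΘ.map_mul p hpS p hpS, hp.2]

theorem IsStarHomOn.map_zero (M : VonNeumannAlgebra H) {Θ : (H →L[ℂ] H) → (H' →L[ℂ] H')}
    (hΘ : IsStarHomOn (M : Set (H →L[ℂ] H)) Θ) : Θ 0 = 0 := by
  have := hΘ.map_smul 0 0 (zero_mem M)
  simpa using this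

theorem IsStarHomOn.map_sub (M : VonNeumannAlgebra H) {Θ : (H →L[ℂ] H) → (H' →L[ℂ] H')}
    (hΘ : IsStarHomOn (M : Set (H →L[ℂ] H)) Θ) {x y : H →L[ℂ] H} (hx : x ∈ M) (hy : y ∈ M) :
    Θ (x - y) = Θ x - Θ y := by
  have h := hΘ.map_add (x - y) (sub_mem hx hy) y hy
  rw [sub_add_cancel] at h
  exact eq_sub_of_add_eq h.symm

/-! ### Density of ranges of intertwiners -/

theorem proj_comm (K : Submodule ℂ H) [CompleteSpace K] (c : H →L[ℂ] H)
    (h1 : ∀ v ∈ K, c v ∈ K) (h2 : ∀ v ∈ K, (star c) v ∈ K) :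
    c * K.starProjection = K.starProjection * c := by
  have key : ∀ d : H →L[ℂ] H, (∀ v ∈ K, d v ∈ K) →
      K.starProjection * d * K.starProjection = d * K.starProjection := by
    intro d hd
    ext v
    simp only [mulv]
    rw [Submodule.starProjection_eq_self_iff]
    exact hd _ (Submodule.starProjection_apply_mem K v)
  have a := key c h1
  have b := congrArg star (key _ h2)
  simp only [star_mul, star_star, (isProjection_starProjection K).1.star_eq] at b
  rw [mul_assoc] at a
  exact a.symm.trans b

theorem star_mem_centralizer_range {I : Type} {x : I → (H →L[ℂ] H)}
    (hx : ∀ i, IsSelfAdjoint (x i)) {c : H →L[ℂ] H} (hc : c ∈ Set.centralizer (Set.range x)) :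
    star c ∈ Set.centralizer (Set.range x) := by
  rintro _ ⟨i, rfl⟩
  have := congrArg star (hc (x i) ⟨i, rfl⟩)
  simp only [star_mul, (hx i).star_eq] at this
  exact this.symm

theorem dense_ranges {I : Type} (x₂ : I → (H' →L[ℂ] H')) (hx₂ : ∀ i, IsSelfAdjoint (x₂ i))
    (hfactor : IsFactorSet (vN (Set.range x₂))) (D : Set (H →L[ℂ] H'))
    (h1 : ∀ c ∈ Set.centralizer (Set.range x₂), ∀ B ∈ D, c.comp B ∈ D)
    (h2 : ∀ i, ∀ B ∈ D, ∃ y : H →L[ℂ] H, (x₂ i).comp B = B.comp y)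
    (h3 : ∃ B ∈ D, B ≠ 0) :
    (Submodule.span ℂ {v | ∃ B ∈ D, ∃ k, B k = v}).topologicalClosure = ⊤ := by
  let K := (Submodule.span ℂ {v | ∃ B ∈ D, ∃ k, B k = v}).topologicalClosure
  have hKc : IsClosed (K : Set H') := Submodule.isClosed_topologicalClosure _
  have : CompleteSpace K := hKc.completeSpace_coe
  have hmem : ∀ B ∈ D, ∀ k, B k ∈ K := fun B hB k =>
    Submodule.le_topologicalClosure _ (Submodule.subset_span ⟨B, hB, k, rfl⟩)
  have inv : ∀ c : H' →L[ℂ] H', (∀ B ∈ D, ∀ k, c (B k) ∈ K) → ∀ v ∈ K, c v ∈ K := by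
    intro c hc v hv
    have hle : (Submodule.span ℂ {v | ∃ B ∈ D, ∃ k, B k = v}) ≤ K.comap (c : H' →ₗ[ℂ] H') := by
      rw [Submodule.span_le]
      rintro _ ⟨B, hB, k, rfl⟩
      exact hc B hB k
    have hcl : IsClosed ((K.comap (c : H' →ₗ[ℂ] H') : Submodule ℂ H') : Set H') :=
      hKc.preimage c.continuous
    exact Submodule.topologicalClosure_minimal _ hle hcl hv
  have i1 : ∀ c ∈ Set.centralizer (Set.range x₂), ∀ v ∈ K, c v ∈ K := fun c hc =>
    inv c (fun B hB k => hmem _ (h1 c hc B hB) k)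
  have i2 : ∀ i, ∀ v ∈ K, x₂ i v ∈ K := fun i => inv _ (fun B hB k => by
    obtain ⟨y, hy⟩ := h2 i B hB
    have := congrArg (fun T => T k) hy
    simp only [ContinuousLinearMap.comp_apply] at this
    rw [this]
    exact hmem B hB _)
  have q1 : K.starProjection ∈ Set.centralizer (Set.range x₂) := by
    rintro _ ⟨i, rfl⟩
    exact proj_comm K _ (i2 i) (by rw [(hx₂ i).star_eq]; exact i2 i)
  have q2 : K.starProjection ∈ vN (Set.range x₂) := by
    intro c hc
    exact proj_comm K c (i1 c hc) (i1 _ (star_mem_centralizer_range hx₂ hc))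
  obtain ⟨c, hc⟩ := hfactor _ q2 (fun y hy => hy _ q1)
  obtain ⟨B, hB, hB0⟩ := h3
  obtain ⟨k, hk⟩ : ∃ k, B k ≠ 0 := by
    by_contra! h
    exact hB0 (ContinuousLinearMap.ext h)
  have hs : K.starProjection (B k) = B k := Submodule.starProjection_eq_self_iff.2 (hmem B hB k)
  have hc1 : c = 1 := by
    rw [hc] at hs
    have : (c - 1) • B k = 0 := by
      rw [sub_smul, one_smul]; simpa [sub_eq_zero] using hs
    rcases smul_eq_zero.1 this with h | h
    · exact sub_eq_zero.1 h
    · exact absurd h hk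
  rw [eq_top_iff]
  intro v _
  have : K.starProjection v = v := by rw [hc, hc1]; simp
  exact Submodule.starProjection_eq_self_iff.1 this

theorem ext_of_dense {G : Type} [NormedAddCommGroup G] [NormedSpace ℂ G] {D : Set (H →L[ℂ] H')}
    (hD : (Submodule.span ℂ {v | ∃ B ∈ D, ∃ k, B k = v}).topologicalClosure = ⊤)
    {S T : H' →L[ℂ] G} (h : ∀ B ∈ D, ∀ k, S (B k) = T (B k)) : S = T := by
  have hle : (Submodule.span ℂ {v | ∃ B ∈ D, ∃ k, B k = v}) ≤
      LinearMap.eqLocus (S : H' →ₗ[ℂ] G) (T : H' →ₗ[ℂ] G) := by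
    rw [Submodule.span_le]
    rintro _ ⟨B, hB, k, rfl⟩
    exact h B hB k
  have hcl : IsClosed (LinearMap.eqLocus (S : H' →ₗ[ℂ] G) (T : H' →ₗ[ℂ] G) : Set H') :=
    isClosed_eq S.continuous T.continuous
  ext v
  have hv : v ∈ (Submodule.span ℂ {v | ∃ B ∈ D, ∃ k, B k = v}).topologicalClosure := by
    rw [hD]; trivial
  exact Submodule.topologicalClosure_minimal _ hle hcl hv

/-! ### Existence of a nonzero intertwiner -/

/-- The amplification of an operator to the `ℓ²`-sum of countably many copies. -/
def ampl (T : H →L[ℂ] H) : lp (fun _ : ℕ => H) 2 →L[ℂ] lp (fun _ : ℕ => H) 2 :=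
  lp.mapCLM 2 (fun _ => T) (norm_nonneg T) (fun _ => le_rfl)

theorem ampl_apply (T : H →L[ℂ] H) (f : lp (fun _ : ℕ => H) 2) (n : ℕ) :
    (ampl T f) n = T (f n) := by
  simp [ampl]

theorem star_ampl (T : H →L[ℂ] H) : star (ampl T) = ampl (star T) := by
  rw [ContinuousLinearMap.star_eq_adjoint, eq_comm, ContinuousLinearMap.eq_adjoint_iff]
  intro f g
  rw [lp.inner_eq_tsum, lp.inner_eq_tsum]
  congr 1
  ext n
  rw [ampl_apply, ampl_apply, ContinuousLinearMap.star_eq_adjoint,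
    ContinuousLinearMap.adjoint_inner_left]

theorem star_word {I : Type} {x : I → (H →L[ℂ] H)} (hx : ∀ i, IsSelfAdjoint (x i)) (l : List I) :
    star (l.map x).prod = (l.reverse.map x).prod := by
  induction l with
  | nil => simp
  | cons a l ih => simp [ih, (hx a).star_eq]

theorem gram_word {I : Type} {x : I → (H →L[ℂ] H)} (hx : ∀ i, IsSelfAdjoint (x i))
    (M : VonNeumannAlgebra H) (hxM : ∀ i, x i ∈ M) (φ : (H →L[ℂ] H) → ℂ) (f : lp (fun _ : ℕ => H) 2)
    (hφ : ∀ x ∈ M, φ x = ∑' n, ⟪x (f n), f n⟫_ℂ) (k l : List I) :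
    ⟪ampl (l.map x).prod f, ampl (k.map x).prod f⟫_ℂ = φ ((k.reverse ++ l).map x).prod := by
  rw [hφ]
  · rw [lp.inner_eq_tsum]
    congr 1
    ext n
    rw [ampl_apply, ampl_apply, List.map_append, List.prod_append, ← star_word hx,
      mulv, ContinuousLinearMap.star_eq_adjoint,
      ContinuousLinearMap.adjoint_inner_left]
  · apply list_prod_mem
    simp only [List.mem_map]
    rintro _ ⟨i, _, rfl⟩
    exact hxM i

theorem norm_lincomb_eq {E E' : Type} [NormedAddCommGroup E] [InnerProductSpace ℂ E]
    [NormedAddCommGroup E'] [InnerProductSpace ℂ E'] {ι : Type} (v : ι → E) (w : ι → E')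
    (h : ∀ i j, ⟪v i, v j⟫_ℂ = ⟪w i, w j⟫_ℂ) (c : ι →₀ ℂ) :
    ‖Finsupp.linearCombination ℂ w c‖ = ‖Finsupp.linearCombination ℂ v c‖ := by
  have : ⟪Finsupp.linearCombination ℂ w c, Finsupp.linearCombination ℂ w c⟫_ℂ
      = ⟪Finsupp.linearCombination ℂ v c, Finsupp.linearCombination ℂ v c⟫_ℂ := by
    simp only [Finsupp.linearCombination_apply, Finsupp.sum, sum_inner, inner_sum, inner_smul_left,
      inner_smul_right, h]
  rw [inner_self_eq_norm_sq_to_K, inner_self_eq_norm_sq_to_K] at this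
  have h2 : ‖Finsupp.linearCombination ℂ w c‖ ^ 2 = ‖Finsupp.linearCombination ℂ v c‖ ^ 2 := by
    exact_mod_cast this
  exact (sq_eq_sq₀ (norm_nonneg _) (norm_nonneg _)).1 h2

theorem exists_vec {ξ : ℕ → H} (hs : Summable fun n => ‖ξ n‖ ^ 2) :
    ∃ f : lp (fun _ : ℕ => H) 2, ∀ n, f n = ξ n :=
  ⟨⟨ξ, memℓp_gen (by simpa using hs)⟩, fun _ => rfl⟩

theorem exists_intertwiner {I : Type}
    (M₁ : VonNeumannAlgebra H) (M₂ : VonNeumannAlgebra H')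
    (φ₁ : (H →L[ℂ] H) → ℂ) (φ₂ : (H' →L[ℂ] H') → ℂ)
    (hφ₁ : IsNormalState (M₁ : Set (H →L[ℂ] H)) φ₁)
    (hφ₂ : IsNormalState (M₂ : Set (H' →L[ℂ] H')) φ₂)
    (x₁ : I → (H →L[ℂ] H)) (x₂ : I → (H' →L[ℂ] H'))
    (hx₁ : ∀ i, IsSelfAdjoint (x₁ i)) (hx₂ : ∀ i, IsSelfAdjoint (x₂ i))
    (hx₁M : ∀ i, x₁ i ∈ M₁) (hx₂M : ∀ i, x₂ i ∈ M₂)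
    (hmom : ∀ l : List I, φ₁ (l.map x₁).prod = φ₂ (l.map x₂).prod) :
    ∃ B : H →L[ℂ] H', (∀ i k, B (x₁ i k) = x₂ i (B k)) ∧ B ≠ 0 := by
  obtain ⟨ξ₁, hs₁, -, hφ₁⟩ := hφ₁
  obtain ⟨ξ₂, hs₂, hn₂, hφ₂⟩ := hφ₂
  obtain ⟨f₁, hf₁⟩ := exists_vec hs₁
  obtain ⟨f₂, hf₂⟩ := exists_vec hs₂
  simp only [← hf₁] at hφ₁
  simp only [← hf₂] at hφ₂ hn₂
  obtain ⟨m, hm⟩ : ∃ m, f₂ m ≠ 0 := by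
    by_contra! h
    simp [h] at hn₂
  let v : List I → lp (fun _ : ℕ => H) 2 := fun l => ampl (l.map x₁).prod f₁
  let w : List I → lp (fun _ : ℕ => H') 2 := fun l => ampl (l.map x₂).prod f₂
  have hg : ∀ i j, ⟪v i, v j⟫_ℂ = ⟪w i, w j⟫_ℂ := by
    intro l k
    rw [gram_word hx₁ M₁ hx₁M φ₁ f₁ hφ₁, gram_word hx₂ M₂ hx₂M φ₂ f₂ hφ₂, hmom]
  obtain ⟨V, hV1, hV2⟩ := exists_ext (Finsupp.linearCombination ℂ v) (Finsupp.linearCombination ℂ w)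
    1 (fun c => by rw [norm_lincomb_eq v w hg, one_mul])
  have hvi : ∀ i l, ampl (x₁ i) (v l) = v (i :: l) := by
    intro i l
    ext n
    simp [v, ampl_apply]
  have hwi : ∀ i l, ampl (x₂ i) (w l) = w (i :: l) := by
    intro i l
    ext n
    simp [w, ampl_apply]
  have hvc : ∀ i c, ampl (x₁ i) (Finsupp.linearCombination ℂ v c)
      = Finsupp.linearCombination ℂ v (Finsupp.mapDomain (fun l => i :: l) c) := by
    intro i c
    rw [Finsupp.linearCombination_mapDomain, Finsupp.linearCombination_apply,
      Finsupp.linearCombination_apply, map_finsuppSum]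
    simp [hvi]
  have hwc : ∀ i c, ampl (x₂ i) (Finsupp.linearCombination ℂ w c)
      = Finsupp.linearCombination ℂ w (Finsupp.mapDomain (fun l => i :: l) c) := by
    intro i c
    rw [Finsupp.linearCombination_mapDomain, Finsupp.linearCombination_apply,
      Finsupp.linearCombination_apply, map_finsuppSum]
    simp [hwi]
  have hVint : ∀ i k, V (ampl (x₁ i) k) = ampl (x₂ i) (V k) := by
    intro i k
    refine intertwine _ _ V hV1 hV2 (ampl (x₁ i)) (ampl (x₂ i)) (fun c => ⟨_, hvc i c, hwc i c⟩)
      (fun c => ?_) k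
    rw [star_ampl, (hx₁ i).star_eq]
    exact ⟨_, hvc i c⟩
  have hVf : V f₁ = f₂ := by
    have := hV1 (Finsupp.single [] 1)
    simp only [Finsupp.linearCombination_single, one_smul] at this
    have a1 : v [] = f₁ := by ext n; simp [v, ampl_apply]
    have a2 : w [] = f₂ := by ext n; simp [w, ampl_apply]
    rwa [a1, a2] at this
  let L : lp (fun _ : ℕ => H) 2 →L[ℂ] H' := (lp.evalCLM ℂ (fun _ : ℕ => H') 2 m).comp V
  have hL : ∀ k, L k = (V k) m := fun k => rfl
  obtain ⟨n, hn⟩ : ∃ n, L (lp.single 2 n (f₁ n)) ≠ 0 := by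
    by_contra! h
    have h1 := (lp.hasSum_single (p := 2) (by simp) f₁).mapL L
    simp only [h] at h1
    have := h1.unique hasSum_zero
    rw [hL, hVf] at this
    exact hm this
  refine ⟨L.comp (lp.singleContinuousLinearMap ℂ (fun _ : ℕ => H) 2 n), ?_, ?_⟩
  · intro i k
    have : ampl (x₁ i) (lp.single 2 n k) = lp.single 2 n (x₁ i k) := by
      ext j
      rw [ampl_apply, lp.single_apply, lp.single_apply]
      by_cases hj : j = n
      · subst hj; simp
      · simp [hj]
    simp only [ContinuousLinearMap.comp_apply, lp.singleContinuousLinearMap_apply]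
    rw [← this, hL, hL, hVint, ampl_apply]
  · intro h
    apply hn
    have := congrArg (fun T => T (f₁ n)) h
    simpa using this

/-! ### Construction of the homomorphism -/

section Exist
variable {I : Type} (x₁ : I → (H →L[ℂ] H)) (x₂ : I → (H' →L[ℂ] H'))

def Inter : Set (H →L[ℂ] H') := {B | ∀ i k, B (x₁ i k) = x₂ i (B k)}

variable {x₁ x₂}

theorem inter_inner (hx₁ : ∀ i, IsSelfAdjoint (x₁ i)) (hx₂ : ∀ i, IsSelfAdjoint (x₂ i))
    {x : H →L[ℂ] H} (hx : x ∈ vN (Set.range x₁)) {B B' : H →L[ℂ] H'} (hB : B ∈ Inter x₁ x₂)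
    (hB' : B' ∈ Inter x₁ x₂) (k k' : H) :
    ⟪B (x k), B' k'⟫_ℂ = ⟪B k, B' (star x k')⟫_ℂ := by
  have hc : (ContinuousLinearMap.adjoint B').comp B ∈ Set.centralizer (Set.range x₁) := by
    rintro _ ⟨i, rfl⟩
    ext k
    apply ext_inner_right ℂ
    intro u
    have e1 : ∀ u v, ⟪x₁ i u, v⟫_ℂ = ⟪u, x₁ i v⟫_ℂ := (hx₁ i).isSymmetric
    have e2 : ∀ u v, ⟪x₂ i u, v⟫_ℂ = ⟪u, x₂ i v⟫_ℂ := (hx₂ i).isSymmetric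
    simp only [mulv, ContinuousLinearMap.comp_apply]
    rw [e1, ContinuousLinearMap.adjoint_inner_left, ContinuousLinearMap.adjoint_inner_left,
      hB', hB, e2]
  have h := congrArg (fun T => T k) (hx _ hc)
  simp only [mulv, ContinuousLinearMap.comp_apply] at h
  rw [← ContinuousLinearMap.adjoint_inner_left, h, ← ContinuousLinearMap.adjoint_inner_right,
    ContinuousLinearMap.adjoint_inner_left, ← ContinuousLinearMap.star_eq_adjoint]

theorem exists_T (M : VonNeumannAlgebra H) (hM : (M : Set (H →L[ℂ] H)) = vN (Set.range x₁))
    (hx₁ : ∀ i, IsSelfAdjoint (x₁ i)) (hx₂ : ∀ i, IsSelfAdjoint (x₂ i))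
    {x : H →L[ℂ] H} (hx : x ∈ M) :
    ∃ T : H' →L[ℂ] H', ∀ B ∈ Inter x₁ x₂, ∀ k, T (B k) = B (x k) := by
  let L : (H →L[ℂ] H) → ((Inter x₁ x₂ →₀ H) →ₗ[ℂ] H') := fun x =>
    Finsupp.lsum ℂ (fun B : Inter x₁ x₂ => ((B : H →L[ℂ] H').comp x : H →ₗ[ℂ] H'))
  have hL : ∀ x f, L x f = f.sum fun B k => (B : H →L[ℂ] H') (x k) := by
    intro x f
    simp only [L, Finsupp.lsum_apply]
    rfl
  have hin : ∀ x ∈ M, ∀ y f, ⟪L x f, L y f⟫_ℂ = ⟪L 1 f, L (star x * y) f⟫_ℂ := by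
    intro x hx y f
    have hx' : x ∈ vN (Set.range x₁) := by rw [← hM]; exact hx
    simp only [hL, Finsupp.sum, sum_inner, inner_sum]
    refine Finset.sum_congr rfl fun B _ => Finset.sum_congr rfl fun B' _ => ?_
    rw [inter_inner hx₁ hx₂ hx' B'.2 B.2]
    rfl
  have hb : ∀ f, ‖L x f‖ ≤ ‖x‖ * ‖L 1 f‖ := by
    intro f
    have h0 : 0 ≤ ((‖x‖ ^ 2 : ℝ) : ℂ) • (1 : H →L[ℂ] H) - star x * x := by
      have := CStarAlgebra.star_mul_le_algebraMap_norm_sq (a := x)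
      rw [← sub_nonneg, Algebra.algebraMap_eq_smul_one] at this
      have e : ((‖x‖ ^ 2 : ℝ) : ℂ) • (1 : H →L[ℂ] H) = (‖x‖ ^ 2 : ℝ) • (1 : H →L[ℂ] H) :=
        Complex.coe_smul _ _
      rw [e]
      exact this
    obtain ⟨s, hs, hs1, hs2⟩ := exists_sqrt M
      (sub_mem (smul_mem_M M _ (one_mem M)) (mul_mem (star_mem hx) hx)) h0
    have a1 := hin s hs s f
    have a2 := hin x hx x f
    rw [hs1, hs2] at a1
    have a3 : L (((‖x‖ ^ 2 : ℝ) : ℂ) • (1 : H →L[ℂ] H) - star x * x) f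
        = ((‖x‖ ^ 2 : ℝ) : ℂ) • L 1 f - L (star x * x) f := by
      simp only [hL, Finsupp.sum, Finset.smul_sum, ← Finset.sum_sub_distrib]
      refine Finset.sum_congr rfl fun B _ => ?_
      simp
    rw [a3, inner_sub_right, ← a2, inner_smul_right, inner_self_eq_norm_sq_to_K,
      inner_self_eq_norm_sq_to_K, inner_self_eq_norm_sq_to_K] at a1
    have a4 : ‖L s f‖ ^ 2 = ‖x‖ ^ 2 * ‖L 1 f‖ ^ 2 - ‖L x f‖ ^ 2 := by
      have a5 := congrArg Complex.re a1
      simpa [← Complex.ofReal_pow, ← Complex.ofReal_mul] using a5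
    refine le_of_sq_le_sq ?_ (by positivity)
    nlinarith [sq_nonneg ‖L s f‖]
  obtain ⟨T, hT, -⟩ := exists_ext (L 1) (L x) _ hb
  refine ⟨T, fun B hB k => ?_⟩
  have := hT (Finsupp.single ⟨B, hB⟩ k)
  simpa [hL] using this

theorem exists_theta (M : VonNeumannAlgebra H) (hM : (M : Set (H →L[ℂ] H)) = vN (Set.range x₁))
    (hx₁ : ∀ i, IsSelfAdjoint (x₁ i)) (hx₂ : ∀ i, IsSelfAdjoint (x₂ i)) (hx₁M : ∀ i, x₁ i ∈ M)
    (hD : (Submodule.span ℂ {v | ∃ B ∈ Inter x₁ x₂, ∃ k, B k = v}).topologicalClosure = ⊤) :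
    ∃ θ : (H →L[ℂ] H) → (H' →L[ℂ] H'),
      (∀ x ∈ M, ∀ B ∈ Inter x₁ x₂, ∀ k, θ x (B k) = B (x k)) ∧
      Set.MapsTo θ (M : Set (H →L[ℂ] H)) (vN (Set.range x₂)) ∧
        θ 1 = 1 ∧
        IsStarHomOn (M : Set (H →L[ℂ] H)) θ ∧
        IsNormalMapOn (M : Set (H →L[ℂ] H)) θ ∧
        ∀ i : I, θ (x₁ i) = x₂ i := by
  have hex : ∀ x : H →L[ℂ] H, ∃ T : H' →L[ℂ] H', x ∈ M →
      ∀ B ∈ Inter x₁ x₂, ∀ k, T (B k) = B (x k) := by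
    intro x
    by_cases hx : x ∈ M
    · obtain ⟨T, hT⟩ := exists_T M hM hx₁ hx₂ hx
      exact ⟨T, fun _ => hT⟩
    · exact ⟨0, fun h => absurd h hx⟩
  choose θ hθ using hex
  have hadd : ∀ x ∈ M, ∀ y ∈ M, θ (x + y) = θ x + θ y := by
    intro x hx y hy
    refine ext_of_dense hD fun B hB k => ?_
    rw [hθ _ (add_mem hx hy) B hB]
    simp [hθ _ hx B hB, hθ _ hy B hB]
  have hsmul : ∀ (c : ℂ), ∀ x ∈ M, θ (c • x) = c • θ x := by
    intro c x hx
    refine ext_of_dense hD fun B hB k => ?_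
    rw [hθ _ (smul_mem_M M c hx) B hB]
    simp [hθ _ hx B hB]
  have hmul : ∀ x ∈ M, ∀ y ∈ M, θ (x * y) = θ x * θ y := by
    intro x hx y hy
    refine ext_of_dense hD fun B hB k => ?_
    rw [hθ _ (mul_mem hx hy) B hB, mulv, mulv, hθ _ hy B hB, hθ _ hx B hB]
  have hstar : ∀ x ∈ M, θ (star x) = star (θ x) := by
    intro x hx
    have hx' : x ∈ vN (Set.range x₁) := by rw [← hM]; exact hx
    refine ext_of_dense hD fun B hB k => ?_
    rw [hθ _ (star_mem hx) B hB]
    apply ext_inner_left ℂ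
    intro u
    rw [ContinuousLinearMap.star_eq_adjoint (θ x), ContinuousLinearMap.adjoint_inner_right]
    have : (innerSL ℂ (B (star x k))) = (innerSL ℂ (B k)).comp (θ x) := by
      refine ext_of_dense hD fun B' hB' k' => ?_
      simp only [ContinuousLinearMap.comp_apply, innerSL_apply_apply]
      rw [hθ x hx B' hB', ← inner_conj_symm, ← inter_inner hx₁ hx₂ hx' hB' hB, inner_conj_symm]
    have h2 := congrArg (fun T => conj (T u)) this
    simpa using h2
  refine ⟨θ, hθ, ?_, ?_, ⟨hadd, hsmul, hmul, hstar⟩, ?_, ?_⟩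
  · intro x hx c hc
    refine ext_of_dense hD fun B hB k => ?_
    have hcB : c.comp B ∈ Inter x₁ x₂ := by
      intro i k
      have := congrArg (fun T => T (B k)) (hc _ ⟨i, rfl⟩)
      simp only [mulv] at this
      simp only [ContinuousLinearMap.comp_apply]
      rw [hB, this]
    rw [mulv, mulv, hθ x hx B hB]
    exact (hθ x hx _ hcB k).symm
  · refine ext_of_dense hD fun B hB k => ?_
    rw [hθ _ (one_mem M) B hB]
    rfl
  · intro ι p q hp hq hpp hpo hsum ξ
    have hhom : IsStarHomOn (M : Set (H →L[ℂ] H)) θ := ⟨hadd, hsmul, hmul, hstar⟩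
    have hP : ∀ i, IsProjection (θ (p i)) := fun i => (hpp i).map hhom (hp i)
    have hPo : ∀ i k, i ≠ k → θ (p i) * θ (p k) = 0 := by
      intro i k hik
      rw [← hmul _ (hp i) _ (hp k), hpo i k hik, hhom.map_zero]
    have heq : Equicontinuous (fun (s : Finset ι) (v : H') => ∑ i ∈ s, θ (p i) v) := by
      refine (LipschitzWith.uniformEquicontinuous _ 1 fun s => ?_).equicontinuous
      refine LipschitzWith.of_dist_le_mul fun u v => ?_
      have := (IsProjection.sum hP hPo s).norm_le (u - v)
      rw [dist_eq_norm, dist_eq_norm, ← Finset.sum_sub_distrib]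
      simpa using this
    have hcl := heq.isClosed_setOfPred_tendsto (l := Filter.atTop) (f := fun v => θ q v)
      (θ q).continuous
    have hsub : ((Submodule.span ℂ {v | ∃ B ∈ Inter x₁ x₂, ∃ k, B k = v} : Submodule ℂ H') : Set H')
        ⊆ {v | HasSum (fun i => θ (p i) v) (θ q v)} := by
      intro v hv
      refine Submodule.span_induction (p := fun v _ => HasSum (fun i => θ (p i) v) (θ q v))
        ?_ ?_ ?_ ?_ hv
      · rintro _ ⟨B, hB, k, rfl⟩
        rw [hθ q hq B hB]
        have := (hsum k).mapL B
        refine this.congr_fun fun i => ?_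
        rw [hθ _ (hp i) B hB]
      · simp
      · intro u v _ _ hu hv
        simpa using hu.add hv
      · intro c v _ hv
        simpa using hv.const_smul c
    have hmem : ξ ∈ closure ((Submodule.span ℂ {v | ∃ B ∈ Inter x₁ x₂, ∃ k, B k = v} :
        Submodule ℂ H') : Set H') := by
      rw [← Submodule.topologicalClosure_coe, hD]
      trivial
    exact closure_minimal hsub hcl hmem
  · intro i
    refine ext_of_dense hD fun B hB k => ?_
    rw [hθ _ (hx₁M i) B hB, hB]

end Exist

/-! ### Uniqueness -/

theorem exists_sum (M : VonNeumannAlgebra H) {ι : Type} {p : ι → (H →L[ℂ] H)}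
    (hpM : ∀ i, p i ∈ M) (hp : ∀ i, IsProjection (p i)) (ho : ∀ i k, i ≠ k → p i * p k = 0) :
    ∃ q ∈ M, IsProjection q ∧ (∀ ξ, HasSum (fun i => p i ξ) (q ξ)) ∧ ∀ i, q * p i = p i := by
  classical
  have hsym : ∀ i u w, ⟪p i u, w⟫_ℂ = ⟪u, p i w⟫_ℂ := fun i => (hp i).1.isSymmetric
  have hbound : ∀ ξ (s : Finset ι), ∑ i ∈ s, ‖p i ξ‖ ^ 2 ≤ ‖ξ‖ ^ 2 := by
    intro ξ s
    have h1 := (IsProjection.sum hp ho s).inner_eq ξ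
    have h2 := (IsProjection.sum hp ho s).norm_le ξ
    have h3 : ((∑ i ∈ s, ‖p i ξ‖ ^ 2 : ℝ) : ℂ) = ((‖(∑ i ∈ s, p i) ξ‖ ^ 2 : ℝ) : ℂ) := by
      rw [← h1, ContinuousLinearMap.sum_apply, sum_inner, Complex.ofReal_sum]
      exact Finset.sum_congr rfl fun i _ => ((hp i).inner_eq ξ).symm
    rw [Complex.ofReal_inj.1 h3]
    gcongr
  have hsummable : ∀ ξ, Summable fun i => p i ξ := by
    intro ξ
    have hV : OrthogonalFamily ℂ (fun i => LinearMap.range (p i : H →ₗ[ℂ] H))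
        fun i => (LinearMap.range (p i : H →ₗ[ℂ] H)).subtypeₗᵢ := by
      rintro i j hij ⟨_, u, rfl⟩ ⟨_, v, rfl⟩
      change ⟪p i u, p j v⟫_ℂ = 0
      rw [hsym, ← mulv, ho i j hij]
      simp
    have := (hV.summable_iff_norm_sq_summable (fun i => ⟨p i ξ, ξ, rfl⟩)).2
      (summable_of_sum_le (fun i => by positivity) (hbound ξ))
    exact this
  let q₀ : H →ₗ[ℂ] H :=
    { toFun := fun ξ => ∑' i, p i ξ
      map_add' := fun u v => by
        simp only [map_add]
        exact (hsummable u).tsum_add (hsummable v)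
      map_smul' := fun c v => by
        simp only [map_smul, RingHom.id_apply]
        exact (hsummable v).tsum_const_smul c }
  have hnorm : ∀ ξ, ‖q₀ ξ‖ ≤ 1 * ‖ξ‖ := by
    intro ξ
    rw [one_mul]
    refine le_of_tendsto (hsummable ξ).hasSum.norm (Filter.Eventually.of_forall fun s => ?_)
    have := (IsProjection.sum hp ho s).norm_le ξ
    simpa using this
  let q : H →L[ℂ] H := q₀.mkContinuous 1 hnorm
  have hq : ∀ ξ, HasSum (fun i => p i ξ) (q ξ) := fun ξ => (hsummable ξ).hasSum
  have hqp : ∀ i, q * p i = p i := by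
    intro i
    ext ξ
    have h1 := hq (p i ξ)
    have h2 : HasSum (fun j => p j (p i ξ)) (p i ξ) := by
      have h3 := hasSum_single (f := fun j => p j (p i ξ)) i (fun j hj => by
        rw [← mulv, ho j i hj]; simp)
      have h4 : p i (p i ξ) = p i ξ := by rw [← mulv, (hp i).2]
      rwa [h4] at h3
    exact h1.unique h2
  refine ⟨q, ?_, ⟨?_, ?_⟩, hq, hqp⟩
  · apply mem_of_comm
    intro c hc
    ext ξ
    have h1 := (hq ξ).mapL c
    have h2 := hq (c ξ)
    have h3 : (fun i => c (p i ξ)) = fun i => p i (c ξ) := by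
      ext i
      exact (congrArg (fun T => T ξ) (comm_of_mem M (hpM i) hc)).symm
    rw [h3] at h1
    exact h1.unique h2
  · rw [ContinuousLinearMap.isSelfAdjoint_iff_isSymmetric]
    intro u v
    have h1 := (hq u).mapL (innerSL ℂ v)
    have h2 := (hq v).mapL (innerSL ℂ u)
    have h3 := h1.map (starRingEnd ℂ) Complex.continuous_conj
    have h4 : ((starRingEnd ℂ) ∘ fun i => (innerSL ℂ v) (p i u))
        = fun i => (innerSL ℂ u) (p i v) := by
      ext i
      simp [hsym]
    rw [h4] at h3
    have := h3.unique h2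
    simpa using this
  · ext ξ
    have h1 := (hq ξ).mapL q
    have h3 : (fun i => q (p i ξ)) = fun i => p i ξ := by
      ext i
      rw [← mulv, hqp]
    rw [h3] at h1
    exact h1.unique (hq ξ)

theorem exists_maximal (M : VonNeumannAlgebra H) {e : H →L[ℂ] H} (he : IsProjection e)
    (P : (H →L[ℂ] H) → Prop) :
    ∃ (S : Set (H →L[ℂ] H)) (q : H →L[ℂ] H), q ∈ M ∧ IsProjection q ∧ q * e = q ∧
      (∀ s ∈ S, s ∈ M ∧ IsProjection s ∧ P s) ∧ (∀ s : S, ∀ t : S, s ≠ t → (s : H →L[ℂ] H) * t = 0) ∧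
      (∀ ξ, HasSum (fun s : S => (s : H →L[ℂ] H) ξ) (q ξ)) ∧
      ∀ g ∈ M, IsProjection g → g * e = g → g * q = 0 → P g → g = 0 := by
  obtain ⟨S, hS⟩ := zorn_subset
    {S : Set (H →L[ℂ] H) | (∀ s ∈ S, s ∈ M ∧ IsProjection s ∧ P s ∧ s * e = s) ∧
      S.Pairwise fun s t => s * t = 0} (by
    intro c hc hchain
    refine ⟨⋃₀ c, ⟨?_, ?_⟩, fun s hs => Set.subset_sUnion_of_mem hs⟩
    · rintro s ⟨t, ht, hs⟩
      exact (hc ht).1 s hs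
    · rw [Set.pairwise_sUnion hchain.directedOn]
      exact fun t ht => (hc ht).2)
  obtain ⟨⟨hS1, hS2⟩, hmax⟩ := hS
  have hor : ∀ s : S, ∀ t : S, s ≠ t → (s : H →L[ℂ] H) * t = 0 :=
    fun s t hst => hS2 s.2 t.2 (fun h => hst (Subtype.ext h))
  obtain ⟨q, hqM, hq, hsum, hqp⟩ := exists_sum M (p := fun s : S => (s : H →L[ℂ] H))
    (fun s => (hS1 s s.2).1) (fun s => (hS1 s s.2).2.1) hor
  have hqe : e * q = q := by
    ext ξ
    have h1 := (hsum ξ).mapL e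
    have h3 : (fun s : S => e ((s : H →L[ℂ] H) ξ)) = fun s : S => (s : H →L[ℂ] H) ξ := by
      ext s
      rw [← mulv, (hS1 s s.2).2.1.mul_comm_of he (hS1 s s.2).2.2.2]
    rw [h3] at h1
    exact h1.unique (hsum ξ)
  have hqe' : q * e = q := by
    have := congrArg star hqe
    rwa [star_mul, hq.1.star_eq, he.1.star_eq] at this
  refine ⟨S, q, hqM, hq, hqe', fun s hs => ⟨(hS1 s hs).1, (hS1 s hs).2.1, (hS1 s hs).2.2.1⟩, hor,
    hsum, ?_⟩
  intro g hgM hg hge hgq hPg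
  have hgs : ∀ s ∈ S, g * s = 0 := by
    intro s hs
    have := hqp ⟨s, hs⟩
    simp only at this
    rw [← this, ← mul_assoc, hgq, zero_mul]
  have hsg : ∀ s ∈ S, s * g = 0 := by
    intro s hs
    have := congrArg star (hgs s hs)
    rwa [star_mul, hg.1.star_eq, (hS1 s hs).2.1.1.star_eq, star_zero] at this
  have hins : insert g S ⊆ S := by
    apply hmax _ (Set.subset_insert g S)
    refine ⟨?_, ?_⟩
    · rintro s (rfl | hs)
      · exact ⟨hgM, hg, hPg, hge⟩
      · exact hS1 s hs
    · exact hS2.insert fun b hb _ => ⟨hgs b hb, hsg b hb⟩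
  have := hgs g (hins (Set.mem_insert g S))
  rwa [hg.2] at this

theorem halve (M : VonNeumannAlgebra H) {y f : H →L[ℂ] H} (hy : y ∈ M) (h0 : 0 ≤ y) {d : ℝ}
    (hd : 0 ≤ d) (hyd : y ≤ (d : ℂ) • 1 + (d : ℂ) • 1) (hyf : y * f = y) :
    ∃ p ∈ M, IsProjection p ∧ p * f = p ∧ 0 ≤ y - (d : ℂ) • p ∧
      y - (d : ℂ) • p ≤ (d : ℂ) • 1 := by
  have hDs : IsSelfAdjoint ((d : ℂ) • (1 : H →L[ℂ] H)) := by
    rw [IsSelfAdjoint, star_smul, star_one]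
    simp
  have hzs : IsSelfAdjoint (y - (d : ℂ) • 1) := (IsSelfAdjoint.of_nonneg h0).sub hDs
  have hzM : y - (d : ℂ) • 1 ∈ M := sub_mem hy (smul_mem_M M _ (one_mem M))
  obtain ⟨a, ha⟩ : ∃ a, a = (y - (d : ℂ) • 1)⁺ := ⟨_, rfl⟩
  obtain ⟨b, hb⟩ : ∃ b, b = (y - (d : ℂ) • 1)⁻ := ⟨_, rfl⟩
  have hab : a - b = y - (d : ℂ) • 1 := by rw [ha, hb]; exact CFC.posPart_sub_negPart _ hzs
  have hab0 : a * b = 0 := by rw [ha, hb]; exact CFC.posPart_mul_negPart _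
  have ha0 : 0 ≤ a := by rw [ha]; exact CFC.posPart_nonneg _
  have hb0 : 0 ≤ b := by rw [hb]; exact CFC.negPart_nonneg _
  have has : star a = a := (IsSelfAdjoint.of_nonneg ha0).star_eq
  have hbs : star b = b := (IsSelfAdjoint.of_nonneg hb0).star_eq
  have haM : a ∈ M := by
    apply mem_of_comm
    intro c hc
    have h : Commute (y - (d : ℂ) • 1) c := comm_of_mem M hzM hc
    rw [ha, CFC.posPart_def]
    exact (h.cfcₙ_real _).symm.eq
  have hKcl : IsClosed ((LinearMap.ker (a : H →ₗ[ℂ] H) : Submodule ℂ H) : Set H) :=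
    isClosed_eq a.continuous continuous_const
  have : CompleteSpace (LinearMap.ker (a : H →ₗ[ℂ] H)) := hKcl.completeSpace_coe
  have hmemK : ∀ v, v ∈ LinearMap.ker (a : H →ₗ[ℂ] H) ↔ a v = 0 := fun v => Iff.rfl
  obtain ⟨q, hq⟩ : ∃ q, q = (LinearMap.ker (a : H →ₗ[ℂ] H)).starProjection := ⟨_, rfl⟩
  have hqM : q ∈ M := by
    rw [hq]
    apply proj_of_submodule_mem
    intro c hc v hv
    rw [hmemK] at hv ⊢
    rw [← mulv, comm_of_mem M haM hc, mulv, hv, map_zero]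
  have hqP : IsProjection q := by rw [hq]; exact isProjection_starProjection _
  have haq : a * q = 0 := by
    ext v
    rw [mulv, hq]
    exact (hmemK _).1 (Submodule.starProjection_apply_mem _ v)
  have hqof : ∀ T : H →L[ℂ] H, a * T = 0 → q * T = T := by
    intro T hT
    ext v
    rw [mulv, hq, Submodule.starProjection_eq_self_iff, hmemK, ← mulv, hT]
    rfl
  obtain ⟨p, hp⟩ : ∃ p, p = 1 - q := ⟨_, rfl⟩
  have hpP : IsProjection p := by rw [hp]; exact hqP.one_sub
  have hap : a * p = a := by rw [hp, mul_sub, haq, mul_one, sub_zero]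
  have hpa : p * a = a := by
    have := congrArg star hap
    rwa [star_mul, has, hpP.1.star_eq] at this
  have hpb : p * b = 0 := by rw [hp, sub_mul, hqof b hab0, one_mul, sub_self]
  have hbp : b * p = 0 := by
    have := congrArg star hpb
    rwa [star_mul, hbs, hpP.1.star_eq, star_zero] at this
  have hyab : y = (d : ℂ) • 1 + a - b := by
    rw [add_sub_assoc, hab]; abel
  have hyp : y * p = (d : ℂ) • p + a := by
    rw [hyab, sub_mul, add_mul, hap, hbp]; simp
  have hpy : p * y = (d : ℂ) • p + a := by
    rw [hyab, mul_sub, mul_add, hpa, hpb]; simp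
  have hpyp : p * y * p = (d : ℂ) • p + a := by
    rw [hpy, add_mul, hap, smul_mul_assoc, hpP.2]
  refine ⟨p, ?_, hpP, ?_, ?_, ?_⟩
  · rw [hp]; exact sub_mem (one_mem M) hqM
  · have haf : a * (1 - f) = 0 := by
      ext v
      obtain ⟨w, hw⟩ : ∃ w, w = (1 - f) v := ⟨_, rfl⟩
      rw [mulv, ← hw]
      have h1 : a * a * (1 - f) = -((d : ℂ) • (a * (1 - f))) := by
        have h2 : a * a = a * (a - b) := by rw [mul_sub, hab0, sub_zero]
        have h3 : y * (1 - f) = 0 := by rw [mul_sub, hyf, mul_one, sub_self]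
        rw [h2, hab, mul_assoc, sub_mul, h3]
        simp
      have h4 : a (a w) = -((d : ℂ) • a w) := by
        have := congrArg (fun T => T v) h1
        simpa [mulv, hw] using this
      have h5 : ∀ u w, ⟪a u, w⟫_ℂ = ⟪u, a w⟫_ℂ :=
        (IsSelfAdjoint.of_nonneg ha0).isSymmetric
      have h6 : 0 ≤ RCLike.re ⟪a w, w⟫_ℂ :=
        ((ContinuousLinearMap.nonneg_iff_isPositive a).1 ha0).re_inner_nonneg_left w
      have h7 : ⟪a w, a w⟫_ℂ = -(d * ⟪a w, w⟫_ℂ) := by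
        rw [← h5, h4, inner_neg_left, inner_smul_left]
        simp
      have h8 := congrArg Complex.re h7
      rw [inner_self_eq_norm_sq_to_K] at h8
      have h9 : ‖a w‖ ^ 2 = -(d * RCLike.re ⟪a w, w⟫_ℂ) := by
        simpa [← Complex.ofReal_pow] using h8
      have h10 : ‖a w‖ ^ 2 ≤ 0 := by rw [h9]; nlinarith [mul_nonneg hd h6]
      have : ‖a w‖ = 0 := by nlinarith [norm_nonneg (a w)]
      simpa using this
    have h1 := hqof _ haf
    have h2 : p * (1 - f) = 0 := by rw [hp, sub_mul, h1, one_mul, sub_self]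
    rw [mul_sub, mul_one, sub_eq_zero] at h2
    exact h2.symm
  · have h1 : y - (d : ℂ) • p = a + (1 - p) * y * (1 - p) := by
      have : (1 - p) * y * (1 - p) = y - p * y - y * p + p * y * p := by noncomm_ring
      rw [this, hpyp, hpy, hyp]; abel
    rw [h1]
    exact add_nonneg ha0 (hpP.one_sub.1.conjugate_nonneg h0)
  · rw [← sub_nonneg]
    have h1 : (d : ℂ) • 1 - (y - (d : ℂ) • p)
        = b + p * ((d : ℂ) • 1 + (d : ℂ) • 1 - y) * p := by
      have : p * ((d : ℂ) • 1 + (d : ℂ) • 1 - y) * p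
        = (d : ℂ) • (p * p) + (d : ℂ) • (p * p) - p * y * p := by
        simp [mul_sub, sub_mul, mul_add, add_mul]
      rw [this, hpyp, hpP.2, hyab]; abel
    rw [h1]
    exact add_nonneg hb0 (hpP.1.conjugate_nonneg (sub_nonneg.2 hyd))

theorem pos_hom (M : VonNeumannAlgebra H) {θ : (H →L[ℂ] H) → (H' →L[ℂ] H')}
    (hθ : IsStarHomOn (M : Set (H →L[ℂ] H)) θ) {z : H →L[ℂ] H} (hz : z ∈ M) (h0 : 0 ≤ z) (η : H') :
    0 ≤ (⟪θ z η, η⟫_ℂ).re := by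
  obtain ⟨s, hs, hs1, hs2⟩ := exists_sqrt M hz h0
  have h1 : IsSelfAdjoint (θ s) := by rw [IsSelfAdjoint, ← hθ.map_star s hs, hs1]
  have h2 : ∀ u v, ⟪θ s u, v⟫_ℂ = ⟪u, θ s v⟫_ℂ := h1.isSymmetric
  rw [← hs2, hθ.map_mul s hs s hs, mulv, h2]
  exact inner_self_nonneg (𝕜 := ℂ)

theorem omega_le_aux (M : VonNeumannAlgebra H) {θ : (H →L[ℂ] H) → (H' →L[ℂ] H')}
    (hθ : IsStarHomOn (M : Set (H →L[ℂ] H)) θ) (h1 : θ 1 = 1) {f : H →L[ℂ] H} {η : H'} {ζ : H}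
    (h : ∀ g ∈ M, IsProjection g → g * f = g → ‖θ g η‖ ^ 2 ≤ ‖g ζ‖ ^ 2) (n : ℕ) :
    ∀ y ∈ M, 0 ≤ y → y * f = y → ∀ d : ℝ, 0 ≤ d → y ≤ (d : ℂ) • 1 →
      (⟪θ y η, η⟫_ℂ).re ≤ (⟪y ζ, ζ⟫_ℂ).re + d / 2 ^ n * ‖η‖ ^ 2 := by
  induction n with
  | zero =>
    intro y hy h0 hyf d hd hyd
    have a1 := pos_hom M hθ (sub_mem (smul_mem_M M (d : ℂ) (one_mem M)) hy) (sub_nonneg.2 hyd) η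
    have a2 : 0 ≤ (⟪y ζ, ζ⟫_ℂ).re :=
      ((ContinuousLinearMap.nonneg_iff_isPositive y).1 h0).re_inner_nonneg_left ζ
    rw [hθ.map_sub M (smul_mem_M M _ (one_mem M)) hy, hθ.map_smul _ _ (one_mem M), h1] at a1
    have a3 : (⟪((d : ℂ) • (1 : H' →L[ℂ] H')) η, η⟫_ℂ).re = d * ‖η‖ ^ 2 := by
      change (⟪(d : ℂ) • η, η⟫_ℂ).re = _
      rw [inner_smul_left, inner_self_eq_norm_sq_to_K]
      simp [← Complex.ofReal_pow]
    rw [ContinuousLinearMap.sub_apply, inner_sub_left, Complex.sub_re, a3] at a1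
    simp only [pow_zero, div_one]
    linarith
  | succ n ih =>
    intro y hy h0 hyf d hd hyd
    have hd2 : 0 ≤ d / 2 := by positivity
    have hyd' : y ≤ ((d / 2 : ℝ) : ℂ) • 1 + ((d / 2 : ℝ) : ℂ) • 1 := by
      rw [← add_smul, ← Complex.ofReal_add, add_halves]
      exact hyd
    obtain ⟨p, hpM, hp, hpf, hr0, hr1⟩ := halve M hy h0 hd2 hyd' hyf
    have hpM' := smul_mem_M M ((d / 2 : ℝ) : ℂ) hpM
    have a1 := ih _ (sub_mem hy hpM') hr0 (by rw [sub_mul, hyf, smul_mul_assoc, hpf]) _ hd2 hr1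
    rw [hθ.map_sub M hy hpM', hθ.map_smul _ _ hpM] at a1
    simp only [ContinuousLinearMap.sub_apply, ContinuousLinearMap.smul_apply, inner_sub_left,
      inner_smul_left, Complex.sub_re, hp.inner_eq, (hp.map hθ hpM).inner_eq, Complex.conj_ofReal,
      ← Complex.ofReal_mul, Complex.ofReal_re] at a1
    have a2 := mul_le_mul_of_nonneg_left (h p hpM hp hpf) hd2
    have a3 : d / 2 ^ (n + 1) = d / 2 / 2 ^ n := by rw [pow_succ]; field_simp
    rw [a3]
    linarith

theorem omega_le (M : VonNeumannAlgebra H) {θ : (H →L[ℂ] H) → (H' →L[ℂ] H')}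
    (hθ : IsStarHomOn (M : Set (H →L[ℂ] H)) θ) (h1 : θ 1 = 1) {f : H →L[ℂ] H} {η : H'} {ζ : H}
    (h : ∀ g ∈ M, IsProjection g → g * f = g → ‖θ g η‖ ^ 2 ≤ ‖g ζ‖ ^ 2)
    {z : H →L[ℂ] H} (hz : z ∈ M) (hzf : z * f = z) : ‖θ z η‖ ≤ ‖z ζ‖ := by
  have hy : star z * z ∈ M := mul_mem (star_mem hz) hz
  have hyd : star z * z ≤ ((‖z‖ ^ 2 : ℝ) : ℂ) • (1 : H →L[ℂ] H) := by
    have := CStarAlgebra.star_mul_le_algebraMap_norm_sq (a := z)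
    rw [Algebra.algebraMap_eq_smul_one] at this
    have e : ((‖z‖ ^ 2 : ℝ) : ℂ) • (1 : H →L[ℂ] H) = (‖z‖ ^ 2 : ℝ) • (1 : H →L[ℂ] H) :=
      Complex.coe_smul _ _
    rw [e]
    exact this
  have key := fun n => omega_le_aux M hθ h1 h n _ hy (star_mul_self_nonneg z)
    (by rw [mul_assoc, hzf]) _ (by positivity) hyd
  have e1 : (⟪θ (star z * z) η, η⟫_ℂ).re = ‖θ z η‖ ^ 2 := by
    rw [hθ.map_mul _ (star_mem hz) _ hz, hθ.map_star _ hz, mulv,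
      ContinuousLinearMap.star_eq_adjoint, ContinuousLinearMap.adjoint_inner_left,
      inner_self_eq_norm_sq_to_K]
    simp [← Complex.ofReal_pow]
  have e2 : (⟪(star z * z) ζ, ζ⟫_ℂ).re = ‖z ζ‖ ^ 2 := by
    rw [mulv, ContinuousLinearMap.star_eq_adjoint, ContinuousLinearMap.adjoint_inner_left,
      inner_self_eq_norm_sq_to_K]
    simp [← Complex.ofReal_pow]
  rw [e1, e2] at key
  have hlim : Filter.Tendsto (fun n : ℕ => ‖z ζ‖ ^ 2 + ‖z‖ ^ 2 / 2 ^ n * ‖η‖ ^ 2) Filter.atTop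
      (nhds (‖z ζ‖ ^ 2 + 0 * ‖η‖ ^ 2)) := by
    refine tendsto_const_nhds.add (Filter.Tendsto.mul_const _ ?_)
    exact tendsto_const_nhds.div_atTop (tendsto_pow_atTop_atTop_of_one_lt one_lt_two)
  have := ge_of_tendsto' hlim key
  refine le_of_sq_le_sq ?_ (by positivity)
  linarith

theorem hasSum_norm_sq {ι : Type} {p : ι → (H →L[ℂ] H)} {q : H →L[ℂ] H}
    (hp : ∀ i, IsProjection (p i)) (hq : IsProjection q) {ξ : H}
    (h : HasSum (fun i => p i ξ) (q ξ)) : HasSum (fun i => ‖p i ξ‖ ^ 2) (‖q ξ‖ ^ 2) := by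
  have h1 := h.mapL (innerSL ℂ ξ)
  have h2 := Complex.hasSum_re h1
  have h3 : ∀ r : H →L[ℂ] H, IsProjection r → ((innerSL ℂ ξ) (r ξ)).re = ‖r ξ‖ ^ 2 := by
    intro r hr
    rw [innerSL_apply_apply, ← inner_conj_symm, hr.inner_eq, Complex.conj_ofReal, Complex.ofReal_re]
  rw [h3 q hq] at h2
  refine h2.congr_fun fun i => ?_
  exact (h3 _ (hp i)).symm

theorem exists_C (M : VonNeumannAlgebra H) {θ : (H →L[ℂ] H) → (H' →L[ℂ] H')}
    (hθ : IsStarHomOn (M : Set (H →L[ℂ] H)) θ) (h1 : θ 1 = 1)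
    (hn : IsNormalMapOn (M : Set (H →L[ℂ] H)) θ) {η : H'} (hη : η ≠ 0) :
    ∃ C : H →L[ℂ] H', (∀ x ∈ M, ∀ k, C (x k) = θ x (C k)) ∧ C ≠ 0 := by
  have hone : IsProjection (1 : H →L[ℂ] H) := ⟨IsSelfAdjoint.one _, one_mul 1⟩
  obtain ⟨S₀, q₀, hq₀M, hq₀, -, hS₀, ho₀, hsum₀, hmax₀⟩ :=
    exists_maximal M hone fun g => θ g η = 0
  have hq₀η : θ q₀ η = 0 := by
    have a1 := hn (fun s : S₀ => (s : H →L[ℂ] H)) q₀ (fun s => (hS₀ s s.2).1) hq₀M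
      (fun s => (hS₀ s s.2).2.1) ho₀ hsum₀ η
    have a2 : (fun s : S₀ => θ (s : H →L[ℂ] H) η) = fun _ => 0 := by
      ext s
      exact (hS₀ s s.2).2.2
    rw [a2] at a1
    exact a1.unique hasSum_zero
  obtain ⟨e, he⟩ : ∃ e, e = 1 - q₀ := ⟨_, rfl⟩
  have heM : e ∈ M := by rw [he]; exact sub_mem (one_mem M) hq₀M
  have heP : IsProjection e := by rw [he]; exact hq₀.one_sub
  have heq : e * q₀ = 0 := by rw [he, sub_mul, one_mul, hq₀.2, sub_self]
  have heη : θ e η = η := by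
    rw [he, hθ.map_sub M (one_mem M) hq₀M, ContinuousLinearMap.sub_apply, hq₀η, h1]
    simp
  have hene : e ≠ 0 := by
    intro h0
    rw [h0, hθ.map_zero] at heη
    exact hη heη.symm
  obtain ⟨ζ, hζ, hlt⟩ : ∃ ζ, e ζ = ζ ∧ ‖η‖ ^ 2 < ‖ζ‖ ^ 2 := by
    obtain ⟨v, hv⟩ : ∃ v, e v ≠ 0 := by
      by_contra! hc
      exact hene (ContinuousLinearMap.ext hc)
    have hvn : 0 < ‖e v‖ := norm_pos_iff.2 hv
    refine ⟨(((‖η‖ + 1) / ‖e v‖ : ℝ) : ℂ) • e v, ?_, ?_⟩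
    · rw [map_smul, ← mulv, heP.2]
    · rw [norm_smul, Complex.norm_real, Real.norm_of_nonneg (by positivity),
        div_mul_cancel₀ _ hvn.ne']
      nlinarith [norm_nonneg η]
  obtain ⟨S₁, q₁, hq₁M, hq₁, hq₁e, hS₁, ho₁, hsum₁, hmax₁⟩ :=
    exists_maximal M heP fun g => ‖g ζ‖ ^ 2 ≤ ‖θ g η‖ ^ 2
  have hq₁ζ : ‖q₁ ζ‖ ^ 2 ≤ ‖η‖ ^ 2 := by
    have a1 := hn (fun s : S₁ => (s : H →L[ℂ] H)) q₁ (fun s => (hS₁ s s.2).1) hq₁M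
      (fun s => (hS₁ s s.2).2.1) ho₁ hsum₁ η
    have a2 := hasSum_norm_sq (p := fun s : S₁ => (s : H →L[ℂ] H))
      (fun s => (hS₁ s s.2).2.1) hq₁ (hsum₁ ζ)
    have a3 := hasSum_norm_sq (p := fun s : S₁ => θ (s : H →L[ℂ] H))
      (fun s => (hS₁ s s.2).2.1.map hθ (hS₁ s s.2).1) (hq₁.map hθ hq₁M) a1
    have a4 := hasSum_le (fun s : S₁ => (hS₁ s s.2).2.2) a2 a3
    have a5 := (hq₁.map hθ hq₁M).norm_le η
    refine a4.trans ?_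
    gcongr
  obtain ⟨f, hf⟩ : ∃ f, f = e - q₁ := ⟨_, rfl⟩
  have hfM : f ∈ M := by rw [hf]; exact sub_mem heM hq₁M
  have hfP : IsProjection f := by rw [hf]; exact hq₁.sub heP hq₁e
  have hfe : f * e = f := by rw [hf, sub_mul, heP.2, hq₁e]
  have hfq : f * q₁ = 0 := by rw [hf, sub_mul, hq₁.mul_comm_of heP hq₁e, hq₁.2, sub_self]
  have hfne : f ≠ 0 := by
    intro h0
    rw [h0] at hf
    rw [← sub_eq_zero.1 hf.symm, hζ] at hq₁ζ
    linarith
  have hfη : θ f η ≠ 0 := by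
    intro h0
    refine hfne (hmax₀ f hfM hfP (mul_one f) ?_ h0)
    rw [← hfe, mul_assoc, heq, mul_zero]
  have hdom : ∀ g ∈ M, IsProjection g → g * f = g → ‖θ g η‖ ^ 2 ≤ ‖g ζ‖ ^ 2 := by
    intro g hg hgP hgf
    by_contra! hc
    have := hmax₁ g hg hgP (by rw [← hgf, mul_assoc, hfe]) (by rw [← hgf, mul_assoc, hfq, mul_zero])
      hc.le
    rw [this, hθ.map_zero] at hc
    simp at hc
  let E : M.toStarSubalgebra →ₗ[ℂ] H :=
    { toFun := fun x => (x : H →L[ℂ] H) (f ζ)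
      map_add' := fun _ _ => rfl
      map_smul' := fun _ _ => rfl }
  have hmf : ∀ x : M.toStarSubalgebra, (x : H →L[ℂ] H) * f ∈ M := fun x => mul_mem x.2 hfM
  let G : M.toStarSubalgebra →ₗ[ℂ] H' :=
    { toFun := fun x => θ ((x : H →L[ℂ] H) * f) η
      map_add' := fun x y => by
        have := hθ.map_add _ (hmf x) _ (hmf y)
        rw [← add_mul] at this
        exact congrArg (fun T => T η) this
      map_smul' := fun c x => by
        have := hθ.map_smul c _ (hmf x)
        rw [← smul_mul_assoc] at this
        exact congrArg (fun T => T η) this }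
  have hEG : ∀ x, ‖G x‖ ≤ 1 * ‖E x‖ := by
    intro x
    rw [one_mul]
    exact omega_le M hθ h1 hdom (hmf x) (by rw [mul_assoc, hfP.2])
  obtain ⟨C, hC1, hC2⟩ := exists_ext E G 1 hEG
  refine ⟨C, fun x hx k => ?_, ?_⟩
  · refine intertwine E G C hC1 hC2 x (θ x) ?_ ?_ k
    · intro y
      refine ⟨⟨x * y, mul_mem hx y.2⟩, rfl, ?_⟩
      change θ x (θ ((y : H →L[ℂ] H) * f) η) = θ (x * y * f) η
      rw [mul_assoc, hθ.map_mul x hx _ (hmf y)]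
      rfl
    · intro y
      exact ⟨⟨star x * y, mul_mem (star_mem hx) y.2⟩, rfl⟩
  · intro h0
    have := hC1 1
    rw [h0] at this
    apply hfη
    have e : G 1 = θ f η := by
      change θ ((1 : H →L[ℂ] H) * f) η = θ f η
      rw [one_mul]
    rw [← e, ← this]
    rfl

/-- **Remark 2.2 (2)** (strengthened Proposition 2.1).  Suppose `(M₁,φ₁)` and `(M₂,φ₂)` are von
Neumann probability spaces, `x₁ : I → M₁` is a self-adjoint family generating `M₁`, and
`x₂ : I → M₂` is a self-adjoint family whose generated von Neumann algebra `N ⊆ M₂` is a factor.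
If all mixed moments agree, then there is a unique normal unital `*`-homomorphism
`θ : M₁ → N ⊆ M₂` with `θ (x₁ i) = x₂ i` for all `i`. -/
theorem remark_2_2_2
    (M₁ : VonNeumannAlgebra H) (M₂ : VonNeumannAlgebra H')
    (φ₁ : (H →L[ℂ] H) → ℂ) (φ₂ : (H' →L[ℂ] H') → ℂ)
    (hφ₁ : IsNormalState (M₁ : Set (H →L[ℂ] H)) φ₁)
    (hφ₂ : IsNormalState (M₂ : Set (H' →L[ℂ] H')) φ₂)
    (x₁ : I → (H →L[ℂ] H)) (x₂ : I → (H' →L[ℂ] H'))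
    (hx₁ : ∀ i, IsSelfAdjoint (x₁ i)) (hx₂ : ∀ i, IsSelfAdjoint (x₂ i))
    (hx₁M : ∀ i, x₁ i ∈ M₁) (hx₂M : ∀ i, x₂ i ∈ M₂)
    (hgen₁ : (M₁ : Set (H →L[ℂ] H)) = vN (Set.range x₁))
    (hfactor : IsFactorSet (vN (Set.range x₂)))
    (hmom : ∀ l : List I, φ₁ (l.map x₁).prod = φ₂ (l.map x₂).prod) :
    ∃ θ : (H →L[ℂ] H) → (H' →L[ℂ] H'),
      (Set.MapsTo θ (M₁ : Set (H →L[ℂ] H)) (vN (Set.range x₂)) ∧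
        θ 1 = 1 ∧
        IsStarHomOn (M₁ : Set (H →L[ℂ] H)) θ ∧
        IsNormalMapOn (M₁ : Set (H →L[ℂ] H)) θ ∧
        ∀ i : I, θ (x₁ i) = x₂ i) ∧
      ∀ θ' : (H →L[ℂ] H) → (H' →L[ℂ] H'),
        (Set.MapsTo θ' (M₁ : Set (H →L[ℂ] H)) (vN (Set.range x₂)) ∧
          θ' 1 = 1 ∧
          IsStarHomOn (M₁ : Set (H →L[ℂ] H)) θ' ∧
          IsNormalMapOn (M₁ : Set (H →L[ℂ] H)) θ' ∧
          ∀ i : I, θ' (x₁ i) = x₂ i) →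
        Set.EqOn θ' θ (M₁ : Set (H →L[ℂ] H)) := by
  obtain ⟨B₀, hB₀, hB₀ne⟩ :=
    exists_intertwiner M₁ M₂ φ₁ φ₂ hφ₁ hφ₂ x₁ x₂ hx₁ hx₂ hx₁M hx₂M hmom
  have hD := dense_ranges x₂ hx₂ hfactor (Inter x₁ x₂)
    (by
      intro c hc B hB i k
      have := congrArg (fun T => T (B k)) (hc _ ⟨i, rfl⟩)
      simp only [mulv] at this
      simp only [ContinuousLinearMap.comp_apply]
      rw [hB, this])
    (by
      intro i B hB
      refine ⟨x₁ i, ?_⟩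
      ext k
      exact (hB i k).symm)
    ⟨B₀, hB₀, hB₀ne⟩
  obtain ⟨θ, hθ, hrest⟩ := exists_theta M₁ hgen₁ hx₁ hx₂ hx₁M hD
  refine ⟨θ, hrest, ?_⟩
  rintro θ' ⟨hmaps, hone, hhom, hnorm, hgens⟩ x hx
  obtain ⟨η, hη⟩ : ∃ η : H', η ≠ 0 := by
    by_contra! hc
    exact hB₀ne (ContinuousLinearMap.ext fun k => hc (B₀ k))
  obtain ⟨C₀, hC₀, hC₀ne⟩ := exists_C M₁ hhom hone hnorm hη
  have hD' := dense_ranges x₂ hx₂ hfactor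
    {C : H →L[ℂ] H' | ∀ x ∈ M₁, ∀ k, C (x k) = θ' x (C k)}
    (by
      intro c hc C hC y hy k
      have := congrArg (fun T => T (C k)) (hmaps hy c hc)
      simp only [mulv] at this
      simp only [ContinuousLinearMap.comp_apply]
      rw [hC y hy, this])
    (by
      intro i C hC
      refine ⟨x₁ i, ?_⟩
      ext k
      have := hC (x₁ i) (hx₁M i) k
      rw [hgens] at this
      exact this.symm)
    ⟨C₀, hC₀, hC₀ne⟩
  refine ext_of_dense hD' fun C hC k => ?_
  have hCI : C ∈ Inter x₁ x₂ := by
    intro i k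
    rw [hC (x₁ i) (hx₁M i) k, hgens]
  rw [hθ x hx C hCI k, hC x hx k]

end Paper
end
end

section
/- Let φ be a faithful normal state on a factor M acting standardly on L²(M,φ), and let θ be an equi-modular endomorphism of (M,φ), with implementing isometry u_θ and modular operator Δ = Δ_φ. Then Δ^{it} commutes with u_θ for every t ∈ ℝ, and θ commutes with the modular automorphism group: θ(σ^φ_t(x)) = σ^φ_t(θ(x)) for all x ∈ M and t ∈ ℝ; in particular σ^φ_t(θ(M)) = θ(M) for all t ∈ ℝ. -/
set_option synthInstance.maxHeartbeats 400000
set_option maxHeartbeats 1000000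

open scoped InnerProductSpace ComplexConjugate

noncomputable section

namespace Paper

variable {H : Type} [NormedAddCommGroup H] [InnerProductSpace ℂ H] [CompleteSpace H]
variable {H' : Type} [NormedAddCommGroup H'] [InnerProductSpace ℂ H'] [CompleteSpace H']

/-- Standard form data for a von Neumann algebra `M` with cyclic separating unit vector `Ω`:
`J` is the modular conjugation (an antiunitary involution fixing `Ω`, conjugating `M` onto its
commutant, and positive on the cone `{x j(x) Ω}`), and `j = J (·) J`. -/
structure StandardForm (M : VonNeumannAlgebra H) (Ω : H) (J : H → H)
    (j : (H →L[ℂ] H) → (H →L[ℂ] H)) : Prop where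
  unit : ‖Ω‖ = 1
  cyclic : Dense {ξ : H | ∃ x ∈ M, x Ω = ξ}
  separating : ∀ x ∈ M, x Ω = 0 → x = 0
  Jadd : ∀ ξ η : H, J (ξ + η) = J ξ + J η
  Jsmul : ∀ (c : ℂ) (ξ : H), J (c • ξ) = (starRingEnd ℂ) c • J ξ
  Jinvol : ∀ ξ : H, J (J ξ) = ξ
  Jinner : ∀ ξ η : H, ⟪J ξ, J η⟫_ℂ = ⟪η, ξ⟫_ℂ
  JΩ : J Ω = Ω
  jdef : ∀ (x : H →L[ℂ] H) (ξ : H), j x ξ = J (x (J ξ))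
  jmapsTo : ∀ x ∈ M, j x ∈ Set.centralizer (M : Set (H →L[ℂ] H))
  jsurj : ∀ y ∈ Set.centralizer (M : Set (H →L[ℂ] H)), ∃ x ∈ M, j x = y
  pos : ∀ x ∈ M, 0 ≤ (⟪(x * j x) Ω, Ω⟫_ℂ).re ∧ (⟪(x * j x) Ω, Ω⟫_ℂ).im = 0

/-- A unital `*`-endomorphism of `M` preserving the (faithful, normal) vector state of `Ω`. -/
structure StateEndo (M : VonNeumannAlgebra H) (Ω : H)
    (θ : (H →L[ℂ] H) → (H →L[ℂ] H)) : Prop where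
  mapsTo : Set.MapsTo θ (M : Set (H →L[ℂ] H)) (M : Set (H →L[ℂ] H))
  unital : θ 1 = 1
  hom : IsStarHomOn (M : Set (H →L[ℂ] H)) θ
  state : ∀ x ∈ M, ⟪θ x Ω, Ω⟫_ℂ = ⟪x Ω, Ω⟫_ℂ

/-- `u` is the isometry of the GNS space implementing `θ`:  `u x Ω = θ(x) Ω`. -/
def Implements (M : VonNeumannAlgebra H) (Ω : H) (θ : (H →L[ℂ] H) → (H →L[ℂ] H))
    (u : H →L[ℂ] H) : Prop :=
  (∀ ξ : H, ‖u ξ‖ = ‖ξ‖) ∧ ∀ x ∈ M, u (x Ω) = θ x Ω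

/-- `u` commutes with the modular conjugation `J`. -/
def CommutesWithJ (J : H → H) (u : H →L[ℂ] H) : Prop := ∀ ξ : H, u (J ξ) = J (u ξ)

/-- `θ` is equi-modular: its implementing isometry commutes with `J`. -/
def EquiModular (M : VonNeumannAlgebra H) (Ω : H) (J : H → H)
    (θ : (H →L[ℂ] H) → (H →L[ℂ] H)) : Prop :=
  ∃ u : H →L[ℂ] H, Implements M Ω θ u ∧ CommutesWithJ J u

/-- `Θ = θ⁽²⁾` is a unital normal `*`-endomorphism of `B(L²(M,φ))` extending `θ` and
`j ∘ θ ∘ j`. -/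
structure IsExtension (M : VonNeumannAlgebra H) (j : (H →L[ℂ] H) → (H →L[ℂ] H))
    (θ : (H →L[ℂ] H) → (H →L[ℂ] H)) (Θ : (H →L[ℂ] H) → (H →L[ℂ] H)) : Prop where
  hom : IsStarHomOn (Set.univ : Set (H →L[ℂ] H)) Θ
  unital : Θ 1 = 1
  normal : IsNormalMapOn (Set.univ : Set (H →L[ℂ] H)) Θ
  onM : ∀ x ∈ M, Θ x = θ x
  onComm : ∀ x ∈ M, Θ (j x) = j (θ x)

/-- `θ` is extendable. -/
def Extendable (M : VonNeumannAlgebra H) (j : (H →L[ℂ] H) → (H →L[ℂ] H))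
    (θ : (H →L[ℂ] H) → (H →L[ℂ] H)) : Prop :=
  ∃ Θ : (H →L[ℂ] H) → (H →L[ℂ] H), IsExtension M j θ Θ

/-- An `E₀`-semigroup on the von Neumann probability space `(M, ⟨·Ω,Ω⟩)`. -/
structure IsE0Semigroup (M : VonNeumannAlgebra H) (Ω : H)
    (α : ℝ → (H →L[ℂ] H) → (H →L[ℂ] H)) : Prop where
  endo : ∀ t : ℝ, 0 ≤ t → StateEndo M Ω (α t)
  id0 : ∀ x ∈ M, α 0 x = x
  semigroup : ∀ s t : ℝ, 0 ≤ s → 0 ≤ t → ∀ x ∈ M, α s (α t x) = α (s + t) x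
  weakCont : ∀ x ∈ M, ∀ ξ η : H, ContinuousOn (fun t : ℝ => ⟪α t x ξ, η⟫_ℂ) (Set.Ici 0)

open Filter Topology Set MeasureTheory in
/-- Averages of a holomorphic function along horizontal segments: interior derivative. -/
theorem avg_hasDerivAt {E : Type} [NormedAddCommGroup E] [NormedSpace ℂ E] [CompleteSpace E]
    (f : ℂ → E) (hf : Continuous f) (c d : ℝ)
    (hd : ∀ z : ℂ, c < z.im → z.im < d → DifferentiableAt ℂ f z) (a : ℝ) (z : ℂ)
    (hz1 : c < z.im) (hz2 : z.im < d) :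
    HasDerivAt (fun w : ℂ => ∫ r in (0 : ℝ)..a, f (w + r)) (f (z + a) - f z) z := by
  set U : Set ℂ := {w | c < w.im ∧ w.im < d} with hU
  have hUo : IsOpen U :=
    (isOpen_lt continuous_const Complex.continuous_im).inter
      (isOpen_lt Complex.continuous_im continuous_const)
  have hdU : DifferentiableOn ℂ f U := fun w hw => (hd w hw.1 hw.2).differentiableWithinAt
  have hder : ContinuousOn (deriv f) U := (hdU.deriv hUo).continuousOn
  obtain ⟨ε, hε, hball⟩ := Metric.nhds_basis_closedBall.mem_iff.1 (hUo.mem_nhds (⟨hz1, hz2⟩ : z ∈ U))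
  have hshift : ∀ w ∈ U, ∀ r : ℝ, w + r ∈ U := by
    intro w hw r
    simpa [hU] using hw
  have hK : IsCompact ((fun p : ℂ × ℝ => p.1 + p.2) '' (Metric.closedBall z ε ×ˢ uIcc 0 a)) :=
    ((isCompact_closedBall z ε).prod isCompact_uIcc).image (by fun_prop)
  have hKU : ((fun p : ℂ × ℝ => p.1 + (p.2 : ℂ)) '' (Metric.closedBall z ε ×ˢ uIcc 0 a)) ⊆ U := by
    rintro _ ⟨p, hp, rfl⟩
    exact hshift _ (hball hp.1) _
  obtain ⟨C, hC⟩ := hK.exists_bound_of_continuousOn (hder.mono hKU)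
  have hcd : Continuous fun r : ℝ => deriv f (z + r) := by
    refine hder.comp_continuous (by fun_prop) (fun r => hshift _ ⟨hz1, hz2⟩ r)
  have key := intervalIntegral.hasDerivAt_integral_of_dominated_loc_of_deriv_le
    (μ := volume) (a := 0) (b := a)
    (F := fun (w : ℂ) (r : ℝ) => f (w + r)) (F' := fun (w : ℂ) (r : ℝ) => deriv f (w + r))
    (x₀ := z) (s := Metric.closedBall z ε) (bound := fun _ => C)
    (Metric.closedBall_mem_nhds z hε)
    (Eventually.of_forall fun w => (by fun_prop : Continuous fun r : ℝ => f (w + r)).aestronglyMeasurable)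
    ((by fun_prop : Continuous fun r : ℝ => f (z + r)).intervalIntegrable _ _)
    hcd.aestronglyMeasurable
    (Eventually.of_forall fun r hr w hw => hC _ ⟨(w, r), ⟨hw, uIoc_subset_uIcc hr⟩, rfl⟩)
    (intervalIntegrable_const)
    (Eventually.of_forall fun r hr w hw => by
      have := hshift w (hball hw) r
      exact ((hd _ this.1 this.2).hasDerivAt).comp_add_const w r)
  have h2 : ∫ r in (0 : ℝ)..a, deriv f (z + r) = f (z + a) - f z := by
    have := intervalIntegral.integral_eq_sub_of_hasDerivAt (a := 0) (b := a)
      (f := fun r : ℝ => f (z + r)) (f' := fun r : ℝ => deriv f (z + r))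
      (fun r _ => by
        have := hshift z ⟨hz1, hz2⟩ r
        have h3 := ((hd _ this.1 this.2).hasDerivAt).comp_const_add z r
        have h4 := h3.scomp r Complex.ofRealCLM.hasDerivAt
        simpa [Function.comp_def] using h4) (hcd.intervalIntegrable _ _)
    simpa using this
  rw [← h2]
  exact key.2

open Filter Topology Set MeasureTheory in
theorem avg_hasFDerivWithinAt {E : Type} [NormedAddCommGroup E] [NormedSpace ℂ E] [CompleteSpace E]
    (f : ℂ → E) (hf : Continuous f) (c d : ℝ)
    (hd : ∀ z : ℂ, c < z.im → z.im < d → DifferentiableAt ℂ f z) (a : ℝ) (z : ℂ) :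
    HasDerivWithinAt (fun w : ℂ => ∫ r in (0 : ℝ)..a, f (w + r)) (f (z + a) - f z)
      (closure {w : ℂ | c < w.im ∧ w.im < d}) z := by
  have hPc : Continuous (fun w : ℂ => ∫ r in (0 : ℝ)..a, f (w + r)) :=
    intervalIntegral.continuous_parametric_intervalIntegral_of_continuous' (by fun_prop) 0 a
  set U : Set ℂ := {w | c < w.im ∧ w.im < d} with hU
  have hUo : IsOpen U :=
    (isOpen_lt continuous_const Complex.continuous_im).inter
      (isOpen_lt Complex.continuous_im continuous_const)
  have hUc : Convex ℝ U := by
    have := (convex_Ioo c d).linear_preimage Complex.imLm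
    exact this
  have hD : ∀ w ∈ U, HasFDerivAt (fun w : ℂ => ∫ r in (0 : ℝ)..a, f (w + r))
      ((ContinuousLinearMap.toSpanSingleton ℂ (f (w + a) - f w)).restrictScalars ℝ) w :=
    fun w hw => (avg_hasDerivAt f hf c d hd a w hw.1 hw.2).hasFDerivAt.restrictScalars ℝ
  have hcont : Continuous fun w : ℂ =>
      ((ContinuousLinearMap.toSpanSingleton ℂ (f (w + a) - f w)).restrictScalars ℝ) := by
    refine (ContinuousLinearMap.continuous_restrictScalars ℝ).comp ?_
    exact (ContinuousLinearMap.toSpanSingletonCLE (𝕜 := ℂ) (E := E)).continuous.comp (by fun_prop)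
  have := hasFDerivWithinAt_closure_of_tendsto_fderiv (x := z)
    (f' := (ContinuousLinearMap.toSpanSingleton ℂ (f (z + a) - f z)).restrictScalars ℝ)
    (fun w hw => (hD w hw).differentiableAt.differentiableWithinAt) hUc hUo
    (fun y _ => hPc.continuousWithinAt)
    (Tendsto.congr' (by
      filter_upwards [self_mem_nhdsWithin] with w hw
      exact ((hD w hw).fderiv).symm) (hcont.continuousWithinAt (s := U) (x := z)))
  exact this.of_restrictScalars ℝ rfl

open Filter Topology Set MeasureTheory in
/-- The average of a continuous function that is holomorphic off a horizontal line. -/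
theorem avg_hasDerivAt_line {E : Type} [NormedAddCommGroup E] [NormedSpace ℂ E] [CompleteSpace E]
    (f : ℂ → E) (hf : Continuous f) (z : ℂ) (δ : ℝ) (hδ : 0 < δ)
    (hd : ∀ w : ℂ, z.im - δ < w.im → w.im < z.im + δ → w.im ≠ z.im → DifferentiableAt ℂ f w)
    (a : ℝ) :
    HasDerivAt (fun w : ℂ => ∫ r in (0 : ℝ)..a, f (w + r)) (f (z + a) - f z) z := by
  have h1 := avg_hasFDerivWithinAt f hf z.im (z.im + δ)
    (fun w h1 h2 => hd w (by linarith) h2 h1.ne') a z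
  have h2 := avg_hasFDerivWithinAt f hf (z.im - δ) z.im
    (fun w h1 h2 => hd w h1 (by linarith) h2.ne) a z
  have hcl : ∀ c d : ℝ, c < d → {w : ℂ | c ≤ w.im ∧ w.im ≤ d} ⊆
      closure {w : ℂ | c < w.im ∧ w.im < d} := by
    intro c d hcd
    have h3 : {w : ℂ | c < w.im ∧ w.im < d} = univ ×ℂ Ioo c d := by
      ext w; simp [Complex.mem_reProdIm]
    rw [h3, Complex.closure_reProdIm, closure_Ioo hcd.ne]
    intro w hw
    simp [Complex.mem_reProdIm]
    exact hw
  have h3 := h1.union h2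
  refine h3.hasDerivAt ?_
  have h4 : {w : ℂ | z.im - δ < w.im ∧ w.im < z.im + δ} ∈ 𝓝 z := by
    refine IsOpen.mem_nhds ((isOpen_lt continuous_const Complex.continuous_im).inter
      (isOpen_lt Complex.continuous_im continuous_const)) ?_
    constructor <;> simp <;> linarith
  filter_upwards [h4] with w hw
  rcases le_total w.im z.im with h | h
  · exact Or.inr (hcl _ _ (by linarith) ⟨hw.1.le, h⟩)
  · exact Or.inl (hcl _ _ (by linarith) ⟨h, hw.2.le⟩)

open Filter Topology Set MeasureTheory in
/-- A function on the closed strip, holomorphic inside and vanishing on the real line, is zero. -/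
theorem strip_unique {E : Type} [NormedAddCommGroup E] [NormedSpace ℂ E] [CompleteSpace E]
    (D : ℂ → E) (hc : ContinuousOn D {z : ℂ | -(1 / 2) ≤ z.im ∧ z.im ≤ 0})
    (hd : DifferentiableOn ℂ D {z : ℂ | -(1 / 2) < z.im ∧ z.im < 0})
    (h0 : ∀ t : ℝ, D t = 0) (z : ℂ) (hz : -(1 / 2) ≤ z.im ∧ z.im ≤ 0) : D z = 0 := by
  set cl : ℂ → ℂ := fun w => ⟨w.re, max (-(1/2)) (min w.im 0)⟩ with hcl
  have hclc : Continuous cl := by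
    have : cl = fun w : ℂ => (w.re : ℂ) + ((max (-(1/2)) (min w.im 0) : ℝ) : ℂ) * Complex.I := by
      ext w
      apply Complex.ext <;> simp [hcl]
    rw [this]
    fun_prop
  set f : ℂ → E := fun w => D (cl w) with hfdef
  have hf : Continuous f := hc.comp_continuous hclc (fun w => by simp [hcl])
  have hUo : IsOpen {z : ℂ | -(1 / 2) < z.im ∧ z.im < 0} :=
    (isOpen_lt continuous_const Complex.continuous_im).inter
      (isOpen_lt Complex.continuous_im continuous_const)
  have hfs : ∀ w : ℂ, -(1/2) ≤ w.im → w.im ≤ 0 → f w = D w := by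
    intro w h1 h2
    simp only [hfdef, hcl, min_eq_left h2, max_eq_right h1]
  have hfp : ∀ w : ℂ, 0 ≤ w.im → f w = 0 := by
    intro w h1
    have : cl w = ((w.re : ℝ) : ℂ) := by
      apply Complex.ext <;> simp [hcl, h1]
    simp only [hfdef, this, h0]
  have hfd : ∀ w : ℂ, -(1/2) < w.im → w.im ≠ 0 → DifferentiableAt ℂ f w := by
    intro w h1 h2
    rcases lt_or_gt_of_ne h2 with h | h
    · have hm := hUo.mem_nhds (⟨h1, h⟩ : w ∈ {z : ℂ | -(1 / 2) < z.im ∧ z.im < 0})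
      refine (hd.differentiableAt hm).congr_of_eventuallyEq ?_
      filter_upwards [hm] with v hv
      exact hfs v hv.1.le hv.2.le
    · refine (differentiableAt_const (0 : E)).congr_of_eventuallyEq ?_
      filter_upwards [(isOpen_lt continuous_const Complex.continuous_im).mem_nhds h] with v hv
      exact hfp v (le_of_lt hv)
  have hV : IsOpen {w : ℂ | -(1/2) < w.im} := isOpen_lt continuous_const Complex.continuous_im
  have hVc : Convex ℝ {w : ℂ | -(1/2) < w.im} :=
    (convex_Ioi (-(1/2) : ℝ)).linear_preimage Complex.imLm
  -- interior points
  have hint : ∀ w : ℂ, -(1/2) < w.im → f w = 0 := by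
    intro w hw
    have hP : ∀ a : ℝ, ∫ r in (0 : ℝ)..a, f (w + r) = 0 := by
      intro a
      have hPd : DifferentiableOn ℂ (fun w : ℂ => ∫ r in (0 : ℝ)..a, f (w + r))
          {w : ℂ | -(1/2) < w.im} := by
        intro v hv
        rcases eq_or_ne v.im 0 with h | h
        · exact (avg_hasDerivAt_line f hf v (1/2) (by norm_num)
            (fun y h1 h2 h3 => hfd y (by linarith) (by rwa [h] at h3)) a).differentiableAt.differentiableWithinAt
        · rcases lt_or_gt_of_ne h with h' | h'
          · exact (avg_hasDerivAt f hf (-(1/2)) 0 (fun y h1 h2 => hfd y h1 h2.ne) a v hv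
              h').differentiableAt.differentiableWithinAt
          · exact (avg_hasDerivAt f hf 0 (v.im + 1) (fun y h1 h2 => hfd y (by linarith) h1.ne') a v
              h' (by linarith)).differentiableAt.differentiableWithinAt
      have hI : Complex.I ∈ {w : ℂ | -(1/2) < w.im} := by
        simp only [mem_ofPred_eq, Complex.I_im]; norm_num
      have := (hPd.analyticOnNhd hV).eqOn_zero_of_preconnected_of_eventuallyEq_zero
        hVc.isPreconnected hI (by
          have : {w : ℂ | 0 < w.im} ∈ 𝓝 Complex.I :=
            (isOpen_lt continuous_const Complex.continuous_im).mem_nhds (by simp)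
          filter_upwards [this] with v hv
          have hv' : 0 < v.im := hv
          have : ∀ r : ℝ, f (v + r) = 0 := fun r => hfp _ (by simpa using hv'.le)
          simp [this])
      exact this hw
    have h1 := ((by fun_prop : Continuous fun r : ℝ => f (w + r)).integral_hasStrictDerivAt 0 0).hasDerivAt
    have h2 : HasDerivAt (fun a : ℝ => ∫ r in (0 : ℝ)..a, f (w + r)) (0 : E) 0 := by
      simp only [hP]
      exact hasDerivAt_const _ _
    simpa using h1.unique h2
  rw [← hfs z hz.1 hz.2]
  rcases hz.1.lt_or_eq with h | h
  · exact hint z h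
  · have hcl2 : z ∈ closure {w : ℂ | -(1/2) < w.im} := by
      rw [Complex.closure_setOfPred_lt_im]
      exact hz.1
    have hcs : IsClosed {w : ℂ | f w = 0} := isClosed_eq hf continuous_const
    exact hcs.closure_subset_iff.2 hint hcl2

open Filter Topology Set MeasureTheory in
/-- A bounded function on the closed strip, holomorphic inside, with equal boundary values on the
two sides, is constant. -/
theorem strip_const (g : ℂ → ℂ) (hc : ContinuousOn g {z : ℂ | -(1 / 2) ≤ z.im ∧ z.im ≤ 0})
    (hd : DifferentiableOn ℂ g {z : ℂ | -(1 / 2) < z.im ∧ z.im < 0})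
    (hper : ∀ t : ℝ, g (t + (-(1 / 2) * Complex.I)) = g t)
    (C : ℝ) (hb : ∀ z : ℂ, -(1 / 2) ≤ z.im → z.im ≤ 0 → ‖g z‖ ≤ C) (t : ℝ) : g t = g 0 := by
  set sh : ℤ → ℂ → ℂ := fun n z => z - (n / 2 : ℝ) * Complex.I with hsh
  have shim : ∀ n z, (sh n z).im = z.im - n / 2 := by intro n z; simp [hsh]
  have shc : ∀ n, Continuous (sh n) := by intro n; simp only [hsh]; fun_prop
  set h : ℂ → ℂ := fun z => g (sh ⌈2 * z.im⌉ z) with hh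
  have hceil : ∀ z : ℂ, (⌈2 * z.im⌉ : ℝ) < 2 * z.im + 1 ∧ 2 * z.im ≤ (⌈2 * z.im⌉ : ℝ) :=
    fun z => ⟨Int.ceil_lt_add_one _, Int.le_ceil _⟩
  -- `h` on the closed strips
  have hS : ∀ (n : ℤ) (z : ℂ), ((n : ℝ) - 1) / 2 ≤ z.im → z.im ≤ n / 2 → h z = g (sh n z) := by
    intro n z h1 h2
    rcases h1.lt_or_eq with h1' | h1'
    · have : ⌈2 * z.im⌉ = n := by
        rw [Int.ceil_eq_iff]; constructor <;> linarith
      simp only [hh, this]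
    · have : ⌈2 * z.im⌉ = n - 1 := by
        rw [Int.ceil_eq_iff]; push_cast; constructor <;> linarith
      simp only [hh, this]
      have e1 : sh (n - 1) z = ((z.re : ℝ) : ℂ) := by
        apply Complex.ext <;> simp [hsh]
        linarith
      have e2 : sh n z = (z.re : ℂ) + (-(1 / 2) * Complex.I) := by
        apply Complex.ext <;> simp [hsh]
        linarith
      rw [e1, e2, hper]
  have hSc : ∀ n : ℤ, ContinuousOn h {z : ℂ | ((n : ℝ) - 1) / 2 ≤ z.im ∧ z.im ≤ n / 2} := by
    intro n
    refine (hc.comp (shc n).continuousOn ?_).congr (fun z hz => hS n z hz.1 hz.2)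
    intro z hz
    have h1 := hz.1
    have h2 := hz.2
    refine ⟨?_, ?_⟩ <;> rw [shim] <;> linarith
  have hcl : ∀ a b : ℝ, IsClosed {z : ℂ | a ≤ z.im ∧ z.im ≤ b} := fun a b =>
    (isClosed_le continuous_const Complex.continuous_im).inter
      (isClosed_le Complex.continuous_im continuous_const)
  have hop : ∀ a b : ℝ, IsOpen {z : ℂ | a < z.im ∧ z.im < b} := fun a b =>
    (isOpen_lt continuous_const Complex.continuous_im).inter
      (isOpen_lt Complex.continuous_im continuous_const)
  have hcont : Continuous h := by
    rw [continuous_iff_continuousAt]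
    intro z
    obtain ⟨h1, h2⟩ := hceil z
    set n := ⌈2 * z.im⌉
    refine ((hSc n).union_of_isClosed (hSc (n + 1)) (hcl _ _) (hcl _ _)).continuousAt ?_
    filter_upwards [(hop (((n : ℝ) - 1) / 2) ((n + 1) / 2)).mem_nhds
      (show z ∈ _ from ⟨by linarith, by linarith⟩)] with w hw
    rcases le_total w.im (n / 2 : ℝ) with h3 | h3
    · exact Or.inl ⟨hw.1.le, h3⟩
    · refine Or.inr ⟨?_, ?_⟩
      · push_cast; linarith
      · push_cast; exact hw.2.le
  have hdiff : ∀ (n : ℤ) (z : ℂ), ((n : ℝ) - 1) / 2 < z.im → z.im < n / 2 →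
      DifferentiableAt ℂ h z := by
    intro n z h1 h2
    have h3 : DifferentiableAt ℂ (fun w => g (sh n w)) z := by
      refine DifferentiableAt.comp z (hd.differentiableAt ((hop _ _).mem_nhds ?_)) ?_
      · refine ⟨?_, ?_⟩ <;> rw [shim] <;> linarith
      · simp only [hsh]; fun_prop
    refine h3.congr_of_eventuallyEq ?_
    filter_upwards [(hop _ _).mem_nhds (show z ∈ {z : ℂ | ((n : ℝ) - 1) / 2 < z.im ∧ z.im < n / 2}
      from ⟨h1, h2⟩)] with w hw
    exact hS n w hw.1.le hw.2.le
  have hder : ∀ z : ℂ, HasDerivAt (fun w : ℂ => ∫ r in (0 : ℝ)..t, h (w + r)) (h (z + t) - h z) z := by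
    intro z
    obtain ⟨h1, h2⟩ := hceil z
    set n := ⌈2 * z.im⌉
    rcases h2.lt_or_eq with h2 | h2
    · exact avg_hasDerivAt h hcont _ _ (hdiff n) t z (by linarith) (by linarith)
    · refine avg_hasDerivAt_line h hcont z (1 / 2) (by norm_num) ?_ t
      intro w h3 h4 h5
      rcases lt_or_gt_of_ne h5 with h5 | h5
      · exact hdiff n w (by linarith) (by linarith)
      · refine hdiff (n + 1) w ?_ ?_ <;> push_cast <;> linarith
  have hbd : ∀ z, ‖h z‖ ≤ C := by
    intro z
    obtain ⟨h1, h2⟩ := hceil z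
    apply hb <;> rw [shim] <;> linarith
  have hconst : ∀ z w : ℂ, (∫ r in (0 : ℝ)..t, h (z + r)) = ∫ r in (0 : ℝ)..t, h (w + r) := by
    have hD : Differentiable ℂ (fun w : ℂ => ∫ r in (0 : ℝ)..t, h (w + r)) :=
      fun z => (hder z).differentiableAt
    refine hD.apply_eq_apply_of_bounded ?_
    refine isBounded_iff_forall_norm_le.2 ⟨C * |t - 0|, ?_⟩
    rintro _ ⟨w, rfl⟩
    exact intervalIntegral.norm_integral_le_of_norm_le_const (fun r _ => hbd _)
  have h0 : HasDerivAt (fun w : ℂ => ∫ r in (0 : ℝ)..t, h (w + r)) 0 0 := by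
    have : (fun w : ℂ => ∫ r in (0 : ℝ)..t, h (w + r)) = fun _ => ∫ r in (0 : ℝ)..t, h (0 + r) := by
      funext w; exact hconst w 0
    rw [this]
    exact hasDerivAt_const _ _
  have h1 := (hder 0).unique h0
  have hr : ∀ s : ℝ, h s = g s := by
    intro s
    rw [hS 0 s (by simp; norm_num) (by simp)]
    simp [hsh]
  have h00 : h 0 = g 0 := by simpa using hr 0
  rw [zero_add, hr, h00] at h1
  exact sub_eq_zero.1 h1

/-- **(Remark 3.3, first part.)**  Let `θ` be an equi-modular endomorphism of `(M, φ)` in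
standard form, with implementing isometry `u`, and let `Δ^{it}` (together with `J`) be the
modular data of `(M, Ω)` — a strongly continuous one-parameter unitary group fixing `Ω`,
implementing the modular automorphism group `σ^φ_t = Ad Δ^{it}` of `M`, and satisfying the
Tomita relation `J Δ^{1/2} (x Ω) = x* Ω`, expressed through analytic continuation of
`t ↦ Δ^{it} x Ω` to the strip `-1/2 ≤ Im z ≤ 0`.  Then `Δ^{it}` commutes with `u` for all
`t ∈ ℝ`, `θ ∘ σ^φ_t = σ^φ_t ∘ θ` on `M`, and `σ^φ_t (θ(M)) = θ(M)`. -/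
theorem remark_3_3_modular
    (M : VonNeumannAlgebra H) (Ω : H) (J : H → H) (j : (H →L[ℂ] H) → (H →L[ℂ] H))
    (hSF : StandardForm M Ω J j) (hM : IsFactorSet (M : Set (H →L[ℂ] H)))
    (θ : (H →L[ℂ] H) → (H →L[ℂ] H)) (hθ : StateEndo M Ω θ)
    (u : H →L[ℂ] H) (hu : Implements M Ω θ u) (hequi : CommutesWithJ J u)
    -- the modular group `Δ^{it}`:
    (Δit : ℝ → (H →L[ℂ] H))
    (hΔ0 : Δit 0 = 1)
    (hΔgrp : ∀ s t : ℝ, Δit (s + t) = Δit s * Δit t)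
    (hΔadj : ∀ t : ℝ, ContinuousLinearMap.adjoint (Δit t) = Δit (-t))
    (hΔΩ : ∀ t : ℝ, Δit t Ω = Ω)
    (hΔcont : ∀ ξ η : H, Continuous fun t : ℝ => ⟪Δit t ξ, η⟫_ℂ)
    (hΔM : ∀ t : ℝ, (fun x => Δit t * x * Δit (-t)) '' (M : Set (H →L[ℂ] H)) =
      (M : Set (H →L[ℂ] H)))
    -- the Tomita relation `S = J Δ^{1/2}`, i.e. `J Δ^{1/2} x Ω = x* Ω`, via analytic
    -- continuation of `t ↦ Δ^{it} x Ω` to the point `z = -i/2`: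
    (hTomita : ∀ x ∈ M, ∃ F : ℂ → H,
      ContinuousOn F {z : ℂ | -(1 / 2) ≤ z.im ∧ z.im ≤ 0} ∧
      DifferentiableOn ℂ F {z : ℂ | -(1 / 2) < z.im ∧ z.im < 0} ∧
      (∀ t : ℝ, F (t : ℂ) = Δit t (x Ω)) ∧
      J (F (-(1 / 2) * Complex.I)) = (star x) Ω) :
    -- `Δ^{it}` commutes with `u_θ`:
    (∀ (t : ℝ) (ξ : H), Δit t (u ξ) = u (Δit t ξ)) ∧
    -- `θ` commutes with the modular automorphism group:
    (∀ t : ℝ, ∀ x ∈ M, θ (Δit t * x * Δit (-t)) = Δit t * θ x * Δit (-t)) ∧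
    -- hence `σ^φ_t (θ(M)) = θ(M)`:
    ∀ t : ℝ, (fun x => Δit t * x * Δit (-t)) '' (θ '' (M : Set (H →L[ℂ] H))) =
      θ '' (M : Set (H →L[ℂ] H)) := by
  classical
  have hsep := hSF.separating
  -- `J` as a continuous conjugate-linear map
  have Jnorm : ∀ ξ, ‖J ξ‖ = ‖ξ‖ := by
    intro ξ
    have h1 := hSF.Jinner ξ ξ
    rw [inner_self_eq_norm_sq_to_K, inner_self_eq_norm_sq_to_K] at h1
    have h2 : ‖J ξ‖ ^ 2 = ‖ξ‖ ^ 2 := by exact_mod_cast h1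
    exact (sq_eq_sq₀ (norm_nonneg _) (norm_nonneg _)).1 h2
  let JL : H →L⋆[ℂ] H := LinearMap.mkContinuous
    { toFun := J, map_add' := hSF.Jadd, map_smul' := hSF.Jsmul } 1
    (fun ξ => by simp [Jnorm])
  have JL_apply : ∀ ξ, JL ξ = J ξ := fun _ => rfl
  have Jcont : Continuous J := JL.continuous
  let B : H →L[ℂ] H →L[ℂ] ℂ := (innerSL ℂ).comp JL
  have B_apply : ∀ ξ η, B ξ η = ⟪J ξ, η⟫_ℂ := fun _ _ => rfl
  -- unitarity
  have Uinv : ∀ t ξ, Δit (-t) (Δit t ξ) = ξ := by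
    intro t ξ
    have h1 := hΔgrp (-t) t
    rw [neg_add_cancel, hΔ0] at h1
    have h2 := congrArg (fun A : H →L[ℂ] H => A ξ) h1
    simpa using h2.symm
  have Uinner : ∀ t ξ η, ⟪Δit t ξ, Δit t η⟫_ℂ = ⟪ξ, η⟫_ℂ := by
    intro t ξ η
    rw [← ContinuousLinearMap.adjoint_inner_right, hΔadj, Uinv]
  have Unorm : ∀ t ξ, ‖Δit t ξ‖ = ‖ξ‖ := by
    intro t ξ
    have h1 := Uinner t ξ ξ
    rw [inner_self_eq_norm_sq_to_K, inner_self_eq_norm_sq_to_K] at h1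
    have h2 : ‖Δit t ξ‖ ^ 2 = ‖ξ‖ ^ 2 := by exact_mod_cast h1
    exact (sq_eq_sq₀ (norm_nonneg _) (norm_nonneg _)).1 h2
  have σmem : ∀ t, ∀ x ∈ M, Δit t * x * Δit (-t) ∈ M := by
    intro t x hx
    have : (fun x => Δit t * x * Δit (-t)) x ∈ (M : Set (H →L[ℂ] H)) := by
      rw [← hΔM t]; exact ⟨x, hx, rfl⟩
    exact this
  have σΩ : ∀ t x, (Δit t * x * Δit (-t)) Ω = Δit t (x Ω) := by
    intro t x
    simp [hΔΩ]
  choose! F hFc hFd hFr hFJ using hTomita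
  have hstrip : ∀ t : ℝ, ∀ z : ℂ, ((t : ℂ) + z).im = z.im := by intro t z; simp
  -- translation covariance
  have hA : ∀ x ∈ M, ∀ t : ℝ, ∀ z : ℂ, (-(1 / 2) ≤ z.im ∧ z.im ≤ 0) →
      F x (t + z) = Δit t (F x z) := by
    intro x hx t z hz
    rw [← sub_eq_zero]
    refine strip_unique (fun w => F x (t + w) - Δit t (F x w)) ?_ ?_ ?_ z hz
    · refine ContinuousOn.sub ?_ ((Δit t).continuous.comp_continuousOn (hFc x hx))
      refine (hFc x hx).comp (by fun_prop) ?_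
      intro w hw
      simpa using hw
    · refine DifferentiableOn.sub ?_ ((Δit t).differentiable.comp_differentiableOn (hFd x hx))
      refine (hFd x hx).comp (by fun_prop) ?_
      intro w hw
      simpa using hw
    · intro s
      have h1 := hFr x hx (t + s)
      rw [Complex.ofReal_add] at h1
      simp only [h1, hFr x hx s, hΔgrp]
      simp
  have hB : ∀ x ∈ M, ∀ t : ℝ, ∀ z : ℂ, (-(1 / 2) ≤ z.im ∧ z.im ≤ 0) →
      F (Δit t * x * Δit (-t)) z = Δit t (F x z) := by
    intro x hx t z hz
    have hx' := σmem t x hx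
    rw [← sub_eq_zero]
    refine strip_unique (fun w => F (Δit t * x * Δit (-t)) w - Δit t (F x w)) ?_ ?_ ?_ z hz
    · exact (hFc _ hx').sub ((Δit t).continuous.comp_continuousOn (hFc x hx))
    · exact (hFd _ hx').sub ((Δit t).differentiable.comp_differentiableOn (hFd x hx))
    · intro s
      simp only [hFr x hx s, hFr _ hx' s, σΩ]
      have h1 : Δit s * Δit t = Δit t * Δit s := by rw [← hΔgrp, ← hΔgrp, add_comm]
      have h2 := congrArg (fun A : H →L[ℂ] H => A (x Ω)) h1
      simpa [sub_eq_zero] using h2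
  have hhalf : -(1 / 2) ≤ (-(1 / 2) * Complex.I).im ∧ (-(1 / 2) * Complex.I).im ≤ 0 := by
    norm_num
  have hFJ' : ∀ x ∈ M, F x (-(1 / 2) * Complex.I) = J (star x Ω) := by
    intro x hx
    rw [← hFJ x hx, hSF.Jinvol]
  -- `J` commutes with the modular group
  have hJU : ∀ t ξ, J (Δit t ξ) = Δit t (J ξ) := by
    intro t
    have h1 : ∀ η, J (Δit t (J η)) = Δit t η := by
      have hcl : IsClosed {η : H | J (Δit t (J η)) = Δit t η} :=
        isClosed_eq (Jcont.comp ((Δit t).continuous.comp Jcont)) (Δit t).continuous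
      have hsub : {ξ : H | ∃ x ∈ M, x Ω = ξ} ⊆ {η : H | J (Δit t (J η)) = Δit t η} := by
        rintro _ ⟨x, hx, rfl⟩
        show J (Δit t (J (x Ω))) = Δit t (x Ω)
        have hx' : star x ∈ M := star_mem hx
        have h2 := hFJ' _ hx'
        rw [star_star] at h2
        rw [← h2, ← hB _ hx' t _ hhalf, hFJ _ (σmem t _ hx')]
        have h3 : star (Δit t * star x * Δit (-t)) = Δit t * x * Δit (-t) := by
          have e : ∀ s, star (Δit s) = Δit (-s) := fun s => hΔadj s
          rw [star_mul, star_mul, star_star, e, e, neg_neg, mul_assoc]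
        rw [h3, σΩ]
      intro η
      exact hcl.closure_subset_iff.2 hsub (hSF.cyclic η)
    intro ξ
    have := h1 (J ξ)
    rwa [hSF.Jinvol] at this
  -- the two boundary values agree
  have hC : ∀ y ∈ M, ∀ w ∈ M, B (F y (-(1 / 2) * Complex.I)) (F w (-(1 / 2) * Complex.I)) =
      B (y Ω) (w Ω) := by
    intro y hy w hw
    rw [B_apply, B_apply, hFJ y hy, hFJ' w hw]
    have hw' : star w ∈ M := star_mem hw
    have h1 : J (star w Ω) = j (star w) Ω := by rw [hSF.jdef, hSF.JΩ]
    have h2 := hSF.jmapsTo _ hw'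
    have h3 : y (j (star w) Ω) = j (star w) (y Ω) := by
      have := congrArg (fun A : H →L[ℂ] H => A Ω) (h2 y hy)
      simpa using this
    have h4 : ⟪Ω, J (star w (J (y Ω)))⟫_ℂ = ⟪star w (J (y Ω)), Ω⟫_ℂ := by
      have := hSF.Jinner Ω (star w (J (y Ω)))
      rwa [hSF.JΩ] at this
    rw [h1, ContinuousLinearMap.star_eq_adjoint, ContinuousLinearMap.adjoint_inner_left, h3, hSF.jdef, h4,
      ContinuousLinearMap.star_eq_adjoint, ContinuousLinearMap.adjoint_inner_left]
  have hD : ∀ x ∈ M, u (F x (-(1 / 2) * Complex.I)) = F (θ x) (-(1 / 2) * Complex.I) := by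
    intro x hx
    rw [hFJ' x hx, hFJ' _ (hθ.mapsTo hx), hequi, hu.2 _ (star_mem hx), hθ.hom.map_star x hx]
  -- the main computation
  have hmain : ∀ x ∈ M, ∀ y ∈ M, ∀ t : ℝ,
      B (Δit t (y Ω)) (u (Δit t (x Ω))) = B (y Ω) (u (x Ω)) := by
    intro x hx y hy t
    have hFbd : ∀ x ∈ M, ∃ C : ℝ, ∀ z : ℂ, -(1 / 2) ≤ z.im → z.im ≤ 0 → ‖F x z‖ ≤ C := by
      intro x hx
      have hcomp : ContinuousOn (fun s : ℝ => F x ((s : ℂ) * Complex.I)) (Set.Icc (-(1/2)) 0) := by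
        refine (hFc x hx).comp (by fun_prop) ?_
        intro s hs
        simpa using hs
      obtain ⟨C, hC⟩ := isCompact_Icc.exists_bound_of_continuousOn hcomp
      refine ⟨C, fun z h1 h2 => ?_⟩
      have h3 := hA x hx z.re ((z.im : ℂ) * Complex.I) (by
        rw [show ((z.im : ℂ) * Complex.I).im = z.im by simp]; exact ⟨h1, h2⟩)
      rw [Complex.re_add_im] at h3
      rw [h3, Unorm]
      exact hC z.im ⟨h1, h2⟩
    obtain ⟨Cx, hCx⟩ := hFbd x hx
    obtain ⟨Cy, hCy⟩ := hFbd y hy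
    have key := strip_const (fun z => B (F y z) (u (F x z))) ?_ ?_ ?_ (Cy * Cx) ?_ t
    · have h0x := hFr x hx 0
      have h0y := hFr y hy 0
      rw [hΔ0, Complex.ofReal_zero] at h0x h0y
      simp only [hFr x hx, hFr y hy, h0x, h0y] at key
      simpa using key
    · exact (B.continuous.comp_continuousOn (hFc y hy)).clm_apply
        (u.continuous.comp_continuousOn (hFc x hx))
    · exact (B.differentiable.comp_differentiableOn (hFd y hy)).clm_apply
        (u.differentiable.comp_differentiableOn (hFd x hx))
    · intro s
      show B (F y (s + -(1 / 2) * Complex.I)) (u (F x (s + -(1 / 2) * Complex.I))) =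
        B (F y s) (u (F x s))
      rw [hA y hy s _ hhalf, hA x hx s _ hhalf, ← hB y hy s _ hhalf, ← hB x hx s _ hhalf,
        hD _ (σmem s x hx), hC _ (σmem s y hy) _ (hθ.mapsTo (σmem s x hx)),
        ← hu.2 _ (σmem s x hx), σΩ, σΩ, hFr y hy, hFr x hx]
    · intro z h1 h2
      rw [B_apply]
      refine (norm_inner_le_norm _ _).trans ?_
      rw [Jnorm, hu.1]
      exact mul_le_mul (hCy z h1 h2) (hCx z h1 h2) (norm_nonneg _)
        ((norm_nonneg _).trans (hCy z h1 h2))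
  have hcomm : ∀ (t : ℝ) (ξ : H), Δit t (u ξ) = u (Δit t ξ) := by
    intro t
    have hx : ∀ x ∈ M, Δit t (u (x Ω)) = u (Δit t (x Ω)) := by
      intro x hx
      have h1 : ∀ η, ⟪Δit t (J η), u (Δit t (x Ω))⟫_ℂ = ⟪J η, u (x Ω)⟫_ℂ := by
        have hcl : IsClosed {η : H | ⟪Δit t (J η), u (Δit t (x Ω))⟫_ℂ = ⟪J η, u (x Ω)⟫_ℂ} :=
          isClosed_eq (((Δit t).continuous.comp Jcont).inner continuous_const)
            (Jcont.inner continuous_const)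
        have hsub : {ξ : H | ∃ x ∈ M, x Ω = ξ} ⊆
            {η : H | ⟪Δit t (J η), u (Δit t (x Ω))⟫_ℂ = ⟪J η, u (x Ω)⟫_ℂ} := by
          rintro _ ⟨y, hy, rfl⟩
          show ⟪Δit t (J (y Ω)), u (Δit t (x Ω))⟫_ℂ = ⟪J (y Ω), u (x Ω)⟫_ℂ
          have := hmain x hx y hy t
          rwa [B_apply, B_apply, hJU] at this
        intro η
        exact hcl.closure_subset_iff.2 hsub (hSF.cyclic η)
      have Uinv' : ∀ ξ, Δit t (Δit (-t) ξ) = ξ := by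
        intro ξ
        have := Uinv (-t) ξ
        rwa [neg_neg] at this
      refine ext_inner_left ℂ (fun v => ?_)
      have h2 := h1 (J (Δit (-t) v))
      rw [hSF.Jinvol, Uinv'] at h2
      rw [h2, ← Uinner t (Δit (-t) v), Uinv']
    have hcl : IsClosed {ξ : H | Δit t (u ξ) = u (Δit t ξ)} :=
      isClosed_eq ((Δit t).continuous.comp u.continuous) (u.continuous.comp (Δit t).continuous)
    have hsub : {ξ : H | ∃ x ∈ M, x Ω = ξ} ⊆ {ξ : H | Δit t (u ξ) = u (Δit t ξ)} := by
      rintro _ ⟨x, hx', rfl⟩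
      exact hx x hx'
    intro ξ
    exact hcl.closure_subset_iff.2 hsub (hSF.cyclic ξ)
  have hθσ : ∀ t : ℝ, ∀ x ∈ M, θ (Δit t * x * Δit (-t)) = Δit t * θ x * Δit (-t) := by
    intro t x hx
    rw [← sub_eq_zero]
    refine hsep _ (sub_mem (hθ.mapsTo (σmem t x hx)) (σmem t _ (hθ.mapsTo hx))) ?_
    rw [sub_apply, ← hu.2 _ (σmem t x hx), σΩ, σΩ, ← hu.2 x hx, hcomm, sub_self]
  refine ⟨hcomm, hθσ, fun t => ?_⟩
  apply Set.Subset.antisymm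
  · rintro _ ⟨_, ⟨x, hx, rfl⟩, rfl⟩
    exact ⟨_, σmem t x hx, hθσ t x hx⟩
  · rintro _ ⟨x, hx, rfl⟩
    have hx2 : x ∈ (fun x => Δit t * x * Δit (-t)) '' (M : Set (H →L[ℂ] H)) := by
      rw [hΔM t]; exact hx
    obtain ⟨y, hy, rfl⟩ := hx2
    exact ⟨θ y, ⟨y, hy, rfl⟩, (hθσ t y hy).symm⟩


end Paper
end
end
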